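/- arXiv:2311.16871 — 4 statements merged into one kernel-verified Lean document; each statement's English description precedes it below -/
import Mathlib

section
/- Fix an integer n ≥ 4. There exists a constant c = c(n) such that the following holds. Let r ≥ 1 be an integer and let F ∈ ℤ[X_1,…,X_n] be a homogeneous polynomial of degree d ≥ 1 which is r-irreducible over ℚ. Then there exists a nonzero homogeneous polynomial G ∈ ℚ[a_1,…,a_n] of degree at most c · d^3 such that for every a = (a_1,…,a_n) ∈ ℚ^n with a ≠ 0 and G(a) ≠ 0, the restriction of F to the hyperplane {x ∈ ℚ^n : a_1 x_1 + … + a_n x_n = 0} is r-irreducible over ℚ; precisely, for every injective ℚ-linear map φ : ℚ^{n−1} → ℚ^n whose image equals that hyperplane, the polynomial F ∘ φ ∈ ℚ[X_1,…,X_{n−1}] is r-irreducible over ℚ. -/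
open MvPolynomial

/-- The number of integral points of height at most `B` on the zero set of `f`. -/
noncomputable def Naff {n : ℕ} (f : MvPolynomial (Fin n) ℤ) (B : ℝ) : ℕ :=
  Set.ncard {x : Fin n → ℤ | MvPolynomial.eval x f = 0 ∧ ∀ i, (|x i| : ℝ) ≤ B}

/-- The linear form with coefficients `c`. -/
noncomputable def linForm {K : Type*} [CommSemiring K] {n : ℕ} (c : Fin n → K) :
    MvPolynomial (Fin n) K :=
  ∑ i, MvPolynomial.C (c i) * MvPolynomial.X i

/-- `f` is NCC (not cylindrical over a curve) over `K`: it cannot be written as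
`g(ℓ₁(x), ℓ₂(x))` for linear forms `ℓ₁, ℓ₂` over `K` and `g ∈ K[y₁,y₂]`. -/
def IsNCC {K : Type*} [CommSemiring K] {n : ℕ} (f : MvPolynomial (Fin n) K) : Prop :=
  ¬ ∃ (c c' : Fin n → K) (g : MvPolynomial (Fin 2) K),
      f = MvPolynomial.aeval ![linForm c, linForm c'] g

/-- `f` is `r`-irreducible: every divisor of `f` of total degree at most `r` is a unit. -/
def RIrreducible {K : Type*} [CommSemiring K] {n : ℕ} (r : ℕ) (f : MvPolynomial (Fin n) K) : Prop :=
  ∀ g : MvPolynomial (Fin n) K, g ∣ f → g.totalDegree ≤ r → IsUnit g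

namespace Polynomial

/-- Differentiation of a bivariate polynomial with respect to the inner variable. -/
noncomputable def innerDeriv (R : Type*) [CommRing R] :
    Polynomial (Polynomial R) →ₗ[R] Polynomial (Polynomial R) :=
  Bivariate.swap.toLinearMap ∘ₗ (derivative.restrictScalars R) ∘ₗ Bivariate.swap.toLinearMap

section innerDeriv
variable {R : Type*} [CommRing R]

lemma innerDeriv_C (a : Polynomial R) : innerDeriv R (C a) = C (derivative a) := by
  simp [innerDeriv, Bivariate.swap_C, derivative_map, Bivariate.swap_map_C]

lemma innerDeriv_mul (f g : Polynomial (Polynomial R)) :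
    innerDeriv R (f * g) = innerDeriv R f * g + f * innerDeriv R g := by
  simp [innerDeriv, Bivariate.swap_swap_apply]

lemma innerDeriv_monomial (n : ℕ) (a : Polynomial R) :
    innerDeriv R (monomial n a) = monomial n (derivative a) := by
  have hX : innerDeriv R (X ^ n) = 0 := by
    have : derivative (Bivariate.swap (X ^ n : Polynomial (Polynomial R))) = 0 := by
      rw [map_pow, Bivariate.swap_Y, ← C_pow, derivative_C]
    simp [innerDeriv, this, -map_pow]
  rw [← C_mul_X_pow_eq_monomial, innerDeriv_mul, hX, innerDeriv_C, mul_zero, add_zero,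
    C_mul_X_pow_eq_monomial]

lemma coeff_innerDeriv (f : Polynomial (Polynomial R)) (i : ℕ) :
    (innerDeriv R f).coeff i = derivative (f.coeff i) := by
  induction f using Polynomial.induction_on' with
  | add p q hp hq => simp [hp, hq]
  | monomial n a =>
    rw [innerDeriv_monomial, coeff_monomial, coeff_monomial]
    split_ifs <;> simp

lemma derivative_innerDeriv (f : Polynomial (Polynomial R)) :
    derivative (innerDeriv R f) = innerDeriv R (derivative f) := by
  ext i : 1
  simp only [coeff_derivative, coeff_innerDeriv, derivative_mul]
  simp

lemma innerDeriv_map {S : Type*} [CommRing S] (φ : R →+* S) (f : Polynomial (Polynomial R)) :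
    innerDeriv S (f.map (mapRingHom φ)) = (innerDeriv R f).map (mapRingHom φ) := by
  ext i : 1
  simp [coeff_innerDeriv, derivative_map]

/-- The chain rule along a parametrised curve. -/
lemma derivative_eval₂_powerSeries {A : Type*} [CommRing A] (ι : Polynomial R →+* PowerSeries A)
    (hι : ∀ a, PowerSeries.derivative A (ι a) = ι (derivative a)) (φ : PowerSeries A)
    (f : Polynomial (Polynomial R)) :
    PowerSeries.derivative A (f.eval₂ ι φ) =
      (derivative f).eval₂ ι φ * PowerSeries.derivative A φ + (innerDeriv R f).eval₂ ι φ := by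
  induction f using Polynomial.induction_on' with
  | add p q hp hq => simp only [eval₂_add, map_add, hp, hq]; ring
  | monomial n a =>
    rw [innerDeriv_monomial, derivative_monomial]
    simp only [eval₂_monomial, Derivation.leibniz, Derivation.leibniz_pow, hι, smul_eq_mul,
      map_mul, map_natCast, nsmul_eq_mul]
    ring

end innerDeriv

lemma exists_powerSeries_root {A : Type*} [CommRing A] (f : Polynomial (PowerSeries A))
    (hf : IsUnit f.leadingCoeff) (a : A)
    (h0 : (f.map PowerSeries.constantCoeff).eval a = 0)
    (h1 : IsUnit ((derivative f).map PowerSeries.constantCoeff |>.eval a)) :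
    ∃ φ : PowerSeries A, f.eval φ = 0 ∧ PowerSeries.constantCoeff φ = a := by
  obtain ⟨w, hw⟩ := hf
  have hm : (C (↑w⁻¹ : PowerSeries A) * f).Monic := by
    rw [Monic, leadingCoeff_C_mul_of_isUnit w⁻¹.isUnit, ← hw, Units.inv_mul]
  have hcc (p : Polynomial (PowerSeries A)) :
      PowerSeries.constantCoeff (p.eval (PowerSeries.C a)) =
        (p.map PowerSeries.constantCoeff).eval a := by
    rw [eval_map, eval, hom_eval₂, RingHom.comp_id, PowerSeries.constantCoeff_C]
  obtain ⟨φ, hφ, hφa⟩ := HenselianRing.is_henselian (I := Ideal.span {(PowerSeries.X : PowerSeries A)}) _ hm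
    (PowerSeries.C a) (by
      rw [Ideal.mem_span_singleton, PowerSeries.X_dvd_iff, hcc]
      simp [h0]) (by
      have : IsUnit ((derivative (C (↑w⁻¹ : PowerSeries A) * f)).eval (PowerSeries.C a)) := by
        rw [PowerSeries.isUnit_iff_constantCoeff, hcc]
        simp only [derivative_C_mul, Polynomial.map_mul, map_C, eval_mul, eval_C]
        exact (w⁻¹.isUnit.map _).mul h1
      exact this.map _)
  refine ⟨φ, ?_, ?_⟩
  · rw [IsRoot, eval_mul, eval_C] at hφ
    simpa using hφ
  · rw [Ideal.mem_span_singleton, PowerSeries.X_dvd_iff, map_sub, sub_eq_zero] at hφa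
    simpa using hφa

lemma dvd_of_irreducible_of_map_eq_zero {S B : Type*} [CommRing S] [IsDomain S]
    [UniqueFactorizationMonoid S] [CommRing B] {Φ Q : Polynomial S} (hΦ : Irreducible Φ)
    (hdeg : Φ.natDegree ≠ 0) (χ : Polynomial S →+* B) (hχ : ∀ c, χ (C c) = 0 → c = 0)
    (h1 : χ Φ = 0) (h2 : χ Q = 0) : Φ ∣ Q := by
  have hp := hΦ.isPrimitive hdeg
  let K := FractionRing S
  have hK := (hp.irreducible_iff_irreducible_map_fraction_map (K := K)).1 hΦ
  by_contra hd
  have hinj := IsFractionRing.injective S K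
  have hco : IsCoprime (Φ.map (algebraMap S K)) (Q.map (algebraMap S K)) := by
    refine (hK.coprime_iff_not_dvd).2 fun h => hd ?_
    exact hp.dvd_of_fraction_map_dvd_fraction_map h
  have hr : resultant (Φ.map (algebraMap S K)) (Q.map (algebraMap S K)) Φ.natDegree Q.natDegree ≠ 0 := by
    have := mt resultant_eq_zero_iff.1 (fun h => h.2 hco)
    rwa [natDegree_map_eq_of_injective hinj, natDegree_map_eq_of_injective hinj] at this
  rw [resultant_map_map] at hr
  obtain ⟨p, q, -, -, hpq⟩ := exists_mul_add_mul_eq_C_resultant Φ Q le_rfl le_rfl (by omega)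
  refine hr ?_
  rw [hχ (resultant Φ Q) (by rw [← hpq]; simp [h1, h2]), map_zero]

section blowUp
variable {W : Type*} [CommRing W]

/-- The substitution `z ↦ s y`, `y ↦ y` from `W[z][y]` to `W[s][y]`. -/
noncomputable def blowUp (W : Type*) [CommRing W] :
    Polynomial (Polynomial W) →+* Polynomial (Polynomial W) :=
  eval₂RingHom (eval₂RingHom (C.comp C) (C X * X)) X

lemma blowUp_monomial (i j : ℕ) (c : W) :
    blowUp W (monomial j (monomial i c)) = monomial (i + j) (monomial i c) := by
  rw [blowUp, coe_eval₂RingHom, eval₂_monomial, coe_eval₂RingHom, eval₂_monomial,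
    ← C_mul_X_pow_eq_monomial, ← C_mul_X_pow_eq_monomial, RingHom.comp_apply, C_mul, C_pow]
  ring

lemma coeff_blowUp (p : Polynomial (Polynomial W)) (i j : ℕ) :
    ((blowUp W p).coeff (i + j)).coeff i = (p.coeff j).coeff i := by
  induction p using Polynomial.induction_on' with
  | add p q hp hq => simp [hp, hq]
  | monomial n a =>
    induction a using Polynomial.induction_on' with
    | add p q hp hq => simp [hp, hq]
    | monomial m c =>
      rw [blowUp_monomial]
      simp only [coeff_monomial]
      by_cases h : m = i
      · subst h; simp
      · split_ifs <;> simp [coeff_monomial, h]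

lemma blowUp_injective : Function.Injective (blowUp W) := by
  intro p q h
  ext j i
  rw [← coeff_blowUp, h, coeff_blowUp]

lemma exists_blowUp_eq (q : Polynomial (Polynomial W)) :
    ∃ (k : ℕ) (p : Polynomial (Polynomial W)), blowUp W p = X ^ k * q := by
  have hX : blowUp W X = X := by simp [blowUp]
  have hadd (a b : Polynomial (Polynomial W))
      (ha : ∃ (k : ℕ) (p : Polynomial (Polynomial W)), blowUp W p = X ^ k * a)
      (hb : ∃ (k : ℕ) (p : Polynomial (Polynomial W)), blowUp W p = X ^ k * b) :
      ∃ (k : ℕ) (p : Polynomial (Polynomial W)), blowUp W p = X ^ k * (a + b) := by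
    obtain ⟨k, p, hp⟩ := ha
    obtain ⟨l, r, hr⟩ := hb
    refine ⟨k + l, X ^ l * p + X ^ k * r, ?_⟩
    simp only [map_add, map_mul, map_pow, hX, hp, hr]
    ring
  induction q using Polynomial.induction_on' with
  | add a b ha hb => exact hadd a b ha hb
  | monomial j a =>
    induction a using Polynomial.induction_on' with
    | add a b ha hb => rw [map_add]; exact hadd _ _ ha hb
    | monomial i c =>
      exact ⟨i, monomial j (monomial i c), by
        rw [blowUp_monomial, X_pow_mul_monomial, add_comm]⟩

lemma exists_map_blowUp_eq (Q : Polynomial (Polynomial (Polynomial W))) :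
    ∃ (k : ℕ) (P : Polynomial (Polynomial (Polynomial W))),
      P.map (blowUp W) = C (X ^ k) * Q := by
  have hX : blowUp W X = X := by simp [blowUp]
  induction Q using Polynomial.induction_on' with
  | add a b ha hb =>
    obtain ⟨k, p, hp⟩ := ha
    obtain ⟨l, r, hr⟩ := hb
    refine ⟨k + l, C (X ^ l) * p + C (X ^ k) * r, ?_⟩
    rw [Polynomial.map_add, Polynomial.map_mul, Polynomial.map_mul, map_C, map_C,
      map_pow (blowUp W), map_pow (blowUp W), hX, hp, hr, pow_add, C_mul]
    ring
  | monomial n a =>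
    obtain ⟨k, p, hp⟩ := exists_blowUp_eq a
    exact ⟨k, monomial n p, by rw [map_monomial, hp, C_mul_monomial]⟩

end blowUp

lemma exists_eq_C_mul_of_closed {A R : Type*} [CommRing A] [IsAddTorsionFree A] [CommRing R]
    (ι : Polynomial R →+* PowerSeries A)
    (hι : ∀ a, PowerSeries.derivative A (ι a) = ι (derivative a))
    {f g h : Polynomial (Polynomial R)}
    (hpde : f * (innerDeriv R g - derivative h) = g * innerDeriv R f - h * derivative f)
    {φ : PowerSeries A} (hf : f.eval₂ ι φ = 0) (hu : IsUnit ((derivative f).eval₂ ι φ)) :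
    ∃ c : A, g.eval₂ ι φ = PowerSeries.C c * (derivative f).eval₂ ι φ := by
  have hF := derivative_eval₂_powerSeries ι hι φ f
  have hG := derivative_eval₂_powerSeries ι hι φ g
  have hFx := derivative_eval₂_powerSeries ι hι φ (derivative f)
  have e1 := congrArg (eval₂ ι φ) hpde
  have e2 := congrArg (fun p => eval₂ ι φ (derivative p)) hpde
  simp only [derivative_mul, derivative_sub, derivative_innerDeriv, eval₂_add, eval₂_sub,
    eval₂_mul] at e1 e2
  rw [hf, map_zero] at hF
  rw [hf] at e1 e2
  obtain ⟨w, hw1⟩ := hu.exists_left_inv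
  set d := PowerSeries.derivative A
  set G := g.eval₂ ι φ
  set Fx := (derivative f).eval₂ ι φ
  have hh : h.eval₂ ι φ = - G * d φ := by
    linear_combination w * e1 - w * G * hF - (h.eval₂ ι φ + G * d φ) * hw1
  have key : Fx * d G = G * d Fx := by
    rw [hG, hFx]
    linear_combination e2 - eval₂ ι φ (derivative g) * hF -
      eval₂ ι φ (derivative (derivative f)) * hh
  have hρ : d (G * w) = 0 := by
    have h1 : d G = G * w * d Fx + Fx * d (G * w) := by
      have : G = G * w * Fx := by linear_combination -G * hw1
      conv_lhs => rw [this]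
      rw [Derivation.leibniz, smul_eq_mul, smul_eq_mul]
    linear_combination (-d (G * w) - w * d G) * hw1 - w * h1 + w ^ 2 * key
  refine ⟨PowerSeries.constantCoeff (G * w), ?_⟩
  have : G * w = PowerSeries.C (PowerSeries.constantCoeff (G * w)) :=
    PowerSeries.derivative.ext (by rw [PowerSeries.derivative_C]; exact hρ) (by simp)
  rw [← this]
  linear_combination -G * hw1

/-- Setting both inner variables to zero. -/
noncomputable def evalZeroZero (W : Type*) [CommRing W] : Polynomial (Polynomial W) →+* W :=
  (evalRingHom 0).comp (evalRingHom 0)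

/-- Bivariate polynomials as power series in the outer variable, after a change of coefficients. -/
noncomputable def toPowerSeriesHom {W E : Type*} [CommRing W] [CommRing E] (j : W →+* E) :
    Polynomial (Polynomial W) →+* PowerSeries (Polynomial E) :=
  coeToPowerSeries.ringHom.comp (mapRingHom (mapRingHom j))

section toPowerSeriesHom
variable {W E : Type*} [CommRing W] [CommRing E] (j : W →+* E)

lemma toPowerSeriesHom_apply (p : Polynomial (Polynomial W)) :
    toPowerSeriesHom j p = ((p.map (mapRingHom j) : Polynomial (Polynomial E)) :
      PowerSeries (Polynomial E)) := rfl

lemma toPowerSeriesHom_C (p : Polynomial W) :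
    toPowerSeriesHom j (C p) = PowerSeries.C (p.map j) := by
  simp [toPowerSeriesHom_apply]

lemma derivative_toPowerSeriesHom (p : Polynomial (Polynomial W)) :
    PowerSeries.derivative (Polynomial E) (toPowerSeriesHom j p) =
      toPowerSeriesHom j (derivative p) := by
  rw [toPowerSeriesHom_apply, toPowerSeriesHom_apply, PowerSeries.derivative_coe, derivative_map]

lemma toPowerSeriesHom_injective (hj : Function.Injective j) :
    Function.Injective (toPowerSeriesHom j) := by
  intro p q h
  exact map_injective _ (map_injective j hj) (Polynomial.coe_injective _ h)

lemma constantCoeff_comp_toPowerSeriesHom :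
    PowerSeries.constantCoeff.comp (toPowerSeriesHom j) =
      (mapRingHom j).comp (evalRingHom 0) := by
  ext <;> simp [toPowerSeriesHom_apply]

lemma constantCoeff_comp_toPowerSeriesHom_comp_blowUp :
    (PowerSeries.constantCoeff.comp (toPowerSeriesHom j)).comp (blowUp W) =
      (C.comp j).comp (evalZeroZero W) := by
  rw [constantCoeff_comp_toPowerSeriesHom]
  ext <;> simp [blowUp, evalZeroZero]

lemma evalZero_comp_map_comp_blowUp :
    ((evalRingHom 0).comp (mapRingHom (evalRingHom 0))).comp (blowUp W) = evalZeroZero W := by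
  ext <;> simp [blowUp, evalZeroZero]

lemma evalZero_comp_constantCoeff_comp_toPowerSeriesHom :
    ((evalRingHom 0).comp PowerSeries.constantCoeff).comp (toPowerSeriesHom j) =
      j.comp ((evalRingHom 0).comp (mapRingHom (evalRingHom 0))) := by
  rw [RingHom.comp_assoc, constantCoeff_comp_toPowerSeriesHom]
  ext <;> simp

end toPowerSeriesHom

lemma exists_monic_annihilator {W E : Type*} [CommRing W] [IsDomain W] [Field E] [Algebra W E]
    [Algebra.IsAlgebraic W E] [FaithfulSMul W E] (c : Polynomial E) (hc : c.eval 0 = 0) :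
    ∃ (w : W) (M : Polynomial (Polynomial W)), w ≠ 0 ∧ M.Monic ∧
      M.map (evalRingHom 0) = X ^ M.natDegree ∧
      M.eval₂ (mapRingHom (algebraMap W E)) (C (algebraMap W E w) * c) = 0 := by
  classical
  obtain ⟨e, rfl⟩ : X ∣ c := by rwa [X_dvd_iff, coeff_zero_eq_eval_zero]
  obtain ⟨w, hw0, hw⟩ := Algebra.IsAlgebraic.exists_integral_multiples W
    ((Finset.range (e.natDegree + 1)).image e.coeff)
  have hint : (mapRingHom (algebraMap W E)).IsIntegralElem (C (algebraMap W E w) * e) := by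
    rw [e.as_sum_range_C_mul_X_pow, Finset.mul_sum]
    refine Finset.sum_induction _ (mapRingHom (algebraMap W E)).IsIntegralElem
      (fun _ _ => RingHom.IsIntegralElem.add _) (RingHom.isIntegralElem_zero _) fun i hi => ?_
    rw [← mul_assoc, ← C_mul]
    obtain ⟨p, hp, hpe⟩ := hw _ (Finset.mem_image_of_mem _ hi)
    refine RingHom.IsIntegralElem.mul _ ⟨p.map C, hp.map C, ?_⟩ ?_
    · have hC : (mapRingHom (algebraMap W E)).comp C = C.comp (algebraMap W E) := by ext; simp
      rw [eval₂_map, hC, ← hom_eval₂, ← Algebra.smul_def, hpe, C_0]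
    · have := (mapRingHom (algebraMap W E)).isIntegralElem_map (x := X ^ i)
      simpa using this
  obtain ⟨m, hm, hme⟩ := hint
  refine ⟨w, m.scaleRoots X, hw0, (monic_scaleRoots_iff _).2 hm, ?_, ?_⟩
  · ext i
    rw [natDegree_scaleRoots, coeff_map, coeff_scaleRoots, coeff_X_pow]
    split_ifs with h
    · subst h
      simp [hm.coeff_natDegree]
    · rcases lt_or_gt_of_ne h with h | h
      · simp [Nat.sub_ne_zero_of_lt h]
      · simp [coeff_eq_zero_of_natDegree_lt h]
  · have := scaleRoots_eval₂_eq_zero (s := X) (mapRingHom (algebraMap W E)) hme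
    convert this using 1
    simp
    ring_nf

lemma exists_branch {W E : Type*} [CommRing W] [IsDomain W] [Field E] [CharZero E] (j : W →+* E)
    (hj : Function.Injective j) {Φ : Polynomial (Polynomial (Polynomial W))} {lc : W}
    (hΦ : Φ ≠ 0)
    (hlc : Φ.leadingCoeff = C (C lc)) {r : W} (hr : r ≠ 0) {A B : Polynomial W}
    (hAB : Φ.map (evalZeroZero W) * A + derivative (Φ.map (evalZeroZero W)) * B = C r)
    {g h : Polynomial (Polynomial (Polynomial W))}
    (hpde : Φ.map (blowUp W) * (innerDeriv _ g - derivative h) =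
      g * innerDeriv _ (Φ.map (blowUp W)) - h * derivative (Φ.map (blowUp W)))
    {a : E} (ha : (Φ.map (evalZeroZero W)).eval₂ j a = 0) :
    ∃ (φ : PowerSeries (Polynomial E)) (c : Polynomial E),
      (Φ.map (blowUp W)).eval₂ (toPowerSeriesHom j) φ = 0 ∧
      IsUnit ((derivative (Φ.map (blowUp W))).eval₂ (toPowerSeriesHom j) φ) ∧
      g.eval₂ (toPowerSeriesHom j) φ =
        PowerSeries.C c * (derivative (Φ.map (blowUp W))).eval₂ (toPowerSeriesHom j) φ ∧
      c.eval 0 * (derivative (Φ.map (evalZeroZero W))).eval₂ j a =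
        g.eval₂ (j.comp ((evalRingHom 0).comp (mapRingHom (evalRingHom 0)))) a ∧
      (derivative (Φ.map (evalZeroZero W))).eval₂ j a ≠ 0 := by
  have hne : (derivative (Φ.map (evalZeroZero W))).eval₂ j a ≠ 0 := by
    intro h0
    have := congrArg (eval₂ j a) hAB
    rw [eval₂_add, eval₂_mul, eval₂_mul, ha, h0, zero_mul, zero_mul, zero_add, eval₂_C] at this
    exact hr (hj (by rw [← this, map_zero]))
  have hlc0 : j lc ≠ 0 := by
    intro h0
    have : lc = 0 := hj (by rw [h0, map_zero])
    exact hΦ (leadingCoeff_eq_zero.1 (by rw [hlc, this, C_0, C_0]))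
  set f := Φ.map (blowUp W) with hf
  have hbl : ((toPowerSeriesHom j).comp (blowUp W)) (C (C lc)) = PowerSeries.C (C (j lc)) := by
    simp [blowUp, toPowerSeriesHom_apply]
  have hdeg : ((toPowerSeriesHom j).comp (blowUp W)) Φ.leadingCoeff ≠ 0 := by
    rw [hlc, hbl]
    intro h0
    apply hlc0
    have := congrArg PowerSeries.constantCoeff h0
    simpa using this
  have hlead : (f.map (toPowerSeriesHom j)).leadingCoeff = PowerSeries.C (C (j lc)) := by
    rw [hf, Polynomial.map_map, leadingCoeff_map_of_leadingCoeff_ne_zero _ hdeg, hlc, hbl]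
  have hcc (p : Polynomial (Polynomial (Polynomial W))) :
      (((p.map (blowUp W)).map (toPowerSeriesHom j)).map PowerSeries.constantCoeff).eval (C a) =
        C ((p.map (evalZeroZero W)).eval₂ j a) := by
    rw [Polynomial.map_map, Polynomial.map_map,
      constantCoeff_comp_toPowerSeriesHom_comp_blowUp, eval_map, hom_eval₂, eval₂_map]
  obtain ⟨φ, hφ, hφa⟩ := exists_powerSeries_root (f.map (toPowerSeriesHom j)) (by
      rw [hlead]
      exact ((isUnit_iff_ne_zero.2 hlc0).map C).map PowerSeries.C) (C a) (by
      rw [hf, hcc, ha, C_0]) (by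
      rw [derivative_map, hf, derivative_map, hcc, ← derivative_map]
      exact (isUnit_iff_ne_zero.2 hne).map C)
  rw [eval_map] at hφ
  have hcc' (p : Polynomial (Polynomial (Polynomial W))) :
      PowerSeries.constantCoeff (p.eval₂ (toPowerSeriesHom j) φ) =
        ((p.map (toPowerSeriesHom j)).map PowerSeries.constantCoeff).eval (C a) := by
    rw [hom_eval₂, hφa, eval_map, eval₂_map]
  have hcf : PowerSeries.constantCoeff ((derivative f).eval₂ (toPowerSeriesHom j) φ) =
      C ((derivative (Φ.map (evalZeroZero W))).eval₂ j a) := by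
    rw [hcc', hf, derivative_map, hcc, derivative_map]
  have hu : IsUnit ((derivative f).eval₂ (toPowerSeriesHom j) φ) := by
    rw [PowerSeries.isUnit_iff_constantCoeff, hcf]
    exact (isUnit_iff_ne_zero.2 hne).map C
  obtain ⟨c, hc⟩ := exists_eq_C_mul_of_closed (toPowerSeriesHom j)
    (derivative_toPowerSeriesHom j) hpde hφ hu
  refine ⟨φ, c, hφ, hu, hc, ?_, hne⟩
  have := congrArg (fun p => (PowerSeries.constantCoeff p).eval 0) hc
  simp only [map_mul, hcf, PowerSeries.constantCoeff_C, eval_mul, eval_C] at this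
  rw [← this, ← evalZero_comp_constantCoeff_comp_toPowerSeriesHom]
  change evalRingHom 0 _ = _
  rw [hom_eval₂, hom_eval₂, hφa]
  simp [RingHom.comp_assoc]

/-- An irreducible polynomial in three variables does not acquire, on the plane `s = 0` of its
blow-up, a factorization whose logarithmic derivative lifts to a closed form. -/
theorem false_of_closed_form_lift {W : Type*} [CommRing W] [IsDomain W]
    [UniqueFactorizationMonoid W] [CharZero W]
    {Φ : Polynomial (Polynomial (Polynomial W))} (hΦ : Irreducible Φ) (hdeg : Φ.natDegree ≠ 0)
    {lc : W} (hlc : Φ.leadingCoeff = C (C lc)) {r : W} (hr : r ≠ 0) {A B : Polynomial W}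
    (hAB : Φ.map (evalZeroZero W) * A + derivative (Φ.map (evalZeroZero W)) * B = C r)
    {u v : Polynomial (Polynomial W)}
    (huv : (Φ.map (blowUp W)).map (mapRingHom (evalRingHom 0)) = u * v)
    (hu : (u.map (evalRingHom 0)).natDegree ≠ 0) (hv : (v.map (evalRingHom 0)).natDegree ≠ 0)
    {g h : Polynomial (Polynomial (Polynomial W))}
    (hpde : Φ.map (blowUp W) * (innerDeriv _ g - derivative h) =
      g * innerDeriv _ (Φ.map (blowUp W)) - h * derivative (Φ.map (blowUp W)))
    {ε : W} (hε : ε ≠ 0)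
    (hg : g.map (mapRingHom (evalRingHom 0)) = C (C ε) * (derivative u * v)) : False := by
  let E := AlgebraicClosure (FractionRing W)
  let j := algebraMap W E
  have hj : Function.Injective j := by
    rw [show j = (algebraMap (FractionRing W) E).comp (algebraMap W (FractionRing W)) from
      IsScalarTower.algebraMap_eq _ _ _]
    exact (algebraMap (FractionRing W) E).injective.comp (IsFractionRing.injective W _)
  have : FaithfulSMul W E := (faithfulSMul_iff_algebraMap_injective W E).2 hj
  have : Algebra.IsAlgebraic W E :=
    (IsFractionRing.comap_isAlgebraic_iff (A := W) (K := FractionRing W) (C := E)).2 inferInstance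
  have : CharZero E := charZero_of_injective_ringHom hj
  have hroot (p : Polynomial W) (hp : p.natDegree ≠ 0) : ∃ a : E, p.eval₂ j a = 0 := by
    obtain ⟨a, ha⟩ := IsAlgClosed.exists_root (p.map j) (by
      rw [degree_map_eq_of_injective hj]
      exact fun h => hp (natDegree_eq_of_degree_eq_some h))
    exact ⟨a, by rwa [IsRoot, eval_map] at ha⟩
  set u0 := u.map (evalRingHom 0) with hu0
  set v0 := v.map (evalRingHom 0) with hv0
  have hf0 : Φ.map (evalZeroZero W) = u0 * v0 := by
    rw [hu0, hv0, ← Polynomial.map_mul, ← huv, Polynomial.map_map, Polynomial.map_map,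
      evalZero_comp_map_comp_blowUp]
  have hg0 (a : E) : g.eval₂ (j.comp ((evalRingHom 0).comp (mapRingHom (evalRingHom 0)))) a =
      j ε * ((derivative u0).eval₂ j a * v0.eval₂ j a) := by
    rw [← RingHom.comp_assoc, ← eval₂_map, hg, ← eval₂_map]
    simp [hu0, hv0, derivative_map, eval₂_mul]
  obtain ⟨α, hα⟩ := hroot v0 hv
  obtain ⟨β, hβ⟩ := hroot u0 hu
  obtain ⟨φα, cα, hfα, huα, hgα, hcα, hneα⟩ := exists_branch j hj hΦ.ne_zero hlc hr hAB hpde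
    (a := α) (by rw [hf0, eval₂_mul, hα, mul_zero])
  obtain ⟨φβ, cβ, hfβ, huβ, hgβ, hcβ, hneβ⟩ := exists_branch j hj hΦ.ne_zero hlc hr hAB hpde
    (a := β) (by rw [hf0, eval₂_mul, hβ, zero_mul])
  have hcα0 : cα.eval 0 = 0 := by
    rw [hg0, hα, mul_zero, mul_zero] at hcα
    exact (mul_eq_zero.1 hcα).resolve_right hneα
  have hcβ0 : cβ.eval 0 = j ε := by
    rw [hg0] at hcβ
    refine mul_right_cancel₀ hneβ (hcβ.trans ?_)
    rw [hf0, derivative_mul, eval₂_add, eval₂_mul, eval₂_mul, hβ, zero_mul, add_zero]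
  obtain ⟨w, M, hw, hM, hM0, hMα⟩ := exists_monic_annihilator (W := W) cα hcα0
  set f := Φ.map (blowUp W) with hf
  let Q : Polynomial (Polynomial (Polynomial W)) := ∑ i ∈ Finset.range (M.natDegree + 1),
    C (C (M.coeff i)) * (C (C (C w)) * g) ^ i * derivative f ^ (M.natDegree - i)
  have hQ (φ : PowerSeries (Polynomial E)) (c : Polynomial E)
      (hc : g.eval₂ (toPowerSeriesHom j) φ =
        PowerSeries.C c * (derivative f).eval₂ (toPowerSeriesHom j) φ) :
      Q.eval₂ (toPowerSeriesHom j) φ = PowerSeries.C (M.eval₂ (mapRingHom j) (C (j w) * c)) *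
        (derivative f).eval₂ (toPowerSeriesHom j) φ ^ M.natDegree := by
    rw [eval₂_finsetSum, eval₂_eq_sum_range, map_sum, Finset.sum_mul]
    refine Finset.sum_congr rfl fun i hi => ?_
    have hi : i + (M.natDegree - i) = M.natDegree := by
      have := Finset.mem_range.1 hi; omega
    conv_rhs => rw [← hi, pow_add]
    simp only [eval₂_mul, eval₂_pow, eval₂_C, hc, toPowerSeriesHom_C, map_C, map_mul, map_pow,
      coe_mapRingHom]
    ring
  obtain ⟨k, P, hP⟩ := exists_map_blowUp_eq Q
  have hχ (φ : PowerSeries (Polynomial E)) (p : Polynomial (Polynomial (Polynomial W))) :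
      eval₂RingHom ((toPowerSeriesHom j).comp (blowUp W)) φ p =
        (p.map (blowUp W)).eval₂ (toPowerSeriesHom j) φ := by
    rw [coe_eval₂RingHom, eval₂_map]
  have hdvd : Φ ∣ P := by
    refine dvd_of_irreducible_of_map_eq_zero hΦ hdeg
      (eval₂RingHom ((toPowerSeriesHom j).comp (blowUp W)) φα) ?_ ?_ ?_
    · intro c hc
      rw [coe_eval₂RingHom, eval₂_C] at hc
      exact blowUp_injective (toPowerSeriesHom_injective j hj (by simpa using hc))
    · rw [hχ, hfα]
    · rw [hχ, hP, eval₂_mul, hQ _ _ hgα, hMα, map_zero, zero_mul, mul_zero]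
  have hPβ : (P.map (blowUp W)).eval₂ (toPowerSeriesHom j) φβ = 0 := by
    obtain ⟨p, rfl⟩ := hdvd
    rw [Polynomial.map_mul, eval₂_mul, hfβ, zero_mul]
  rw [hP, eval₂_mul, eval₂_C, hQ _ _ hgβ] at hPβ
  have hX : toPowerSeriesHom j (X ^ k) ≠ 0 := fun h =>
    pow_ne_zero k X_ne_zero (toPowerSeriesHom_injective j hj (by rw [h, map_zero]))
  have h1 := (mul_eq_zero.1 ((mul_eq_zero.1 hPβ).resolve_left hX)).resolve_right
    (huβ.pow _).ne_zero
  have h2 := congrArg (evalRingHom 0) ((map_eq_zero_iff _ PowerSeries.C_injective).1 h1)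
  have hcomp : (evalRingHom 0).comp (mapRingHom j) = j.comp (evalRingHom 0) := by ext <;> simp
  rw [hom_eval₂, hcomp, ← eval₂_map, hM0, eval₂_pow, eval₂_X, map_zero] at h2
  have h3 := eq_zero_of_pow_eq_zero h2
  rw [coe_evalRingHom, eval_mul, eval_C, hcβ0, ← map_mul] at h3
  exact mul_ne_zero hw hε (hj (by rw [h3, map_zero]))

end Polynomial

namespace Matrix

lemma det_mul_eq_of_bordered_det_eq_zero {R n : Type*} [CommRing R] [IsDomain R] [Fintype n]
    [DecidableEq n] (A : Matrix n n R) (B : Matrix n Unit R) (C : Matrix Unit n R)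
    (D : Matrix Unit Unit R) (hA : A.det ≠ 0) (h : (fromBlocks A B C D).det = 0) :
    A.det • D = C * (A.adjugate * B) := by
  have h1 : fromBlocks A B C D * fromBlocks A.adjugate (-(A.adjugate * B)) 0 (A.det • 1) =
      fromBlocks (A.det • 1) 0 (C * A.adjugate) (A.det • D - C * (A.adjugate * B)) := by
    rw [fromBlocks_multiply]
    congr 1
    · simp [mul_adjugate]
    · rw [Matrix.mul_neg, ← Matrix.mul_assoc, mul_adjugate]; simp
    · simp
    · rw [Matrix.mul_neg, Matrix.mul_smul, Matrix.mul_one, neg_add_eq_sub]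
  have h2 := congrArg det h1
  rw [det_mul, h, zero_mul, det_fromBlocks_zero₁₂, det_smul, det_one, mul_one] at h2
  have h3 := (mul_eq_zero.1 h2.symm).resolve_left (pow_ne_zero _ hA)
  rw [det_unique, sub_apply, sub_eq_zero] at h3
  ext i j
  exact h3

/-- A vector killed by the specialization of a matrix lifts, up to a factor given by a maximal
nonzero minor, to a vector killed by the matrix. -/
lemma exists_det_ne_zero_forall_exists_lift {R W J ι : Type*} [CommRing R] [IsDomain R]
    [CommRing W] [Fintype J] (M : Matrix ι J R) :
    ∃ (k : ℕ) (r : Fin k → ι) (c : Fin k → J), k ≤ Fintype.card J ∧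
      (M.submatrix r c).det ≠ 0 ∧ ∀ (η : R →+* W) (V : J → R),
        (∀ i, η (∑ j, M i j * V j) = 0) →
        ∃ v : J → R, (∀ i, ∑ j, M i j * v j = 0) ∧
          ∀ j, η (v j) = η (M.submatrix r c).det * η (V j) := by
  classical
  let P : ℕ → Prop := fun k => ∃ (r : Fin k → ι) (c : Fin k → J), (M.submatrix r c).det ≠ 0
  have hP0 : P 0 := ⟨Fin.elim0, Fin.elim0, by simp⟩
  have hPle (k : ℕ) (hk : P k) : k ≤ Fintype.card J := by
    obtain ⟨r, c, h⟩ := hk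
    have hc : Function.Injective c := by
      intro a b hab
      by_contra hne
      exact h (det_zero_of_column_eq hne fun i => by simp [hab])
    simpa using Fintype.card_le_of_injective c hc
  have hmax := Nat.findGreatest_spec (P := P) (Nat.zero_le (Fintype.card J)) hP0
  set k := Nat.findGreatest P (Fintype.card J) with hk
  obtain ⟨r, c, hdet⟩ := hmax
  refine ⟨k, r, c, hPle k ⟨r, c, hdet⟩, hdet, fun η V hV => ?_⟩
  set A := M.submatrix r c with hA
  have hborder (i : ι) (j : J) :
      A.det * M i j = ∑ a, M i (c a) * ∑ b, A.adjugate a b * M (r b) j := by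
    have h0 : (fromBlocks A (of fun b (_ : Unit) => M (r b) j)
        (of fun (_ : Unit) a => M i (c a)) (of fun (_ _ : Unit) => M i j)).det = 0 := by
      by_contra hne
      have hPk : P (k + 1) := by
        let e : Fin (k + 1) ≃ Fin k ⊕ Unit := (Fintype.equivFinOfCardEq (by simp)).symm
        refine ⟨Sum.elim r (fun _ => i) ∘ e, Sum.elim c (fun _ => j) ∘ e, ?_⟩
        rw [← submatrix_submatrix, det_submatrix_equiv_self]
        convert hne using 2
        ext (a | a) (b | b) <;> rfl
      have := Nat.le_findGreatest (hPle _ hPk) hPk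
      omega
    have := congrFun (congrFun (det_mul_eq_of_bordered_det_eq_zero _ _ _ _ hdet h0) ()) ()
    simpa [mul_apply] using this
  let y : Fin k → R := fun a => ∑ b, A.adjugate a b * ∑ j, M (r b) j * V j
  have hy (a : Fin k) : η (y a) = 0 := by simp [y, hV]
  refine ⟨fun j => A.det * V j - ∑ a, if c a = j then y a else 0, fun i => ?_, fun j => ?_⟩
  · have h1 : ∑ j, M i j * ∑ a, (if c a = j then y a else 0) = ∑ a, M i (c a) * y a := by
      simp_rw [Finset.mul_sum]
      rw [Finset.sum_comm]
      simp
    simp_rw [mul_sub, Finset.sum_sub_distrib]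
    rw [h1, sub_eq_zero]
    calc ∑ j, M i j * (A.det * V j) = ∑ j, (A.det * M i j) * V j :=
          Finset.sum_congr rfl fun j _ => by ring
      _ = ∑ a, M i (c a) * y a := by
          simp_rw [hborder, y, Finset.sum_mul, Finset.mul_sum, Finset.sum_mul]
          rw [Finset.sum_comm]
          refine Finset.sum_congr rfl fun a _ => ?_
          rw [Finset.sum_comm]
          refine Finset.sum_congr rfl fun b _ => Finset.sum_congr rfl fun j _ => by ring
  · rw [map_sub, map_sum, map_mul]
    simp [apply_ite η, hy]

end Matrix

namespace MvPolynomial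

lemma totalDegree_det_le {σ W n : Type*} [CommRing W] [Fintype n] [DecidableEq n]
    (A : Matrix n n (MvPolynomial σ W)) (D : ℕ) (hD : ∀ i j, (A i j).totalDegree ≤ D) :
    A.det.totalDegree ≤ Fintype.card n * D := by
  rw [Matrix.det_apply]
  refine totalDegree_finsetSum_le fun p _ => ?_
  have : Equiv.Perm.sign p • ∏ i, A (p i) i = C ((Equiv.Perm.sign p : ℤ) : W) * ∏ i, A (p i) i := by
    rw [Units.smul_def, zsmul_eq_mul]; simp
  rw [this]
  refine (totalDegree_mul _ _).trans ?_
  rw [totalDegree_C, zero_add]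
  refine (totalDegree_finsetProd _ _).trans ?_
  refine (Finset.sum_le_card_nsmul _ _ D fun i _ => hD _ _).trans ?_
  simp

/-- A multiplicative filtration which contains the images of the variables in degree one contains
the image of a polynomial in its total degree. -/
lemma aeval_mem_of_filtration {K A σ : Type*} [CommSemiring K] [CommSemiring A] [Algebra K A]
    (P : ℕ → A → Prop) (hmono : ∀ k l a, k ≤ l → P k a → P l a)
    (hadd : ∀ k a b, P k a → P k b → P k (a + b)) (hmul : ∀ k l a b, P k a → P l b → P (k + l) (a * b))
    (hC : ∀ c, P 0 (algebraMap K A c)) {ℓ : σ → A} (hℓ : ∀ i, P 1 (ℓ i))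
    {F : MvPolynomial σ K} {d : ℕ} (hF : F.totalDegree ≤ d) : P d (aeval ℓ F) := by
  classical
  rw [aeval_def, eval₂_eq]
  refine Finset.sum_induction _ (P d) (hadd d) ?_ fun s hs => ?_
  · simpa using hmono 0 d _ (Nat.zero_le _) (hC 0)
  · have hpow (i : σ) (n : ℕ) : P n (ℓ i ^ n) := by
      induction n with
      | zero => simpa using hC 1
      | succ n ih => rw [pow_succ]; exact hmul _ _ _ _ ih (hℓ i)
    have hprod (t : Finset σ) : P (∑ i ∈ t, s i) (∏ i ∈ t, ℓ i ^ s i) := by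
      induction t using Finset.induction_on with
      | empty => simpa using hC 1
      | insert i t hi ih =>
        rw [Finset.sum_insert hi, Finset.prod_insert hi]
        exact hmul _ _ _ _ (hpow _ _) ih
    refine hmono (0 + ∑ i ∈ s.support, s i) d _ ?_ (hmul _ _ _ _ (hC _) (hprod _))
    rw [zero_add]
    exact (le_totalDegree hs).trans hF

end MvPolynomial

namespace Polynomial

lemma coeff_aeval_totalDegree {K T σ : Type*} [CommSemiring K] [CommSemiring T] [Algebra K T]
    {ℓ : σ → Polynomial T} (hℓ : ∀ i, (ℓ i).natDegree ≤ 1) {F : MvPolynomial σ K} {d : ℕ}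
    (hF : F.totalDegree ≤ d) :
    (MvPolynomial.aeval ℓ F).coeff d =
      MvPolynomial.aeval (fun i => (ℓ i).coeff 1) (MvPolynomial.homogeneousComponent d F) := by
  classical
  have hprod (s : σ →₀ ℕ) (t : Finset σ) :
      (∏ i ∈ t, ℓ i ^ s i).natDegree ≤ ∑ i ∈ t, s i ∧
      (∏ i ∈ t, ℓ i ^ s i).coeff (∑ i ∈ t, s i) = ∏ i ∈ t, (ℓ i).coeff 1 ^ s i := by
    induction t using Finset.induction_on with
    | empty => simp
    | insert i t hi ih =>
      have h1 : (ℓ i ^ s i).natDegree ≤ s i := by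
        simpa using natDegree_pow_le_of_le (s i) (hℓ i)
      rw [Finset.prod_insert hi, Finset.sum_insert hi, Finset.prod_insert hi]
      refine ⟨natDegree_mul_le_of_le h1 ih.1, ?_⟩
      rw [coeff_mul_add_eq_of_natDegree_le h1 ih.1, ih.2]
      congr 1
      simpa using coeff_pow_of_natDegree_le (m := s i) (hℓ i)
  rw [MvPolynomial.aeval_def, MvPolynomial.eval₂_eq, MvPolynomial.homogeneousComponent_apply,
    map_sum, Finset.sum_filter, finsetSum_coeff]
  refine Finset.sum_congr rfl fun s hs => ?_
  rw [algebraMap_apply, coeff_C_mul, MvPolynomial.aeval_monomial, Finsupp.prod]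
  have hle : s.degree ≤ d := (MvPolynomial.le_totalDegree hs).trans hF
  split_ifs with h
  · have := (hprod s s.support).2
    rw [← Finsupp.degree_apply, h] at this
    rw [this]
  · rw [coeff_eq_zero_of_natDegree_lt, mul_zero]
    refine (hprod s s.support).1.trans_lt ?_
    rw [← Finsupp.degree_apply]
    omega

/-- Substitution of a plane section: `X₀ ↦ x`, `X₁ ↦ y`, `X₂ ↦ p₀ x + p₁ y + p₂`, and the remaining
variables are constants. -/
noncomputable def sectionHom {K S : Type*} [CommRing K] [CommRing S] [Algebra K S] {m : ℕ}
    (w : Fin m → S) (p₀ p₁ p₂ : S) :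
    MvPolynomial (Fin (m + 3)) K →ₐ[K] Polynomial (Polynomial S) :=
  MvPolynomial.aeval (Matrix.vecCons X (Matrix.vecCons (C X)
    (Matrix.vecCons (C (C p₀) * X + C (C p₁ * X + C p₂)) fun j => C (C (w j)))))

section sectionHom
variable {K S : Type*} [CommRing K] [CommRing S] [Algebra K S] {m : ℕ} (w : Fin m → S) (p₀ p₁ p₂ : S)

lemma sectionHom_zero : sectionHom (K := K) w p₀ p₁ p₂ (MvPolynomial.X 0) = X := by
  simp [sectionHom]

lemma sectionHom_one :
    sectionHom (K := K) w p₀ p₁ p₂ (MvPolynomial.X (Fin.succ 0)) = C X := by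
  simp [sectionHom]

lemma sectionHom_two : sectionHom (K := K) w p₀ p₁ p₂ (MvPolynomial.X (Fin.succ (Fin.succ 0))) =
    C (C p₀) * X + C (C p₁ * X + C p₂) := by
  rw [sectionHom, MvPolynomial.aeval_X]
  rfl

lemma sectionHom_succ (j : Fin m) :
    sectionHom (K := K) w p₀ p₁ p₂ (MvPolynomial.X j.succ.succ.succ) = C (C (w j)) := by
  rw [sectionHom, MvPolynomial.aeval_X]
  rfl

lemma map_sectionHom {S' : Type*} [CommRing S'] [Algebra K S'] (θ : Polynomial S →+* Polynomial S')
    (hθ : ∀ c, θ (C (algebraMap K S c)) = C (algebraMap K S' c)) {w' : Fin m → S'}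
    (hw : ∀ j, θ (C (w j)) = C (w' j)) {q₀ q₁ q₂ : S'} (hX : θ X = X)
    (h0 : θ (C p₀) = C q₀) (h12 : θ (C p₁ * X + C p₂) = C q₁ * X + C q₂)
    (F : MvPolynomial (Fin (m + 3)) K) :
    (sectionHom w p₀ p₁ p₂ F).map θ = sectionHom w' q₀ q₁ q₂ F := by
  have : ((mapRingHom θ).comp (sectionHom w p₀ p₁ p₂ :
      MvPolynomial (Fin (m + 3)) K →ₐ[K] _).toRingHom) =
      (sectionHom w' q₀ q₁ q₂ : MvPolynomial (Fin (m + 3)) K →ₐ[K] _).toRingHom := by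
    refine MvPolynomial.ringHom_ext (fun c => ?_) ?_
    · simp [hθ]
    · refine Fin.cases ?_ (Fin.cases ?_ (Fin.cases ?_ fun j => ?_)) <;>
        simp only [RingHom.comp_apply, AlgHom.toRingHom_eq_coe, RingHom.coe_coe, sectionHom_two,
          sectionHom_zero, sectionHom_one, sectionHom_succ, hw, hX,
          coe_mapRingHom, Polynomial.map_add, Polynomial.map_mul, map_C, map_X, h0, h12]
  exact DFunLike.congr_fun this F

variable {F : MvPolynomial (Fin (m + 3)) K} {d : ℕ}

lemma sectionHom_mem_of_filtration (P : ℕ → Polynomial (Polynomial S) → Prop)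
    (hmono : ∀ k l a, k ≤ l → P k a → P l a)
    (hadd : ∀ k a b, P k a → P k b → P k (a + b))
    (hmul : ∀ k l a b, P k a → P l b → P (k + l) (a * b))
    (hC : ∀ c : K, P 0 (C (C (algebraMap K S c)))) (hX : P 1 X) (hY : P 1 (C X))
    (h2 : P 1 (C (C p₀) * X + C (C p₁ * X + C p₂))) (hw : ∀ j, P 1 (C (C (w j))))
    (hF : F.totalDegree ≤ d) : P d (sectionHom w p₀ p₁ p₂ F) :=
  MvPolynomial.aeval_mem_of_filtration P hmono hadd hmul hC
    (Fin.cases hX (Fin.cases hY (Fin.cases h2 hw))) hF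

lemma natDegree_sectionHom_le (hF : F.totalDegree ≤ d) :
    (sectionHom w p₀ p₁ p₂ F).natDegree ≤ d := by
  refine sectionHom_mem_of_filtration w p₀ p₁ p₂ (fun k p => p.natDegree ≤ k)
    (fun k l a h1 h2 => h2.trans h1) (fun k a b => natDegree_add_le_of_degree_le)
    (fun k l a b => natDegree_mul_le_of_le) ?_ ?_ ?_ ?_ ?_ hF
  · simp
  · exact natDegree_X_le
  · simp
  · compute_degree
  · simp

lemma coeff_sectionHom (hF : F.totalDegree ≤ d) :
    (sectionHom w p₀ p₁ p₂ F).coeff d =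
      C (MvPolynomial.aeval (Matrix.vecCons 1 (Matrix.vecCons 0 (Matrix.vecCons p₀ 0)))
        (MvPolynomial.homogeneousComponent d F)) := by
  rw [sectionHom, coeff_aeval_totalDegree _ hF]
  · change _ = (CAlgHom : S →ₐ[S] _).restrictScalars K _
    rw [MvPolynomial.comp_aeval_apply]
    congr 2
    funext i
    revert i
    refine Fin.cases ?_ (Fin.cases ?_ (Fin.cases ?_ fun j => ?_))
    · simp
    · simp
    · simp only [Matrix.cons_val_succ, Matrix.cons_val_zero, coeff_add, coeff_mul_X, coeff_C]
      simp
    · simp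
  · refine Fin.cases ?_ (Fin.cases ?_ (Fin.cases ?_ fun j => ?_))
    · simpa using natDegree_X_le
    · simp
    · simp only [Matrix.cons_val_succ, Matrix.cons_val_zero]
      compute_degree
    · simp

/-- The degree in the inner variable is at most `k`. -/
def InnerDegreeLE (k : ℕ) (p : Polynomial (Polynomial S)) : Prop :=
  ∀ i, (p.coeff i).natDegree ≤ k

lemma InnerDegreeLE.mono {k l : ℕ} {p : Polynomial (Polynomial S)} (h : InnerDegreeLE k p)
    (hkl : k ≤ l) : InnerDegreeLE l p := fun i => (h i).trans hkl

lemma InnerDegreeLE.add {k : ℕ} {p q : Polynomial (Polynomial S)} (hp : InnerDegreeLE k p)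
    (hq : InnerDegreeLE k q) : InnerDegreeLE k (p + q) := fun i => by
  rw [coeff_add]
  exact natDegree_add_le_of_degree_le (hp i) (hq i)

lemma InnerDegreeLE.mul {k l : ℕ} {p q : Polynomial (Polynomial S)} (hp : InnerDegreeLE k p)
    (hq : InnerDegreeLE l q) : InnerDegreeLE (k + l) (p * q) := fun i => by
  rw [coeff_mul]
  exact natDegree_sum_le_of_forall_le _ _ fun x _ => natDegree_mul_le_of_le (hp _) (hq _)

lemma InnerDegreeLE.derivative {k : ℕ} {p : Polynomial (Polynomial S)} (hp : InnerDegreeLE k p) :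
    InnerDegreeLE k (derivative p) := fun i => by
  rw [coeff_derivative]
  refine natDegree_mul_le_of_le (n := 0) (hp _) ?_
  exact_mod_cast (natDegree_natCast (R := S) (i + 1)).le

lemma InnerDegreeLE.innerDeriv {k : ℕ} {p : Polynomial (Polynomial S)} (hp : InnerDegreeLE k p) :
    InnerDegreeLE k (innerDeriv S p) := fun i => by
  rw [coeff_innerDeriv]
  exact (natDegree_derivative_le _).trans ((Nat.sub_le _ _).trans (hp i))

lemma innerDegreeLE_C {k : ℕ} {a : Polynomial S} (h : a.natDegree ≤ k) :
    InnerDegreeLE k (C a) := fun i => by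
  rw [coeff_C]
  split_ifs
  · exact h
  · simp

lemma innerDegreeLE_X : InnerDegreeLE 0 (X : Polynomial (Polynomial S)) := fun i => by
  rw [coeff_X]
  split_ifs <;> simp

lemma innerDegreeLE_sectionHom (hF : F.totalDegree ≤ d) :
    InnerDegreeLE d (sectionHom w p₀ p₁ p₂ F) := by
  refine sectionHom_mem_of_filtration w p₀ p₁ p₂ InnerDegreeLE
    (fun k l a h1 h2 => h2.mono h1) (fun k a b => InnerDegreeLE.add)
    (fun k l a b => InnerDegreeLE.mul) ?_ ?_ ?_ ?_ ?_ hF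
  · exact fun c => innerDegreeLE_C (by simp)
  · exact innerDegreeLE_X.mono zero_le_one
  · exact innerDegreeLE_C natDegree_X_le
  · refine InnerDegreeLE.add (InnerDegreeLE.mono (k := 0 + 0) ?_ zero_le_one) (innerDegreeLE_C ?_)
    · exact (innerDegreeLE_C (by simp)).mul innerDegreeLE_X
    · compute_degree
  · exact fun j => innerDegreeLE_C (by simp)

end sectionHom

lemma coeff_coeff_swap {S : Type*} [CommRing S] (p : Polynomial (Polynomial S)) (i j : ℕ) :
    ((Bivariate.swap p).coeff j).coeff i = (p.coeff i).coeff j := by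
  induction p using Polynomial.induction_on' with
  | add p q hp hq => simp [hp, hq]
  | monomial n a =>
    induction a using Polynomial.induction_on' with
    | add p q hp hq => simp [hp, hq]
    | monomial l c =>
      rw [Bivariate.swap_monomial_monomial]
      simp only [coeff_monomial]
      split_ifs <;> simp [coeff_monomial, *]

lemma innerDegreeLE_iff {S : Type*} [CommRing S] {k : ℕ} {p : Polynomial (Polynomial S)} :
    InnerDegreeLE k p ↔ (Bivariate.swap p).natDegree ≤ k := by
  simp only [InnerDegreeLE, natDegree_le_iff_coeff_eq_zero]
  refine ⟨fun h j hj => ?_, fun h i j hj => ?_⟩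
  · ext i
    rw [coeff_coeff_swap, h i j hj, coeff_zero]
  · rw [← coeff_coeff_swap, h j hj, coeff_zero]

/-- The bidegrees of factors add up. -/
lemma exists_innerDegreeLE_of_mul {S : Type*} [CommRing S] [IsDomain S] {k : ℕ}
    {u v : Polynomial (Polynomial S)} (h0 : u * v ≠ 0) (h : InnerDegreeLE k (u * v)) :
    ∃ a b, a + b ≤ k ∧ InnerDegreeLE a u ∧ InnerDegreeLE b v := by
  refine ⟨(Bivariate.swap u).natDegree, (Bivariate.swap v).natDegree, ?_,
    innerDegreeLE_iff.2 le_rfl, innerDegreeLE_iff.2 le_rfl⟩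
  rw [← natDegree_mul, ← map_mul]
  · exact innerDegreeLE_iff.1 h
  · exact (map_ne_zero_iff _ Bivariate.swap.injective).2 (left_ne_zero_of_mul h0)
  · exact (map_ne_zero_iff _ Bivariate.swap.injective).2 (right_ne_zero_of_mul h0)

/-- The linear operator `(g, h) ↦ f (∂_y g - ∂_x h) - g ∂_y f + h ∂_x f` whose kernel consists of the
closed forms `(g dx + h dy) / f`. -/
noncomputable def closedFormOp {S : Type*} [CommRing S] (f : Polynomial (Polynomial S)) :
    (Polynomial (Polynomial S) × Polynomial (Polynomial S)) →ₗ[S] Polynomial (Polynomial S) :=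
  LinearMap.mulLeft S f ∘ₗ (innerDeriv S ∘ₗ LinearMap.fst _ _ _ -
      derivative.restrictScalars S ∘ₗ LinearMap.snd _ _ _) -
    LinearMap.mulRight S (innerDeriv S f) ∘ₗ LinearMap.fst _ _ _ +
    LinearMap.mulRight S (derivative f) ∘ₗ LinearMap.snd _ _ _

section closedFormOp
variable {S : Type*} [CommRing S]

lemma closedFormOp_apply (f g h : Polynomial (Polynomial S)) :
    closedFormOp f (g, h) = f * (innerDeriv S g - derivative h) - g * innerDeriv S f +
      h * derivative f := rfl

lemma closedFormOp_eq_zero_iff {f g h : Polynomial (Polynomial S)} :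
    closedFormOp f (g, h) = 0 ↔
      f * (innerDeriv S g - derivative h) = g * innerDeriv S f - h * derivative f := by
  rw [closedFormOp_apply, sub_add, sub_eq_zero]

lemma closedFormOp_map {S' : Type*} [CommRing S'] (η : S →+* S') (f g h : Polynomial (Polynomial S)) :
    closedFormOp (f.map (mapRingHom η)) (g.map (mapRingHom η), h.map (mapRingHom η)) =
      (closedFormOp f (g, h)).map (mapRingHom η) := by
  simp only [closedFormOp_apply, innerDeriv_map, derivative_map, Polynomial.map_add,
    Polynomial.map_sub, Polynomial.map_mul]

/-- The logarithmic derivative of a factor is a closed form. -/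
lemma closedFormOp_mul (u v : Polynomial (Polynomial S)) :
    closedFormOp (u * v) (derivative u * v, innerDeriv S u * v) = 0 := by
  rw [closedFormOp_apply]
  simp only [innerDeriv_mul, derivative_mul, derivative_innerDeriv]
  ring

/-- The pairs of bivariate monomials of bidegree at most `(d, d)`. -/
noncomputable def monomialPair (S : Type*) [CommRing S] (d : ℕ) :
    (Fin (d + 1) × Fin (d + 1)) ⊕ (Fin (d + 1) × Fin (d + 1)) →
      Polynomial (Polynomial S) × Polynomial (Polynomial S) :=
  Sum.elim (fun a => (monomial a.1 (monomial a.2 1), 0)) (fun a => (0, monomial a.1 (monomial a.2 1)))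

lemma monomialPair_map {S' : Type*} [CommRing S'] (η : S →+* S') (d : ℕ)
    (i : (Fin (d + 1) × Fin (d + 1)) ⊕ (Fin (d + 1) × Fin (d + 1))) :
    monomialPair S' d i = ((monomialPair S d i).1.map (mapRingHom η),
      (monomialPair S d i).2.map (mapRingHom η)) := by
  rcases i with i | i <;> simp [monomialPair]

lemma eq_sum_monomial_monomial {d : ℕ} {g : Polynomial (Polynomial S)} (hg : g.natDegree ≤ d)
    (hg' : InnerDegreeLE d g) :
    g = ∑ a : Fin (d + 1) × Fin (d + 1), (g.coeff a.1).coeff a.2 • monomial a.1 (monomial a.2 1) := by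
  conv_lhs => rw [g.as_sum_range' (d + 1) (by omega)]
  rw [Fintype.sum_prod_type, ← Fin.sum_univ_eq_sum_range (fun i => monomial i (g.coeff i))]
  refine Finset.sum_congr rfl fun i _ => ?_
  conv_lhs => rw [(g.coeff i).as_sum_range' (d + 1) (by have := hg' i; omega)]
  rw [← Fin.sum_univ_eq_sum_range (fun j => monomial j ((g.coeff i).coeff j)), map_sum]
  refine Finset.sum_congr rfl fun j _ => ?_
  simp [smul_monomial]

lemma sum_smul_monomialPair_map {S' : Type*} [CommRing S'] (η : S →+* S') (d : ℕ)
    (v : (Fin (d + 1) × Fin (d + 1)) ⊕ (Fin (d + 1) × Fin (d + 1)) → S) :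
    ∑ i, η (v i) • monomialPair S' d i =
      ((∑ i, v i • monomialPair S d i).1.map (mapRingHom η),
        (∑ i, v i • monomialPair S d i).2.map (mapRingHom η)) := by
  have hsmul (a : S) (p : Polynomial (Polynomial S)) :
      (a • p).map (mapRingHom η) = η a • p.map (mapRingHom η) := by
    ext; simp
  simp only [monomialPair_map η, Prod.smul_mk, Prod.ext_iff, Prod.fst_sum, Prod.snd_sum,
    Polynomial.map_sum, Prod.smul_fst, Prod.smul_snd, hsmul, and_self]

/-- The matrix of `closedFormOp` on pairs of polynomials of bidegree at most `(d, d)`. -/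
noncomputable def closedFormMatrix (f : Polynomial (Polynomial S)) (d : ℕ) :
    Matrix (ℕ × ℕ) ((Fin (d + 1) × Fin (d + 1)) ⊕ (Fin (d + 1) × Fin (d + 1))) S :=
  Matrix.of fun i j => ((closedFormOp f (monomialPair S d j)).coeff i.1).coeff i.2

lemma sum_closedFormMatrix_mul (f : Polynomial (Polynomial S)) (d : ℕ)
    (v : (Fin (d + 1) × Fin (d + 1)) ⊕ (Fin (d + 1) × Fin (d + 1)) → S) (i : ℕ × ℕ) :
    ∑ j, closedFormMatrix f d i j * v j =
      ((closedFormOp f (∑ j, v j • monomialPair S d j)).coeff i.1).coeff i.2 := by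
  simp [closedFormMatrix, finsetSum_coeff, mul_comm]

lemma exists_closedForm_lift {B W : Type*} [CommRing B] [IsDomain B] [CommRing W]
    (f : Polynomial (Polynomial B)) (d : ℕ) :
    ∃ (k : ℕ) (r : Fin k → ℕ × ℕ)
      (c : Fin k → (Fin (d + 1) × Fin (d + 1)) ⊕ (Fin (d + 1) × Fin (d + 1))),
      k ≤ 2 * (d + 1) ^ 2 ∧ ((closedFormMatrix f d).submatrix r c).det ≠ 0 ∧
      ∀ η : B →+* W, Function.Surjective η → ∀ g₀ h₀ : Polynomial (Polynomial W),
        g₀.natDegree ≤ d → InnerDegreeLE d g₀ → h₀.natDegree ≤ d → InnerDegreeLE d h₀ →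
        closedFormOp (f.map (mapRingHom η)) (g₀, h₀) = 0 →
        ∃ g h : Polynomial (Polynomial B), closedFormOp f (g, h) = 0 ∧
          g.map (mapRingHom η) = C (C (η ((closedFormMatrix f d).submatrix r c).det)) * g₀ := by
  obtain ⟨k, r, c, hk, hdet, hlift⟩ :=
    Matrix.exists_det_ne_zero_forall_exists_lift (W := W) (closedFormMatrix f d)
  refine ⟨k, r, c, hk.trans (by simp; ring_nf; rfl), hdet, fun η hη g₀ h₀ hg hg' hh hh' h0 => ?_⟩
  obtain ⟨σ, hσ⟩ := hη.hasRightInverse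
  let v₀ : (Fin (d + 1) × Fin (d + 1)) ⊕ (Fin (d + 1) × Fin (d + 1)) → W :=
    Sum.elim (fun a => (g₀.coeff a.1).coeff a.2) (fun a => (h₀.coeff a.1).coeff a.2)
  have hv₀ : ∑ i, v₀ i • monomialPair W d i = (g₀, h₀) := by
    rw [Fintype.sum_sum_type, Prod.ext_iff]
    simp only [v₀, monomialPair, Sum.elim_inl, Sum.elim_inr, Prod.fst_add, Prod.snd_add,
      Prod.fst_sum, Prod.snd_sum, Prod.smul_mk, smul_zero, Finset.sum_const_zero, add_zero, zero_add]
    exact ⟨(eq_sum_monomial_monomial hg hg').symm, (eq_sum_monomial_monomial hh hh').symm⟩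
  obtain ⟨v, hv, hvη⟩ := hlift η (fun j => σ (v₀ j)) fun i => by
    have h1 := congrArg (fun p => (p.coeff i.1).coeff i.2)
      (closedFormOp_map η f (∑ j, σ (v₀ j) • monomialPair B d j).1
        (∑ j, σ (v₀ j) • monomialPair B d j).2)
    rw [← sum_smul_monomialPair_map] at h1
    simp only [hσ (v₀ _), hv₀, h0] at h1
    rw [sum_closedFormMatrix_mul]
    rw [coeff_map, coe_mapRingHom, coeff_map, coeff_zero, coeff_zero] at h1
    exact h1.symm
  refine ⟨(∑ j, v j • monomialPair B d j).1, (∑ j, v j • monomialPair B d j).2, ?_, ?_⟩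
  · ext i j
    rw [Prod.mk.eta, ← sum_closedFormMatrix_mul f d v (i, j), hv]
    simp
  · have h1 := congrArg Prod.fst (sum_smul_monomialPair_map η d v)
    rw [← show _ = (∑ j, v j • monomialPair B d j).1.map (mapRingHom η) from h1]
    simp only [hvη, hσ (v₀ _), mul_smul]
    rw [← Finset.smul_sum, hv₀, Prod.smul_fst]
    ext i j
    simp

end closedFormOp

section CoeffDegreeLE
variable {τ W : Type*} [CommRing W]

/-- All coefficients have total degree at most `k`. -/
def CoeffDegreeLE (k : ℕ) (p : Polynomial (Polynomial (MvPolynomial τ W))) : Prop :=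
  ∀ i j, ((p.coeff i).coeff j).totalDegree ≤ k

lemma CoeffDegreeLE.mono {k l : ℕ} {p : Polynomial (Polynomial (MvPolynomial τ W))}
    (h : CoeffDegreeLE k p) (hkl : k ≤ l) : CoeffDegreeLE l p := fun i j => (h i j).trans hkl

lemma CoeffDegreeLE.add {k : ℕ} {p q : Polynomial (Polynomial (MvPolynomial τ W))}
    (hp : CoeffDegreeLE k p) (hq : CoeffDegreeLE k q) : CoeffDegreeLE k (p + q) := fun i j => by
  rw [coeff_add, coeff_add]
  exact (MvPolynomial.totalDegree_add _ _).trans (max_le (hp i j) (hq i j))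

lemma CoeffDegreeLE.sub {k : ℕ} {p q : Polynomial (Polynomial (MvPolynomial τ W))}
    (hp : CoeffDegreeLE k p) (hq : CoeffDegreeLE k q) : CoeffDegreeLE k (p - q) := fun i j => by
  rw [coeff_sub, coeff_sub]
  exact (MvPolynomial.totalDegree_sub _ _).trans (max_le (hp i j) (hq i j))

lemma CoeffDegreeLE.mul {k l : ℕ} {p q : Polynomial (Polynomial (MvPolynomial τ W))}
    (hp : CoeffDegreeLE k p) (hq : CoeffDegreeLE l q) : CoeffDegreeLE (k + l) (p * q) :=
  fun i j => by
  rw [coeff_mul, finsetSum_coeff]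
  refine MvPolynomial.totalDegree_finsetSum_le fun x _ => ?_
  rw [coeff_mul]
  refine MvPolynomial.totalDegree_finsetSum_le fun y _ => ?_
  exact (MvPolynomial.totalDegree_mul _ _).trans (add_le_add (hp _ _) (hq _ _))

lemma totalDegree_mul_natCast_add_one_le (a : MvPolynomial τ W) (n : ℕ) :
    (a * ((n : MvPolynomial τ W) + 1)).totalDegree ≤ a.totalDegree := by
  refine (MvPolynomial.totalDegree_mul _ _).trans ?_
  rw [show (n : MvPolynomial τ W) + 1 = MvPolynomial.C ((n : W) + 1) by simp,
    MvPolynomial.totalDegree_C, add_zero]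

lemma CoeffDegreeLE.derivative {k : ℕ} {p : Polynomial (Polynomial (MvPolynomial τ W))}
    (hp : CoeffDegreeLE k p) : CoeffDegreeLE k (derivative p) := fun i j => by
  rw [coeff_derivative, show ((i : Polynomial (MvPolynomial τ W)) + 1) =
    C ((i : MvPolynomial τ W) + 1) by simp, coeff_mul_C]
  exact (totalDegree_mul_natCast_add_one_le _ _).trans (hp _ _)

lemma CoeffDegreeLE.innerDeriv {k : ℕ} {p : Polynomial (Polynomial (MvPolynomial τ W))}
    (hp : CoeffDegreeLE k p) : CoeffDegreeLE k (innerDeriv _ p) := fun i j => by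
  rw [coeff_innerDeriv, coeff_derivative]
  exact (totalDegree_mul_natCast_add_one_le _ _).trans (hp _ _)

lemma coeffDegreeLE_monomial {k : ℕ} {a : MvPolynomial τ W} (h : a.totalDegree ≤ k) (i j : ℕ) :
    CoeffDegreeLE k (monomial i (monomial j a)) := fun i j => by
  rw [coeff_monomial]
  split_ifs
  · rw [coeff_monomial]
    split_ifs
    · exact h
    · simp
  · simp

lemma coeffDegreeLE_C {k : ℕ} {a : MvPolynomial τ W} (h : a.totalDegree ≤ k) :
    CoeffDegreeLE k (C (C a)) := coeffDegreeLE_monomial h 0 0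

lemma coeffDegreeLE_X : CoeffDegreeLE 0 (X : Polynomial (Polynomial (MvPolynomial τ W))) :=
  coeffDegreeLE_monomial (by simp) 1 0

lemma coeffDegreeLE_C_X : CoeffDegreeLE 0 (C X : Polynomial (Polynomial (MvPolynomial τ W))) :=
  coeffDegreeLE_monomial (by simp) 0 1

lemma CoeffDegreeLE.totalDegree_closedFormMatrix {d : ℕ}
    {f : Polynomial (Polynomial (MvPolynomial τ W))} (hf : CoeffDegreeLE d f) (i j) :
    (closedFormMatrix f d i j).totalDegree ≤ d := by
  have h0 : CoeffDegreeLE 0 (monomialPair (MvPolynomial τ W) d j).1 ∧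
      CoeffDegreeLE 0 (monomialPair (MvPolynomial τ W) d j).2 := by
    have hz : CoeffDegreeLE 0 (0 : Polynomial (Polynomial (MvPolynomial τ W))) := fun i j => by simp
    rcases j with j | j
    · exact ⟨coeffDegreeLE_monomial (by simp) _ _, hz⟩
    · exact ⟨hz, coeffDegreeLE_monomial (by simp) _ _⟩
  have h1 : CoeffDegreeLE d (closedFormOp f (monomialPair _ d j)) := by
    rw [← Prod.mk.eta (p := monomialPair _ d j), closedFormOp_apply]
    have h3 := h0.1.mul hf.innerDeriv
    rw [zero_add] at h3
    have h4 := h0.2.mul hf.derivative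
    rw [zero_add] at h4
    exact ((hf.mul (h0.1.innerDeriv.sub h0.2.derivative)).sub h3).add h4
  exact h1 _ _

lemma coeffDegreeLE_sectionHom {K : Type*} [CommRing K] [Algebra K W] {m d : ℕ}
    {w : Fin m → MvPolynomial τ W} (hw : ∀ j, (w j).totalDegree ≤ 1) {p₀ p₁ p₂ : MvPolynomial τ W}
    (h0 : p₀.totalDegree ≤ 1) (h1 : p₁.totalDegree ≤ 1) (h2 : p₂.totalDegree ≤ 1)
    {F : MvPolynomial (Fin (m + 3)) K} (hF : F.totalDegree ≤ d) :
    CoeffDegreeLE d (sectionHom w p₀ p₁ p₂ F) := by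
  refine sectionHom_mem_of_filtration w p₀ p₁ p₂ CoeffDegreeLE
    (fun k l a h1 h2 => h2.mono h1) (fun k a b => CoeffDegreeLE.add)
    (fun k l a b => CoeffDegreeLE.mul) ?_ ?_ ?_ ?_ ?_ hF
  · exact fun c => coeffDegreeLE_C (by rw [MvPolynomial.algebraMap_apply]; simp)
  · exact coeffDegreeLE_X.mono zero_le_one
  · exact coeffDegreeLE_C_X.mono zero_le_one
  · refine ((coeffDegreeLE_C h0).mul coeffDegreeLE_X).add ?_
    rw [C_add, C_mul]
    exact ((coeffDegreeLE_C h1).mul coeffDegreeLE_C_X).add (coeffDegreeLE_C h2)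
  · exact fun j => coeffDegreeLE_C (hw j)

lemma totalDegree_resultant_le {d m n : ℕ} {f g : Polynomial (MvPolynomial τ W)}
    (hf : ∀ i, (f.coeff i).totalDegree ≤ d) (hg : ∀ i, (g.coeff i).totalDegree ≤ d) :
    (resultant f g m n).totalDegree ≤ (m + n) * d := by
  refine (MvPolynomial.totalDegree_det_le _ d fun i j => ?_).trans (by simp)
  rw [sylvester, Matrix.of_apply]
  induction j using Fin.addCases with
  | left j =>
    rw [Fin.addCases_left]
    split_ifs
    · exact hg _
    · simp
  | right j =>
    rw [Fin.addCases_right]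
    split_ifs
    · exact hf _
    · simp

end CoeffDegreeLE

section irreducible
variable {K : Type*} [Field K] {m : ℕ}

/-- With one free parameter, plane sections are a linear change of variables. -/
lemma bijective_sectionHom (p₀ p₁ a : MvPolynomial (Fin m) K) :
    Function.Bijective (sectionHom (fun j => C (MvPolynomial.X j)) (C p₀) (C p₁) (X + C a) :
      MvPolynomial (Fin (m + 3)) K →ₐ[K]
        Polynomial (Polynomial (Polynomial (MvPolynomial (Fin m) K)))) := by
  let ρ : MvPolynomial (Fin m) K →+* MvPolynomial (Fin (m + 3)) K :=
    (MvPolynomial.rename fun j => j.succ.succ.succ).toRingHom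
  let x : Fin (m + 3) → MvPolynomial (Fin (m + 3)) K := MvPolynomial.X
  let ψ : Polynomial (Polynomial (Polynomial (MvPolynomial (Fin m) K))) →+*
      MvPolynomial (Fin (m + 3)) K :=
    eval₂RingHom (eval₂RingHom (eval₂RingHom ρ
      (x (Fin.succ (Fin.succ 0)) - ρ p₀ * x 0 - ρ p₁ * x (Fin.succ 0) - ρ a)) (x (Fin.succ 0))) (x 0)
  let Γ := (sectionHom (fun j => C (MvPolynomial.X j)) (C p₀) (C p₁) (X + C a) :
      MvPolynomial (Fin (m + 3)) K →ₐ[K]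
        Polynomial (Polynomial (Polynomial (MvPolynomial (Fin m) K))))
  have hρ (c : MvPolynomial (Fin m) K) : Γ (ρ c) = C (C (C c)) := by
    have : Γ.toRingHom.comp ρ = C.comp (C.comp C) := by
      refine MvPolynomial.ringHom_ext (fun c => ?_) fun j => ?_
      · simp [Γ, ρ, algebraMap_apply]
      · simp [Γ, ρ, sectionHom_succ]
    exact DFunLike.congr_fun this c
  have h1 : ψ.comp Γ.toRingHom = RingHom.id _ := by
    refine MvPolynomial.ringHom_ext (fun c => ?_) ?_
    · simp [Γ, ψ, ρ, algebraMap_apply]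
    · refine Fin.cases ?_ (Fin.cases ?_ (Fin.cases ?_ fun j => ?_))
      · simp only [RingHom.comp_apply, AlgHom.toRingHom_eq_coe, RingHom.coe_coe, Γ, sectionHom_zero,
          ψ, coe_eval₂RingHom, eval₂_X, RingHom.id_apply, x]
      · simp only [RingHom.comp_apply, AlgHom.toRingHom_eq_coe, RingHom.coe_coe, Γ, sectionHom_one,
          ψ, coe_eval₂RingHom, eval₂_X, eval₂_C, RingHom.id_apply, x]
      · simp only [RingHom.comp_apply, AlgHom.toRingHom_eq_coe, RingHom.coe_coe, Γ, sectionHom_two,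
          ψ, coe_eval₂RingHom, eval₂_X, eval₂_C, eval₂_add, eval₂_mul, RingHom.id_apply, x]
        ring
      · simp [Γ, ψ, ρ, sectionHom_succ]
  have h2 : Γ.toRingHom.comp ψ = RingHom.id _ := by
    refine ringHom_ext' (ringHom_ext' (ringHom_ext' ?_ ?_) ?_) ?_
    · refine RingHom.ext fun c => ?_
      simp only [RingHom.comp_apply, AlgHom.toRingHom_eq_coe, RingHom.coe_coe, ψ, coe_eval₂RingHom,
        eval₂_C, hρ, RingHom.id_apply]
    · simp only [RingHom.comp_apply, AlgHom.toRingHom_eq_coe, RingHom.coe_coe, ψ, coe_eval₂RingHom,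
        eval₂_C, eval₂_X, map_sub, map_mul, hρ, x, RingHom.id_apply, Γ, sectionHom_zero,
        sectionHom_one, sectionHom_two, C_add]
      ring
    · simp only [RingHom.comp_apply, AlgHom.toRingHom_eq_coe, RingHom.coe_coe, ψ, coe_eval₂RingHom,
        eval₂_C, eval₂_X, x, RingHom.id_apply, Γ, sectionHom_one]
    · simp only [RingHom.comp_apply, AlgHom.toRingHom_eq_coe, RingHom.coe_coe, ψ, coe_eval₂RingHom,
        eval₂_X, x, RingHom.id_apply, Γ, sectionHom_zero]
  exact Function.bijective_iff_has_inverse.2 ⟨ψ, DFunLike.congr_fun h1, DFunLike.congr_fun h2⟩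

end irreducible

section planeSection
variable {K : Type*} [Field K] {m : ℕ}

/-- The restriction to the hyperplane `X₂ = β₀ X₀ + β₁ X₁ + ∑ βⱼ₊₂ Xⱼ₊₃`, viewed as a polynomial in
`X₀` and `X₁`. -/
noncomputable def planeSection (β : Fin (m + 2) → K) :
    MvPolynomial (Fin (m + 3)) K →ₐ[K] Polynomial (Polynomial (MvPolynomial (Fin m) K)) :=
  sectionHom MvPolynomial.X (MvPolynomial.C (β 0)) (MvPolynomial.C (β (Fin.succ 0)))
    (∑ j, MvPolynomial.C (β j.succ.succ) * MvPolynomial.X j)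

/-- The restriction to the generic hyperplane. -/
noncomputable def genericSection : MvPolynomial (Fin (m + 3)) K →ₐ[K]
    Polynomial (Polynomial (MvPolynomial (Fin (m + 2)) (MvPolynomial (Fin m) K))) :=
  sectionHom (fun j => MvPolynomial.C (MvPolynomial.X j)) (MvPolynomial.X 0)
    (MvPolynomial.X (Fin.succ 0))
    (∑ j : Fin m, MvPolynomial.X j.succ.succ * MvPolynomial.C (MvPolynomial.X j))

lemma map_genericSection {S : Type*} [CommRing S] [Algebra K S]
    (η : MvPolynomial (Fin (m + 2)) (MvPolynomial (Fin m) K) →+* S)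
    (hη : ∀ c, η (MvPolynomial.C (MvPolynomial.C c)) = algebraMap K S c)
    (F : MvPolynomial (Fin (m + 3)) K) :
    (genericSection F).map (mapRingHom η) =
      sectionHom (fun j => η (MvPolynomial.C (MvPolynomial.X j))) (η (MvPolynomial.X 0))
        (η (MvPolynomial.X (Fin.succ 0)))
        (∑ j : Fin m, η (MvPolynomial.X j.succ.succ) * η (MvPolynomial.C (MvPolynomial.X j))) F := by
  refine map_sectionHom _ _ _ _ _ (fun c => ?_) (fun j => ?_) ?_ ?_ ?_ F
  · rw [coe_mapRingHom, map_C, ← hη]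
    rfl
  · rw [coe_mapRingHom, map_C]
  · rw [coe_mapRingHom, map_X]
  · rw [coe_mapRingHom, map_C]
  · simp only [coe_mapRingHom, Polynomial.map_add, Polynomial.map_mul, map_C, map_X, map_sum,
      map_mul, Polynomial.map_sum]

lemma map_genericSection_eval (β : Fin (m + 2) → K) (F : MvPolynomial (Fin (m + 3)) K) :
    (genericSection F).map (mapRingHom (MvPolynomial.eval fun i => MvPolynomial.C (β i))) =
      planeSection β F := by
  rw [map_genericSection _ fun c => by rw [MvPolynomial.eval_C]; rfl]
  simp only [MvPolynomial.eval_C, MvPolynomial.eval_X]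
  rfl

lemma coeffDegreeLE_genericSection {F : MvPolynomial (Fin (m + 3)) K} {d : ℕ}
    (hF : F.totalDegree ≤ d) : CoeffDegreeLE d (genericSection F) := by
  refine coeffDegreeLE_sectionHom (fun j => ?_) ?_ ?_ ?_ hF
  · simp
  · simp
  · simp
  · refine MvPolynomial.totalDegree_finsetSum_le fun j _ => ?_
    refine (MvPolynomial.totalDegree_mul _ _).trans ?_
    simp

lemma exists_map_eval_ne_zero {τ σ : Type*} [Infinite K]
    {P : MvPolynomial τ (MvPolynomial σ K)} (hP : P ≠ 0) :
    ∃ w : σ → K, MvPolynomial.map (MvPolynomial.eval w) P ≠ 0 := by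
  obtain ⟨s, hs⟩ := MvPolynomial.ne_zero_iff.1 hP
  by_contra! h
  refine hs (MvPolynomial.funext fun w => ?_)
  rw [← MvPolynomial.coeff_map, h w]
  simp

lemma eval_map_eval {τ σ : Type*} (w : σ → K) (β : τ → K) (P : MvPolynomial τ (MvPolynomial σ K)) :
    MvPolynomial.eval β (MvPolynomial.map (MvPolynomial.eval w) P) =
      MvPolynomial.eval w (MvPolynomial.eval (fun i => MvPolynomial.C (β i)) P) := by
  induction P using MvPolynomial.induction_on with
  | C a => simp
  | add p q hp hq => simp only [map_add, hp, hq]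
  | mul_X p i hp => simp [hp]

lemma isUnit_leadingCoeff_left {S : Type*} [CommRing S] [IsDomain S] {u v : Polynomial S}
    (h : IsUnit (u * v).leadingCoeff) : IsUnit u.leadingCoeff := by
  rw [leadingCoeff_mul] at h
  exact isUnit_of_mul_isUnit_left h

end planeSection

section liftSection
variable {K : Type*} [Field K] {m d : ℕ}

lemma coeff_sectionHom_algebraMap {S : Type*} [CommRing S] [Algebra K S] (w : Fin m → S) (b : K)
    (p₁ p₂ : S) {F : MvPolynomial (Fin (m + 3)) K} (hd : F.totalDegree ≤ d) :
    (sectionHom w (algebraMap K S b) p₁ p₂ F).coeff d = C (algebraMap K S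
      (MvPolynomial.aeval (Matrix.vecCons 1 (Matrix.vecCons 0 (Matrix.vecCons b 0)))
        (MvPolynomial.homogeneousComponent d F))) := by
  rw [coeff_sectionHom _ _ _ _ hd, ← MvPolynomial.aeval_algebraMap_apply]
  congr 3
  refine _root_.funext (Fin.cases ?_ (Fin.cases ?_ (Fin.cases ?_ fun j => ?_))) <;> simp

/-- The pencil of sections `X₂ = β₀ X₀ + β₁ X₁ + ∑ βⱼ₊₂ Xⱼ₊₃ + z`. -/
noncomputable def pencilSection (β : Fin (m + 2) → K) : MvPolynomial (Fin (m + 3)) K →ₐ[K]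
    Polynomial (Polynomial (Polynomial (MvPolynomial (Fin m) K))) :=
  sectionHom (fun j => C (MvPolynomial.X j)) (C (MvPolynomial.C (β 0)))
    (C (MvPolynomial.C (β (Fin.succ 0))))
    (X + C (∑ j, MvPolynomial.C (β j.succ.succ) * MvPolynomial.X j))

lemma irreducible_pencilSection (β : Fin (m + 2) → K) {F : MvPolynomial (Fin (m + 3)) K}
    (hF : Irreducible F) : Irreducible (pencilSection β F) :=
  (MulEquiv.irreducible_iff (MulEquiv.ofBijective (pencilSection β)
    (bijective_sectionHom (MvPolynomial.C (β 0)) (MvPolynomial.C (β (Fin.succ 0))) _))).2 hF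

lemma exists_coeff_planeSection (β : Fin (m + 2) → K) {F : MvPolynomial (Fin (m + 3)) K}
    (hd : F.totalDegree ≤ d) : ∃ c : K, (planeSection β F).coeff d = C (MvPolynomial.C c) ∧
      (pencilSection β F).coeff d = C (C (MvPolynomial.C c)) :=
  ⟨_, coeff_sectionHom_algebraMap _ (β 0) _ _ hd, coeff_sectionHom_algebraMap _ (β 0) _ _ hd⟩

/-- The substitution `β₁ ↦ β₁ + s`. -/
noncomputable def tilt (β : Fin (m + 2) → K) :
    MvPolynomial (Fin (m + 2)) (MvPolynomial (Fin m) K) →+* Polynomial (MvPolynomial (Fin m) K) :=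
  MvPolynomial.eval₂Hom C
    (Matrix.vecCons (C (MvPolynomial.C (β 0))) (Matrix.vecCons
      (C (MvPolynomial.C (β (Fin.succ 0))) + X) fun j => C (MvPolynomial.C (β j.succ.succ))))

lemma evalRingHom_comp_tilt (β : Fin (m + 2) → K) :
    (evalRingHom 0).comp (tilt β) = MvPolynomial.eval fun i => MvPolynomial.C (β i) := by
  refine MvPolynomial.ringHom_ext (fun c => ?_) (Fin.cases ?_ (Fin.cases ?_ fun j => ?_))
  · simp [tilt]
  · simp [tilt]
  · simp only [tilt, RingHom.comp_apply, MvPolynomial.coe_eval₂Hom, MvPolynomial.eval₂_X,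
      MvPolynomial.eval_X, Matrix.cons_val_succ, Matrix.cons_val_zero]
    simp
  · simp [tilt]

lemma map_blowUp_pencilSection (β : Fin (m + 2) → K) (F : MvPolynomial (Fin (m + 3)) K) :
    (pencilSection β F).map (blowUp (MvPolynomial (Fin m) K)) =
      (genericSection F).map (mapRingHom (tilt β)) := by
  have h (c : K) : tilt β (MvPolynomial.C (MvPolynomial.C c)) = algebraMap K _ c := by
    rw [tilt, MvPolynomial.coe_eval₂Hom, MvPolynomial.eval₂_C]
    rfl
  rw [map_genericSection (tilt β) h]
  refine map_sectionHom _ _ _ _ _ (fun c => ?_) (fun j => ?_) ?_ ?_ ?_ F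
  · rw [blowUp, coe_eval₂RingHom, eval₂_C, coe_eval₂RingHom]
    exact eval₂_C _ _
  · simp [blowUp, tilt]
  · simp [blowUp]
  · simp [blowUp, tilt]
  · simp only [blowUp, tilt, coe_eval₂RingHom, MvPolynomial.coe_eval₂Hom, MvPolynomial.eval₂_X,
      MvPolynomial.eval₂_C, Matrix.cons_val_succ, Matrix.cons_val_zero, eval₂_add, eval₂_mul,
      eval₂_C, eval₂_X, RingHom.comp_apply, C_add, map_sum, map_mul, eval₂_finsetSum]
    ring

end liftSection

section main
variable {K : Type*} [Field K] [CharZero K] {m d : ℕ}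

/-- The key irreducibility criterion for a hyperplane section. -/
lemma irreducible_planeSection {F : MvPolynomial (Fin (m + 3)) K} (hF : Irreducible F)
    (hd : F.totalDegree ≤ d) (hd0 : d ≠ 0) {β : Fin (m + 2) → K}
    {k : ℕ} {rr : Fin k → ℕ × ℕ}
    {cc : Fin k → Fin (d + 1) × Fin (d + 1) ⊕ Fin (d + 1) × Fin (d + 1)}
    (hlift : ∀ g₀ h₀ : Polynomial (Polynomial (MvPolynomial (Fin m) K)), g₀.natDegree ≤ d →
      InnerDegreeLE d g₀ → h₀.natDegree ≤ d → InnerDegreeLE d h₀ →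
      (planeSection β F).closedFormOp (g₀, h₀) = 0 →
      ∃ g h, (genericSection F).closedFormOp (g, h) = 0 ∧
        g.map (mapRingHom (MvPolynomial.eval fun i => MvPolynomial.C (β i))) =
          C (C (MvPolynomial.eval (fun i => MvPolynomial.C (β i))
            (((genericSection F).closedFormMatrix d).submatrix rr cc).det)) * g₀)
    (hdet : MvPolynomial.eval (fun i => MvPolynomial.C (β i))
      (((genericSection F).closedFormMatrix d).submatrix rr cc).det ≠ 0)
    (hres : resultant ((planeSection β F).map (evalRingHom 0))
      (derivative ((planeSection β F).map (evalRingHom 0))) d (d - 1) ≠ 0)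
    (hlc : (planeSection β F).coeff d ≠ 0) :
    Irreducible (planeSection β F) ∧ (planeSection β F).natDegree = d := by
  set f := planeSection β F with hf
  set η : MvPolynomial (Fin (m + 2)) (MvPolynomial (Fin m) K) →+* MvPolynomial (Fin m) K :=
    MvPolynomial.eval fun i => MvPolynomial.C (β i) with hη
  have hdeg : f.natDegree = d :=
    le_antisymm (natDegree_sectionHom_le _ _ _ _ hd) (le_natDegree_of_ne_zero hlc)
  obtain ⟨c, hc, hΦlc⟩ := exists_coeff_planeSection β hd
  have hc0 : c ≠ 0 := by
    rintro rfl
    exact hlc (by rw [hc, map_zero, map_zero])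
  have hunit : IsUnit f.leadingCoeff := by
    rw [leadingCoeff, hdeg, hc]
    exact isUnit_C.2 ((isUnit_iff_ne_zero.2 hc0).map _)
  refine ⟨⟨fun h => ?_, fun u v huv => ?_⟩, hdeg⟩
  · exact hd0 (hdeg ▸ natDegree_eq_zero_of_isUnit h)
  have hu1 : IsUnit u.leadingCoeff := isUnit_leadingCoeff_left (v := v) (huv ▸ hunit)
  have hv1 : IsUnit v.leadingCoeff :=
    isUnit_leadingCoeff_left (v := u) (by rw [mul_comm, ← huv]; exact hunit)
  by_contra! hcon
  have key : ∀ w : Polynomial (Polynomial (MvPolynomial (Fin m) K)), IsUnit w.leadingCoeff →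
      ¬ IsUnit w → (w.map (evalRingHom 0)).natDegree ≠ 0 := by
    intro w hw1 hw h0
    rw [natDegree_map_of_leadingCoeff_ne_zero _ (hw1.map (evalRingHom 0)).ne_zero] at h0
    rw [eq_C_of_natDegree_eq_zero h0] at hw
    rw [leadingCoeff, h0] at hw1
    exact hw (isUnit_C.2 hw1)
  have hf0 : f ≠ 0 := fun h => hd0 (by rw [← hdeg, h, natDegree_zero])
  have hle : InnerDegreeLE d f := innerDegreeLE_sectionHom _ _ _ _ hd
  have huv0 : u * v ≠ 0 := huv ▸ hf0
  obtain ⟨a, b, hab, ha, hb⟩ := exists_innerDegreeLE_of_mul huv0 (huv ▸ hle)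
  have hduv : u.natDegree + v.natDegree = d := by
    rw [← natDegree_mul (left_ne_zero_of_mul huv0) (right_ne_zero_of_mul huv0), ← huv, hdeg]
  obtain ⟨g, h, hgh, hg⟩ := hlift (derivative u * v) (innerDeriv _ u * v)
    (natDegree_mul_le.trans ((add_le_add_left ((natDegree_derivative_le u).trans
      (Nat.sub_le _ _)) _).trans hduv.le))
    ((ha.derivative.mul hb).mono hab)
    (natDegree_mul_le.trans ((add_le_add_left (natDegree_le_iff_coeff_eq_zero.2 fun N hN => by
      rw [coeff_innerDeriv, coeff_eq_zero_of_natDegree_lt hN, derivative_zero]) _).trans hduv.le))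
    ((ha.innerDeriv.mul hb).mono hab)
    (by rw [huv]; exact closedFormOp_mul u v)
  have hmap (p : Polynomial (Polynomial (MvPolynomial (Fin (m + 2)) (MvPolynomial (Fin m) K)))) :
      (p.map (mapRingHom (tilt β))).map (mapRingHom (evalRingHom 0)) = p.map (mapRingHom η) := by
    rw [Polynomial.map_map, mapRingHom_comp, evalRingHom_comp_tilt]
  have hΦf : ((pencilSection β F).map (blowUp _)).map (mapRingHom (evalRingHom 0)) = f := by
    rw [map_blowUp_pencilSection, hmap, hη, map_genericSection_eval]
  have hΦ0 : (pencilSection β F).map (evalZeroZero _) = f.map (evalRingHom 0) := by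
    rw [← evalZero_comp_map_comp_blowUp, ← Polynomial.map_map, ← Polynomial.map_map, hΦf]
  have hΦdeg : (pencilSection β F).natDegree = d := by
    refine le_antisymm (natDegree_sectionHom_le _ _ _ _ hd) (le_natDegree_of_ne_zero ?_)
    rw [hΦlc]
    simpa using hc0
  have hfd : (f.map (evalRingHom 0)).natDegree ≤ d := natDegree_map_le.trans hdeg.le
  obtain ⟨A, B, r, hr, hAB⟩ : ∃ A B r, r ≠ 0 ∧ f.map (evalRingHom 0) * A +
      derivative (f.map (evalRingHom 0)) * B = C r := by
    obtain ⟨A, B, -, -, hAB⟩ := exists_mul_add_mul_eq_C_resultant (f.map (evalRingHom 0))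
      (derivative (f.map (evalRingHom 0))) hfd
      ((natDegree_derivative_le _).trans (Nat.sub_le_sub_right hfd 1)) (Or.inl hd0)
    exact ⟨A, B, _, hres, hAB⟩
  rw [← hΦ0] at hAB
  have hpde := closedFormOp_eq_zero_iff.1 (by
    rw [closedFormOp_map, hgh, Polynomial.map_zero] :
      ((genericSection F).map (mapRingHom (tilt β))).closedFormOp
        (g.map (mapRingHom (tilt β)), h.map (mapRingHom (tilt β))) = 0)
  rw [← map_blowUp_pencilSection] at hpde
  exact false_of_closed_form_lift (irreducible_pencilSection β hF) (hΦdeg ▸ hd0)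
    (by rw [leadingCoeff, hΦdeg, hΦlc]) hr hAB (hΦf.trans huv) (key u hu1 hcon.1) (key v hv1 hcon.2) hpde hdet (by rw [hmap, hg])

end main

section exists_forall
variable {K : Type*} [Field K] [CharZero K] {m d : ℕ}

lemma exists_forall_irreducible_planeSection {F : MvPolynomial (Fin (m + 3)) K}
    (hF : Irreducible F) (hd : F.totalDegree ≤ d) (hd0 : d ≠ 0) (w : Fin m → K)
    (hq : ((sectionHom w 0 0 0 F).map (evalRingHom 0)).natDegree = d)
    (hsep : ((sectionHom w 0 0 0 F).map (evalRingHom 0)).Separable) :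
    ∃ P : MvPolynomial (Fin (m + 2)) K, P ≠ 0 ∧ P.totalDegree ≤ 11 * d ^ 3 ∧
      ∀ β, MvPolynomial.eval β P ≠ 0 →
        Irreducible (planeSection β F) ∧ (planeSection β F).natDegree = d := by
  have hcd : CoeffDegreeLE d (genericSection F) := coeffDegreeLE_genericSection hd
  obtain ⟨k, rr, cc, hk, hdet, hlift⟩ := exists_closedForm_lift
    (W := MvPolynomial (Fin m) K) (genericSection F) d
  set D := (((genericSection F).closedFormMatrix d).submatrix rr cc).det with hD
  set f₀ := (genericSection F).map (evalRingHom 0) with hf₀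
  set R := resultant f₀ (derivative f₀) d (d - 1) with hR
  set l := ((genericSection F).coeff d).coeff 0 with hl
  have hDdeg : D.totalDegree ≤ 2 * (d + 1) ^ 2 * d := by
    refine (MvPolynomial.totalDegree_det_le _ d fun i j =>
      hcd.totalDegree_closedFormMatrix _ _).trans ?_
    rw [Fintype.card_fin]
    exact Nat.mul_le_mul_right d hk
  have hf₀c (i : ℕ) : (f₀.coeff i).totalDegree ≤ d := by
    rw [hf₀, coeff_map, coe_evalRingHom, ← coeff_zero_eq_eval_zero]
    exact hcd i 0
  have hRdeg : R.totalDegree ≤ (d + (d - 1)) * d := by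
    refine totalDegree_resultant_le hf₀c fun i => ?_
    rw [coeff_derivative]
    exact (totalDegree_mul_natCast_add_one_le _ _).trans (hf₀c _)
  have hldeg : l.totalDegree ≤ d := hcd d 0
  let χ : MvPolynomial (Fin (m + 2)) (MvPolynomial (Fin m) K) →+* K :=
    (MvPolynomial.eval w).comp (MvPolynomial.eval 0)
  have hχ : (genericSection F).map (mapRingHom χ) = sectionHom w 0 0 0 F := by
    rw [map_genericSection χ fun c => by simp [χ]]
    simp [χ]
  have hχ₀ : f₀.map χ = (sectionHom w 0 0 0 F).map (evalRingHom 0) := by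
    rw [← hχ, hf₀, Polynomial.map_map, Polynomial.map_map]
    congr 1
    ext <;> simp
  have hR0 : R ≠ 0 := fun h => by
    refine resultant_ne_zero _ _ hsep ?_
    rw [natDegree_derivative, hq, ← hχ₀, derivative_map, resultant_map_map, ← hR, h, map_zero]
  have hl0 : l ≠ 0 := fun h => by
    refine leadingCoeff_ne_zero.2 hsep.ne_zero ?_
    rw [leadingCoeff, hq, ← hχ₀, coeff_map, hf₀, coeff_map, coe_evalRingHom,
      ← coeff_zero_eq_eval_zero, ← hl, h, map_zero]
  obtain ⟨w', hw'⟩ := exists_map_eval_ne_zero (mul_ne_zero (mul_ne_zero hdet hR0) hl0)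
  refine ⟨_, hw', ?_, fun β hβ => ?_⟩
  · refine (Finset.sup_mono (MvPolynomial.support_map_subset _ _)).trans ((MvPolynomial.totalDegree_mul _ _).trans
      ((add_le_add_left (MvPolynomial.totalDegree_mul _ _) _).trans ?_))
    have h1 : 1 ≤ d := Nat.one_le_iff_ne_zero.2 hd0
    have h2 : (d + (d - 1)) * d ≤ 2 * d * d := Nat.mul_le_mul_right d (by omega)
    have h3 : d ≤ d * d := Nat.le_mul_self d
    have h4 : d * d ≤ d * d * d := Nat.le_mul_of_pos_right _ h1
    nlinarith
  · rw [eval_map_eval] at hβ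
    set η : MvPolynomial (Fin (m + 2)) (MvPolynomial (Fin m) K) →+* MvPolynomial (Fin m) K :=
      MvPolynomial.eval fun i => MvPolynomial.C (β i) with hη
    have hβ' : η (D * R * l) ≠ 0 := fun h => hβ (by rw [h, map_zero])
    rw [map_mul, map_mul] at hβ'
    have hη₀ : f₀.map η = (planeSection β F).map (evalRingHom 0) := by
      rw [← map_genericSection_eval, hf₀, Polynomial.map_map, Polynomial.map_map]
      congr 1
      ext <;> simp [hη]
    refine irreducible_planeSection (rr := rr) (cc := cc) hF hd hd0 ?_
      (left_ne_zero_of_mul (left_ne_zero_of_mul hβ')) ?_ ?_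
    · have := hlift η fun a => ⟨MvPolynomial.C a, MvPolynomial.eval_C a⟩
      rwa [map_genericSection_eval] at this
    · rw [← hη₀, derivative_map, resultant_map_map]
      exact right_ne_zero_of_mul (left_ne_zero_of_mul hβ')
    · intro h
      refine right_ne_zero_of_mul hβ' ?_
      rw [← map_genericSection_eval, coeff_map] at h
      have := congrArg (fun p => p.coeff 0) h
      simpa using this

end exists_forall
end Polynomial

namespace MvPolynomial

lemma eval_aeval {K σ τ : Type*} [CommRing K] (v : σ → K) (ℓ : τ → MvPolynomial σ K)
    (F : MvPolynomial τ K) : eval v (aeval ℓ F) = eval (fun i => eval v (ℓ i)) F := by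
  induction F using MvPolynomial.induction_on with
  | C a => rw [aeval_C, algebraMap_eq, eval_C, eval_C]
  | add p q hp hq => rw [map_add, map_add, map_add, hp, hq]
  | mul_X p i hp => rw [map_mul, map_mul, map_mul, hp, aeval_X, eval_X]

section linSub
variable {K : Type*} [Field K] {l m n : ℕ}

/-- Composition of a polynomial with a linear map. -/
noncomputable def linSub (φ : (Fin m → K) →ₗ[K] (Fin n → K)) :
    MvPolynomial (Fin n) K →ₐ[K] MvPolynomial (Fin m) K :=
  aeval fun i : Fin n => ∑ j : Fin m, C (φ (Pi.single j 1) i) * X j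

lemma eval_linSub (φ : (Fin m → K) →ₗ[K] (Fin n → K)) (v : Fin m → K)
    (F : MvPolynomial (Fin n) K) : eval v (linSub φ F) = eval (φ v) F := by
  rw [linSub, eval_aeval]
  congr 2
  ext i
  conv_rhs => rw [LinearMap.pi_apply_eq_sum_univ φ v]
  rw [map_sum, Finset.sum_apply]
  refine Finset.sum_congr rfl fun j _ => ?_
  rw [Pi.smul_apply, smul_eq_mul, map_mul, eval_C, eval_X, mul_comm]
  congr 1
  refine congrArg (φ · i) (_root_.funext fun k => ?_)
  simp [Pi.single_apply, eq_comm]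

lemma totalDegree_linSub_le (φ : (Fin m → K) →ₗ[K] (Fin n → K)) (F : MvPolynomial (Fin n) K) :
    (linSub φ F).totalDegree ≤ F.totalDegree := by
  refine aeval_mem_of_filtration (fun k (p : MvPolynomial (Fin m) K) => p.totalDegree ≤ k) (fun k l a h h' => h'.trans h)
    (fun k a b ha hb => (totalDegree_add a b).trans (max_le ha hb))
    (fun k l a b ha hb => (totalDegree_mul a b).trans (add_le_add ha hb))
    (fun c => (totalDegree_C c).le) (fun i => ?_) le_rfl
  refine totalDegree_finsetSum_le fun j _ => (totalDegree_mul _ _).trans ?_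
  simp

variable [Infinite K]

lemma linSub_linSub (φ : (Fin m → K) →ₗ[K] (Fin n → K)) (ψ : (Fin l → K) →ₗ[K] (Fin m → K))
    (F : MvPolynomial (Fin n) K) : linSub ψ (linSub φ F) = linSub (φ ∘ₗ ψ) F :=
  MvPolynomial.funext fun v => by simp only [eval_linSub, LinearMap.comp_apply]

/-- Invertible linear substitutions. -/
noncomputable def linSubEquiv (e : (Fin n → K) ≃ₗ[K] (Fin n → K)) :
    MvPolynomial (Fin n) K ≃ₐ[K] MvPolynomial (Fin n) K :=
  AlgEquiv.ofAlgHom (linSub e) (linSub e.symm)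
    (AlgHom.ext fun F => MvPolynomial.funext fun v => by simp [eval_linSub])
    (AlgHom.ext fun F => MvPolynomial.funext fun v => by simp [eval_linSub])

lemma irreducible_linSub_iff (e : (Fin n → K) ≃ₗ[K] (Fin n → K)) {F : MvPolynomial (Fin n) K} :
    Irreducible (linSub (e : (Fin n → K) →ₗ[K] (Fin n → K)) F) ↔ Irreducible F :=
  MulEquiv.irreducible_iff (linSubEquiv e)

lemma totalDegree_linSub (e : (Fin n → K) ≃ₗ[K] (Fin n → K)) (F : MvPolynomial (Fin n) K) :
    (linSub (e : (Fin n → K) →ₗ[K] (Fin n → K)) F).totalDegree = F.totalDegree := by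
  refine le_antisymm (totalDegree_linSub_le _ _) ?_
  conv_lhs => rw [show F = linSub (e.symm : (Fin n → K) →ₗ[K] (Fin n → K)) (linSub e F) from
    MvPolynomial.funext fun v => by simp [eval_linSub]]
  exact totalDegree_linSub_le _ _

end linSub

section transvection
variable {K : Type*} [Field K] {n : ℕ}

lemma exists_linearEquiv_single {i : Fin n} {v : Fin n → K} (hv : v i ≠ 0) :
    ∃ e : (Fin n → K) ≃ₗ[K] (Fin n → K), e (Pi.single i 1) = v ∧
      ∀ j ≠ i, e (Pi.single j 1) = Pi.single j 1 := by
  let f : (Fin n → K) →ₗ[K] (Fin n → K) :=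
    LinearMap.id + (LinearMap.proj i : (Fin n → K) →ₗ[K] K).smulRight (v - Pi.single i 1)
  have hf (x : Fin n → K) : f x = x + x i • (v - Pi.single i 1) := rfl
  have hinj : Function.Injective f := by
    refine (injective_iff_map_eq_zero f).2 fun x hx => ?_
    have hi := congrFun hx i
    rw [hf] at hi hx
    have hxi : x i = 0 := by
      have : x i * v i = 0 := by
        simp only [Pi.add_apply, Pi.smul_apply, Pi.sub_apply, Pi.single_eq_same, smul_eq_mul,
          Pi.zero_apply] at hi
        linear_combination hi
      exact (mul_eq_zero.1 this).resolve_right hv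
    simpa [hxi] using hx
  refine ⟨LinearEquiv.ofInjectiveEndo f hinj, ?_, fun j hj => ?_⟩
  · simp [hf]
  · simp [hf, Pi.single_eq_of_ne' hj]

end transvection

section homogenization
variable {K σ τ : Type*} [Field K]

lemma IsHomogeneous.eval_smul {p : MvPolynomial σ K} {k : ℕ} (hp : p.IsHomogeneous k) (c : K)
    (x : σ → K) : eval (fun i => c * x i) p = c ^ k * eval x p := by
  rw [eval_eq, eval_eq, Finset.mul_sum]
  refine Finset.sum_congr rfl fun s hs => ?_
  simp_rw [mul_pow]
  rw [Finset.prod_mul_distrib, Finset.prod_pow_eq_pow_sum, ← hp.degree_eq_sum_deg_support hs]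
  ring

lemma exists_isHomogeneous_eval_div {L : MvPolynomial σ K} (hL : L.IsHomogeneous 1)
    {M : τ → MvPolynomial σ K} (hM : ∀ j, (M j).IsHomogeneous 1) (P : MvPolynomial τ K) :
    ∃ G : MvPolynomial σ K, G.IsHomogeneous (P.totalDegree + 1) ∧ (∀ a, eval a L = 0 → eval a G = 0) ∧
      ∀ a, eval a L ≠ 0 →
        eval a G = eval a L ^ (P.totalDegree + 1) * eval (fun j => eval a (M j) / eval a L) P := by
  have hG (a : σ → K) : eval a (∑ k ∈ Finset.range (P.totalDegree + 1), L ^ (P.totalDegree + 1 - k) *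
      aeval M (homogeneousComponent k P)) = ∑ k ∈ Finset.range (P.totalDegree + 1),
        eval a L ^ (P.totalDegree + 1 - k) * eval (fun j => eval a (M j)) (homogeneousComponent k P) := by
    rw [map_sum]
    refine Finset.sum_congr rfl fun k _ => ?_
    rw [map_mul, map_pow]
    rw [eval_aeval]
  refine ⟨∑ k ∈ Finset.range (P.totalDegree + 1), L ^ (P.totalDegree + 1 - k) * aeval M (homogeneousComponent k P),
    ?_, fun a ha => ?_, fun a ha => ?_⟩
  · refine IsHomogeneous.sum _ _ _ fun k hk => ?_
    convert (hL.pow (P.totalDegree + 1 - k)).mul ((homogeneousComponent_isHomogeneous k P).aeval _ hM)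
      using 1
    have := Finset.mem_range.1 hk
    omega
  · rw [hG]
    refine Finset.sum_eq_zero fun k hk => ?_
    have := Finset.mem_range.1 hk
    rw [ha, zero_pow (by omega), zero_mul]
  · have hPs : eval (fun j => eval a (M j) / eval a L) P = ∑ k ∈ Finset.range (P.totalDegree + 1),
        eval (fun j => eval a (M j) / eval a L) (homogeneousComponent k P) := by
      rw [← map_sum, sum_homogeneousComponent]
    rw [hG, hPs, Finset.mul_sum]
    refine Finset.sum_congr rfl fun k hk => ?_
    simp_rw [div_eq_inv_mul]
    rw [(homogeneousComponent_isHomogeneous k P).eval_smul, ← mul_assoc, inv_pow,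
      pow_sub₀ _ ha (Finset.mem_range.1 hk).le]

end homogenization

section sliceMap
variable {K : Type*} [Field K] {m n : ℕ}

lemma linSub_X (φ : (Fin m → K) →ₗ[K] (Fin n → K)) (i : Fin n) :
    linSub φ (X i) = ∑ j, C (φ (Pi.single j 1) i) * X j := aeval_X _ _

/-- The parametrisation of the hyperplane on which the third coordinate is the linear form `β` in
the other ones. -/
def sliceMap (β : Fin (m + 2) → K) : (Fin (m + 2) → K) →ₗ[K] (Fin (m + 3) → K) :=
  LinearMap.pi (Fin.insertNth (α := fun _ => (Fin (m + 2) → K) →ₗ[K] K) (Fin.succ (Fin.succ 0))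
    (∑ j, β j • LinearMap.proj j) fun j => LinearMap.proj j)

lemma sliceMap_same (β y : Fin (m + 2) → K) :
    sliceMap β y (Fin.succ (Fin.succ 0)) = ∑ j, β j * y j := by
  rw [sliceMap, LinearMap.pi_apply, Fin.insertNth_apply_same]
  simp

lemma sliceMap_succAbove (β y : Fin (m + 2) → K) (j : Fin (m + 2)) :
    sliceMap β y (Fin.succAbove (Fin.succ (Fin.succ 0)) j) = y j := by
  rw [sliceMap, LinearMap.pi_apply, Fin.insertNth_apply_succAbove]
  simp

lemma sliceMap_injective (β : Fin (m + 2) → K) : Function.Injective (sliceMap β) := fun x y h =>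
  _root_.funext fun j => by rw [← sliceMap_succAbove β x, h, sliceMap_succAbove]

lemma linSub_sliceMap_same (β : Fin (m + 2) → K) :
    linSub (sliceMap β) (X (Fin.succ (Fin.succ 0))) = ∑ j, C (β j) * X j := by
  rw [linSub_X]
  refine Finset.sum_congr rfl fun j _ => ?_
  rw [sliceMap_same]
  simp [Pi.single_apply]

lemma linSub_sliceMap_succAbove (β : Fin (m + 2) → K) (j : Fin (m + 2)) :
    linSub (sliceMap β) (X (Fin.succAbove (Fin.succ (Fin.succ 0)) j)) = X j := by
  rw [linSub_X]
  simp only [sliceMap_succAbove]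
  simp [Pi.single_apply]

variable (K m) in
/-- A polynomial ring as a ring of bivariate polynomials in its first two variables. -/
noncomputable def bivariateEquiv :
    MvPolynomial (Fin (m + 2)) K ≃ₐ[K] Polynomial (Polynomial (MvPolynomial (Fin m) K)) :=
  (finSuccEquiv K (m + 1)).trans (Polynomial.mapAlgEquiv (finSuccEquiv K m))

lemma bivariateEquiv_zero : bivariateEquiv K m (X 0) = Polynomial.X := by
  simp [bivariateEquiv, finSuccEquiv_X_zero]

lemma bivariateEquiv_one : bivariateEquiv K m (X (Fin.succ 0)) = Polynomial.C Polynomial.X := by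
  rw [bivariateEquiv, AlgEquiv.trans_apply, finSuccEquiv_X_succ]
  simp [finSuccEquiv_X_zero]

lemma bivariateEquiv_succ (j : Fin m) :
    bivariateEquiv K m (X j.succ.succ) = Polynomial.C (Polynomial.C (X j)) := by
  rw [bivariateEquiv, AlgEquiv.trans_apply, finSuccEquiv_X_succ]
  simp [finSuccEquiv_X_succ]

lemma bivariateEquiv_C (c : K) :
    bivariateEquiv K m (C c) = Polynomial.C (Polynomial.C (C c)) :=
  (bivariateEquiv K m).commutes c

lemma bivariateEquiv_linSub (β : Fin (m + 2) → K) (F : MvPolynomial (Fin (m + 3)) K) :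
    bivariateEquiv K m (linSub (sliceMap β) F) = Polynomial.planeSection β F := by
  suffices ((bivariateEquiv K m).toAlgHom.comp (linSub (sliceMap β))) = Polynomial.planeSection β from
    DFunLike.congr_fun this F
  refine algHom_ext fun i => ?_
  change bivariateEquiv K m (linSub (sliceMap β) (X i)) = _
  obtain rfl | ⟨j, rfl⟩ := Fin.eq_self_or_eq_succAbove (Fin.succ (Fin.succ (0 : Fin (m + 1)))) i
  · rw [linSub_sliceMap_same, map_sum, Polynomial.planeSection, Polynomial.sectionHom_two]
    rw [Fin.sum_univ_succ, Fin.sum_univ_succ]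
    simp only [map_mul, bivariateEquiv_C, bivariateEquiv_zero, bivariateEquiv_one, bivariateEquiv_succ,
      map_add, map_sum]
  · rw [linSub_sliceMap_succAbove, Polynomial.planeSection]
    induction j using Fin.cases with
    | zero => rw [bivariateEquiv_zero, Fin.succ_succAbove_zero, Polynomial.sectionHom_zero]
    | succ j =>
      rw [Fin.succ_succAbove_succ]
      induction j using Fin.cases with
      | zero => rw [bivariateEquiv_one, Fin.succ_succAbove_zero, Polynomial.sectionHom_one]
      | succ j =>
        rw [Fin.succ_succAbove_succ, Fin.zero_succAbove, bivariateEquiv_succ, Polynomial.sectionHom_succ]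

lemma irreducible_linSub_sliceMap {β : Fin (m + 2) → K} {F : MvPolynomial (Fin (m + 3)) K}
    (h : Irreducible (Polynomial.planeSection β F)) : Irreducible (linSub (sliceMap β) F) := by
  rw [← bivariateEquiv_linSub] at h
  exact (MulEquiv.irreducible_iff (bivariateEquiv K m)).1 h

lemma natDegree_planeSection_le (β : Fin (m + 2) → K) (F : MvPolynomial (Fin (m + 3)) K) :
    (Polynomial.planeSection β F).natDegree ≤ (linSub (sliceMap β) F).totalDegree := by
  rw [← bivariateEquiv_linSub, bivariateEquiv, AlgEquiv.trans_apply]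
  refine Polynomial.natDegree_map_le.trans ?_
  rw [natDegree_finSuccEquiv]
  exact degreeOf_le_totalDegree _ _

end sliceMap

section separable
variable {K : Type*} [Field K] {m n d : ℕ}

lemma aeval_apply_eq_eval {σ : Type*} (u : σ → K) (P : MvPolynomial σ K) : aeval u P = eval u P := by
  rw [← coe_aeval_eq_eval]
  rfl

lemma eval_homogeneousComponent_linSub [CharZero K] (A : (Fin m → K) →ₗ[K] (Fin n → K)) {F : MvPolynomial (Fin n) K}
    (hd : F.totalDegree ≤ d) (u : Fin m → K) :
    eval u (homogeneousComponent d (linSub A F)) = eval (A u) (homogeneousComponent d F) := by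
  have key {k : ℕ} {G : MvPolynomial (Fin k) K} (hG : G.totalDegree ≤ d) (u : Fin k → K) :
      eval u (homogeneousComponent d G) =
        (aeval (fun i => Polynomial.C (u i) * Polynomial.X) G).coeff d := by
    rw [Polynomial.coeff_aeval_totalDegree (fun i => by
      simpa using Polynomial.natDegree_C_mul_X_pow_le (u i) 1) hG]
    rw [aeval_apply_eq_eval]
    congr 2
    exact _root_.funext fun i => by simp
  have hev {k : ℕ} (G : MvPolynomial (Fin k) K) (u : Fin k → K) (t : K) :
      (aeval (fun i => Polynomial.C (u i) * Polynomial.X) G).eval t = eval (t • u) G := by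
    rw [← Polynomial.coe_aeval_eq_eval, comp_aeval_apply, aeval_apply_eq_eval]
    congr 2
    exact _root_.funext fun i => by
      rw [map_mul, Polynomial.aeval_C, Polynomial.aeval_X, Pi.smul_apply, smul_eq_mul, mul_comm]; rfl
  rw [key hd, key ((totalDegree_linSub_le A F).trans hd)]
  congr 1
  refine Polynomial.funext fun t => ?_
  rw [hev, hev, eval_linSub, map_smul]

lemma totalDegree_ne_zero_of_irreducible {σ : Type*} {F : MvPolynomial σ K} (hF : Irreducible F) :
    F.totalDegree ≠ 0 := fun h => by
  rw [totalDegree_eq_zero_iff_eq_C.1 h] at hF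
  refine hF.not_isUnit ((isUnit_iff_ne_zero.2 fun h0 => ?_).map C)
  rw [h0, C_0] at hF
  exact hF.ne_zero rfl

lemma homogeneousComponent_totalDegree_ne_zero {σ : Type*} {F : MvPolynomial σ K} (hF : F ≠ 0) :
    homogeneousComponent F.totalDegree F ≠ 0 := fun h => by
  obtain ⟨s, hs, hs'⟩ := Finset.exists_mem_eq_sup F.support (support_nonempty.2 hF)
    (fun s => s.sum fun _ e => e)
  have := coeff_homogeneousComponent (R := K) F.totalDegree F s
  rw [h, if_pos (by rw [totalDegree, hs', Finsupp.degree_apply]; rfl)] at this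
  exact mem_support_iff.1 hs this.symm

lemma exists_mul_add_mul_derivative_eq_C {S : Type*} [CommRing S] [IsDomain S] [CharZero S]
    [UniqueFactorizationMonoid S] {Φ : Polynomial S} (hΦ : Irreducible Φ) (hdeg : Φ.natDegree ≠ 0) :
    ∃ (p q : Polynomial S) (r : S), r ≠ 0 ∧ Φ * p + Polynomial.derivative Φ * q = Polynomial.C r := by
  have hp := hΦ.isPrimitive hdeg
  let E := FractionRing S
  have hE := (hp.irreducible_iff_irreducible_map_fraction_map (K := E)).1 hΦ
  have hinj := IsFractionRing.injective S E
  have : CharZero E := charZero_of_injective_algebraMap hinj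
  have hco := hE.separable
  rw [Polynomial.Separable, Polynomial.derivative_map] at hco
  have hr := mt Polynomial.resultant_eq_zero_iff.1 (fun h => h.2 hco)
  rw [Polynomial.natDegree_map_eq_of_injective hinj, Polynomial.natDegree_map_eq_of_injective hinj,
    Polynomial.resultant_map_map] at hr
  obtain ⟨p, q, -, -, hpq⟩ := Polynomial.exists_mul_add_mul_eq_C_resultant Φ
    (Polynomial.derivative Φ) le_rfl le_rfl (Or.inl hdeg)
  exact ⟨p, q, _, fun h => hr (by rw [h, map_zero]), hpq⟩

lemma eval_map_sectionHom (w : Fin m → K) (F : MvPolynomial (Fin (m + 3)) K) (x : K) :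
    ((Polynomial.sectionHom w 0 0 0 F).map (Polynomial.evalRingHom 0)).eval x =
      eval (Matrix.vecCons x (Matrix.vecCons 0 (Matrix.vecCons 0 w))) F := by
  suffices ((Polynomial.evalRingHom x).comp (Polynomial.mapRingHom (Polynomial.evalRingHom 0))).comp
      (Polynomial.sectionHom w 0 0 0 : MvPolynomial (Fin (m + 3)) K →ₐ[K] _).toRingHom =
      eval (Matrix.vecCons x (Matrix.vecCons 0 (Matrix.vecCons 0 w))) from DFunLike.congr_fun this F
  refine ringHom_ext (fun c => ?_) fun i => ?_
  · simp
  · simp only [RingHom.comp_apply, eval_X, AlgHom.toRingHom_eq_coe, RingHom.coe_coe]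
    revert i
    refine Fin.cases ?_ (Fin.cases ?_ (Fin.cases ?_ fun j => ?_))
    · rw [Polynomial.sectionHom_zero]; simp
    · rw [Polynomial.sectionHom_one]; simp
    · rw [Polynomial.sectionHom_two]; simp
    · rw [Polynomial.sectionHom_succ]; simp

lemma exists_linearEquiv_separable [CharZero K] {F : MvPolynomial (Fin (m + 1 + 3)) K} (hF : Irreducible F) :
    ∃ e : (Fin (m + 1 + 3) → K) ≃ₗ[K] (Fin (m + 1 + 3) → K),
      ((Polynomial.sectionHom (Pi.single 0 1 : Fin (m + 1) → K) 0 0 0 (linSub e.toLinearMap F)).map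
        (Polynomial.evalRingHom 0)).natDegree = F.totalDegree ∧
      ((Polynomial.sectionHom (Pi.single 0 1 : Fin (m + 1) → K) 0 0 0 (linSub e.toLinearMap F)).map
        (Polynomial.evalRingHom 0)).Separable := by
  obtain ⟨p, hp⟩ : ∃ p, eval p (homogeneousComponent F.totalDegree F * X 0) ≠ 0 := by
    by_contra! h
    exact mul_ne_zero (homogeneousComponent_totalDegree_ne_zero hF.ne_zero) (X_ne_zero 0)
      (MvPolynomial.funext fun p => by rw [h, map_zero])
  rw [map_mul, eval_X] at hp
  obtain ⟨e₁, he₁, -⟩ := exists_linearEquiv_single (right_ne_zero_of_mul hp)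
  set F₁ := linSub e₁.toLinearMap F with hF₁
  have hF₁i : Irreducible F₁ := (irreducible_linSub_iff e₁).2 hF
  have hΦ : Irreducible (finSuccEquiv K (m + 3) F₁) :=
    (MulEquiv.irreducible_iff (finSuccEquiv K (m + 3))).2 hF₁i
  have hcoeff (v : Fin (m + 3) → K) : (finSuccEquiv K (m + 3) F₁).map (eval v) =
      aeval (Fin.cons Polynomial.X fun i => Polynomial.C (v i)) F₁ := by
    refine Polynomial.funext fun x => ?_
    rw [← eval_eq_eval_mv_eval', ← Polynomial.coe_aeval_eq_eval, comp_aeval_apply,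
      aeval_apply_eq_eval]
    congr 2
    refine _root_.funext (Fin.cases ?_ fun j => ?_) <;> simp
  have htop : eval (Pi.single 0 1) (homogeneousComponent F.totalDegree F₁) ≠ 0 := by
    rw [hF₁, eval_homogeneousComponent_linSub _ le_rfl]
    change eval (e₁ _) _ ≠ 0
    rw [he₁]
    exact left_ne_zero_of_mul hp
  have hd (v : Fin (m + 3) → K) : ((finSuccEquiv K (m + 3) F₁).map (eval v)).natDegree =
      F.totalDegree := by
    refine le_antisymm (Polynomial.natDegree_map_le.trans ?_) (Polynomial.le_natDegree_of_ne_zero ?_)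
    · rw [natDegree_finSuccEquiv]
      exact (degreeOf_le_totalDegree _ _).trans (totalDegree_linSub_le _ _)
    · rw [hcoeff, Polynomial.coeff_aeval_totalDegree (Fin.cases (by simp) (by simp))
        (totalDegree_linSub_le _ _)]
      convert htop using 1
      rw [aeval_apply_eq_eval]
      congr 2
      refine _root_.funext (Fin.cases ?_ fun j => ?_) <;> simp
  have hdeg : (finSuccEquiv K (m + 3) F₁).natDegree ≠ 0 := fun h => by
    have := (Polynomial.natDegree_map_le (f := eval 0) (p := finSuccEquiv K (m + 3) F₁))
    rw [hd 0, h] at this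
    exact totalDegree_ne_zero_of_irreducible hF (Nat.le_zero.1 this)
  obtain ⟨a, b, r, hr, hab⟩ := exists_mul_add_mul_derivative_eq_C hΦ hdeg
  obtain ⟨v, hv⟩ : ∃ v, eval v (r * X (Fin.succ (Fin.succ 0))) ≠ 0 := by
    by_contra! h
    exact mul_ne_zero hr (X_ne_zero _) (MvPolynomial.funext fun p => by rw [h, map_zero])
  rw [map_mul, eval_X] at hv
  have hsep : ((finSuccEquiv K (m + 3) F₁).map (eval v)).Separable := by
    refine Polynomial.separable_def' _ |>.2 ⟨Polynomial.C (eval v r)⁻¹ * a.map (eval v),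
      Polynomial.C (eval v r)⁻¹ * b.map (eval v), ?_⟩
    have := congrArg (Polynomial.map (eval v)) hab
    rw [Polynomial.map_add, Polynomial.map_mul, Polynomial.map_mul, Polynomial.map_C,
      ← Polynomial.derivative_map] at this
    have h1 : Polynomial.C (eval v r)⁻¹ * Polynomial.C (eval v r) = 1 := by
      rw [← Polynomial.C_mul, inv_mul_cancel₀ (left_ne_zero_of_mul hv), Polynomial.C_1]
    linear_combination Polynomial.C (eval v r)⁻¹ * this + h1
  obtain ⟨e₂, he₂, he₂'⟩ := exists_linearEquiv_single (n := m + 1 + 3)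
    (i := Fin.succ (Fin.succ (Fin.succ 0))) (v := Fin.cons 0 v) (right_ne_zero_of_mul hv)
  refine ⟨e₂.trans e₁, ?_⟩
  have hq : (Polynomial.sectionHom (Pi.single 0 1 : Fin (m + 1) → K) 0 0 0
      (linSub (e₂.trans e₁).toLinearMap F)).map (Polynomial.evalRingHom 0) =
      (finSuccEquiv K (m + 3) F₁).map (eval v) := by
    refine Polynomial.funext fun x => ?_
    rw [eval_map_sectionHom, ← eval_eq_eval_mv_eval', hF₁, eval_linSub, eval_linSub]
    have h : (Matrix.vecCons x (Matrix.vecCons 0 (Matrix.vecCons 0 (Pi.single 0 1))) :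
        Fin (m + 1 + 3) → K) = x • Pi.single 0 1 + Pi.single (Fin.succ (Fin.succ (Fin.succ 0))) 1 := by
      refine _root_.funext (Fin.cases ?_ (Fin.cases ?_ (Fin.cases ?_ fun j => ?_)))
      all_goals simp only [Matrix.cons_val_zero, Matrix.cons_val_succ, Pi.add_apply, Pi.smul_apply,
        Pi.single_apply, Fin.succ_inj, Fin.succ_ne_zero, (Fin.succ_ne_zero _).symm, if_true, if_false,
        smul_eq_mul, mul_one, mul_zero, add_zero, zero_add]
    rw [h]
    change eval (e₁ (e₂ _)) F = eval (e₁ _) F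
    rw [map_add, map_smul, he₂, he₂' 0 (Fin.succ_ne_zero _).symm]
    refine congrArg (fun u => eval (e₁ u) F) (_root_.funext (Fin.cases ?_ fun j => ?_)) <;> simp
  rw [hq]
  exact ⟨hd v, hsep⟩

end separable

section hyperplane
variable {K : Type*} [Field K] {m n : ℕ}

lemma linearMap_eq_sum_mul (f : (Fin n → K) →ₗ[K] K) (x : Fin n → K) :
    f x = ∑ k, x k * f (Pi.single k 1) := by
  conv_lhs => rw [LinearMap.pi_apply_eq_sum_univ f x]
  refine Finset.sum_congr rfl fun k _ => ?_
  rw [smul_eq_mul]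
  refine congrArg (x k * f ·) (_root_.funext fun i => ?_)
  simp [Pi.single_apply, eq_comm]

/-- A linear map with values in the image of an injective one factors through it. -/
lemma exists_linearEquiv_comp_eq {φ ψ : (Fin m → K) →ₗ[K] (Fin n → K)} (hφ : Function.Injective φ)
    (hψ : Function.Injective ψ) (h : ∀ x, ψ x ∈ LinearMap.range φ) :
    ∃ t : (Fin m → K) ≃ₗ[K] (Fin m → K), φ ∘ₗ t.toLinearMap = ψ := by
  let t₀ : (Fin m → K) →ₗ[K] (Fin m → K) :=
    (LinearEquiv.ofInjective φ hφ).symm.toLinearMap ∘ₗ ψ.codRestrict (LinearMap.range φ) h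
  have ht₀ (x : Fin m → K) : φ (t₀ x) = ψ x := by
    change ((LinearEquiv.ofInjective φ hφ (t₀ x) : LinearMap.range φ) : Fin n → K) = ψ x
    simp [t₀]
  have hinj : Function.Injective t₀ := fun x y hxy => hψ (by rw [← ht₀, hxy, ht₀])
  exact ⟨LinearEquiv.ofInjectiveEndo t₀ hinj, LinearMap.ext ht₀⟩

/-- The value at `a` of the linear form `a ↦ ⟨a, v⟩`. -/
lemma eval_sum_C_mul_X (a v : Fin n → K) : eval a (∑ i, C (v i) * X i) = ∑ i, v i * a i := by
  simp

lemma isHomogeneous_sum_C_mul_X (v : Fin n → K) : (∑ i, C (v i) * X i).IsHomogeneous 1 :=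
  IsHomogeneous.sum _ _ _ fun i _ => isHomogeneous_C_mul_X _ i

lemma exists_forall_irreducible_linSub [CharZero K] {F : MvPolynomial (Fin (m + 1 + 3)) K}
    (hF : Irreducible F) : ∃ (G : MvPolynomial (Fin (m + 1 + 3)) K) (D : ℕ), G ≠ 0 ∧
      G.IsHomogeneous D ∧ D ≤ 12 * F.totalDegree ^ 3 ∧ ∀ a, eval a G ≠ 0 →
        ∀ φ : (Fin (m + 1 + 2) → K) →ₗ[K] (Fin (m + 1 + 3) → K), Function.Injective φ →
          (LinearMap.range φ : Set (Fin (m + 1 + 3) → K)) = {x | ∑ i, a i * x i = 0} →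
          Irreducible (linSub φ F) ∧ (linSub φ F).totalDegree = F.totalDegree := by
  obtain ⟨e, hq, hsep⟩ := exists_linearEquiv_separable hF
  have hd0 := totalDegree_ne_zero_of_irreducible hF
  obtain ⟨P, hP, hPdeg, hPirr⟩ := Polynomial.exists_forall_irreducible_planeSection
    ((irreducible_linSub_iff e).2 hF) (totalDegree_linSub e F).le hd0 _ hq hsep
  set two : Fin (m + 1 + 3) := Fin.succ (Fin.succ (0 : Fin (m + 1 + 1))) with htwo
  let ℓ (k : Fin (m + 1 + 3)) : MvPolynomial (Fin (m + 1 + 3)) K :=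
    ∑ i, C (e (Pi.single k 1) i) * X i
  have hℓ (k) : (ℓ k).IsHomogeneous 1 := isHomogeneous_sum_C_mul_X _
  have hev (a) (k) : eval a (ℓ k) = ∑ i, e (Pi.single k 1) i * a i := eval_sum_C_mul_X _ _
  have hsum (a x : Fin (m + 1 + 3) → K) : ∑ i, a i * e x i = ∑ k, x k * eval a (ℓ k) := by
    have := linearMap_eq_sum_mul ((∑ i, a i • LinearMap.proj i) ∘ₗ e.toLinearMap) x
    simpa [hev, mul_comm] using this
  obtain ⟨G, hGh, hG0, hGe⟩ := exists_isHomogeneous_eval_div (hℓ two)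
    (M := fun j => -ℓ (two.succAbove j)) (fun j => (hℓ _).neg) P
  refine ⟨G, _, ?_, hGh, ?_, fun a ha φ hφ hrange => ?_⟩
  · obtain ⟨β, hβ⟩ : ∃ β, eval β P ≠ 0 := by
      by_contra! h
      exact hP (MvPolynomial.funext fun p => by rw [h, map_zero])
    let f : (Fin (m + 1 + 3) → K) →ₗ[K] K :=
      LinearMap.proj two - ∑ j, β j • LinearMap.proj (two.succAbove j)
    let a : Fin (m + 1 + 3) → K := fun i => f (e.symm (Pi.single i 1))
    have ha (k) : eval a (ℓ k) = f (Pi.single k 1) := by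
      rw [hev]
      refine (linearMap_eq_sum_mul (f ∘ₗ e.symm.toLinearMap) _).symm.trans ?_
      simp
    have h2 : eval a (ℓ two) = 1 := by
      rw [ha]
      simp [f, Fin.succAbove_ne]
    have hs (j) : eval a (ℓ (two.succAbove j)) = -β j := by
      rw [ha]
      simp [f, Pi.single_apply, Fin.ne_succAbove]
    rintro rfl
    have := hGe a (by rw [h2]; exact one_ne_zero)
    simp only [map_zero, h2, one_pow, one_mul, map_neg, hs, neg_neg, div_one] at this
    exact hβ this.symm
  · have : 1 ≤ F.totalDegree ^ 3 := Nat.one_le_pow _ _ (Nat.pos_of_ne_zero hd0)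
    omega
  · have h2 : eval a (ℓ two) ≠ 0 := fun h => ha (hG0 a h)
    have hPβ := hGe a h2 ▸ ha
    replace hPβ := right_ne_zero_of_mul hPβ
    set β : Fin (m + 1 + 2) → K := fun j => eval a (-ℓ (two.succAbove j)) / eval a (ℓ two) with hβ
    obtain ⟨hirr, hdeg⟩ := hPirr β hPβ
    obtain ⟨t, ht⟩ := exists_linearEquiv_comp_eq (ψ := e.toLinearMap ∘ₗ sliceMap β) hφ
      (e.injective.comp (sliceMap_injective β)) fun y => by
        rw [← SetLike.mem_coe, hrange, Set.mem_ofPred_eq]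
        change ∑ i, a i * e (sliceMap β y) i = 0
        rw [hsum, Fin.sum_univ_succAbove _ two, sliceMap_same, Finset.sum_mul, ← Finset.sum_add_distrib]
        refine Finset.sum_eq_zero fun j _ => ?_
        rw [sliceMap_succAbove, hβ]
        beta_reduce
        rw [map_neg]
        field_simp
        ring
    have hcomp : linSub t.toLinearMap (linSub φ F) =
        linSub (sliceMap β) (linSub e.toLinearMap F) := by
      rw [linSub_linSub, linSub_linSub, ht]
    refine ⟨(irreducible_linSub_iff t).1 ?_, le_antisymm (totalDegree_linSub_le _ _) ?_⟩
    · rw [hcomp]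
      exact irreducible_linSub_sliceMap hirr
    · rw [← totalDegree_linSub t, hcomp]
      exact hdeg.symm.le.trans (natDegree_planeSection_le _ _)

end hyperplane

section factorisation
variable {K : Type*} [Field K] {m : ℕ}

lemma totalDegree_le_of_dvd {σ : Type*} {f g : MvPolynomial σ K} (h : f ∣ g) (hg : g ≠ 0) :
    f.totalDegree ≤ g.totalDegree := by
  obtain ⟨k, rfl⟩ := h
  rw [totalDegree_mul_of_isDomain (left_ne_zero_of_mul hg) (right_ne_zero_of_mul hg)]
  exact Nat.le_add_right _ _

lemma ne_zero_of_rIrreducible {n r : ℕ} {f : MvPolynomial (Fin (n + 1)) K} (hf : RIrreducible r f)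
    (hr : 1 ≤ r) : f ≠ 0 := by
  rintro rfl
  exact X_prime.not_isUnit
    (hf (X 0) (dvd_zero _) ((totalDegree_X (R := K) (0 : Fin (n + 1))).trans_le hr))

variable [CharZero K]

lemma exists_forall_irreducible_dvd_linSub {F : MvPolynomial (Fin (m + 1 + 3)) K} (hF : F ≠ 0) :
    ∃ (G : MvPolynomial (Fin (m + 1 + 3)) K) (D : ℕ), G ≠ 0 ∧
      G.IsHomogeneous D ∧ D ≤ 12 * F.totalDegree ^ 3 ∧ ∀ a, eval a G ≠ 0 →
        ∀ φ : (Fin (m + 1 + 2) → K) →ₗ[K] (Fin (m + 1 + 3) → K), Function.Injective φ →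
          (LinearMap.range φ : Set (Fin (m + 1 + 3) → K)) = {x | ∑ i, a i * x i = 0} →
          linSub φ F ≠ 0 ∧ ∀ q, Irreducible q → q ∣ linSub φ F →
            ∃ Q, Irreducible Q ∧ Q ∣ F ∧ q.totalDegree = Q.totalDegree := by
  induction F using UniqueFactorizationMonoid.induction_on_prime with
  | h₁ => exact absurd rfl hF
  | h₂ u hu =>
    refine ⟨1, 0, one_ne_zero, isHomogeneous_one _ _, Nat.zero_le _, fun a _ φ _ _ => ?_⟩
    have hu' := hu.map (linSub φ)
    exact ⟨hu'.ne_zero, fun q hq h => absurd (isUnit_of_dvd_unit h hu') hq.not_isUnit⟩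
  | h₃ F p hF0 hp ih =>
    obtain ⟨G₁, D₁, hG₁, hh₁, hD₁, H₁⟩ := exists_forall_irreducible_linSub hp.irreducible
    obtain ⟨G₂, D₂, hG₂, hh₂, hD₂, H₂⟩ := ih hF0
    refine ⟨G₁ * G₂, D₁ + D₂, mul_ne_zero hG₁ hG₂, hh₁.mul hh₂, ?_, fun a ha φ hφ hr => ?_⟩
    · rw [totalDegree_mul_of_isDomain hp.ne_zero hF0]
      nlinarith [Nat.zero_le (p.totalDegree ^ 2 * F.totalDegree),
        Nat.zero_le (p.totalDegree * F.totalDegree ^ 2)]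
    · rw [map_mul] at ha
      obtain ⟨hirr, hdeg⟩ := H₁ a (left_ne_zero_of_mul ha) φ hφ hr
      obtain ⟨hne, H⟩ := H₂ a (right_ne_zero_of_mul ha) φ hφ hr
      rw [map_mul]
      refine ⟨mul_ne_zero hirr.ne_zero hne, fun q hq hdvd => ?_⟩
      rcases hq.prime.dvd_or_dvd hdvd with h | h
      · refine ⟨p, hp.irreducible, dvd_mul_right _ _, ?_⟩
        rw [← hdeg]
        exact le_antisymm (totalDegree_le_of_dvd h hirr.ne_zero)
          (totalDegree_le_of_dvd (hq.associated_of_dvd hirr h).symm.dvd hq.ne_zero)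
      · obtain ⟨Q, hQ, hQF, hqQ⟩ := H q hq h
        exact ⟨Q, hQ, hQF.mul_left p, hqQ⟩

end factorisation
end MvPolynomial

/-- Bertini/Hilbert-type theorem: for `n ≥ 4` there is `c = c(n)` such that for every `r ≥ 1` and
every homogeneous `r`-irreducible (over ℚ) `F ∈ ℤ[X₁,…,Xₙ]` of degree `d ≥ 1` there is a nonzero
homogeneous form `G` of degree at most `c·d³` in the coefficients `a` of a linear form such that
whenever `G(a) ≠ 0`, the restriction of `F` to the hyperplane `{Σ aᵢxᵢ = 0}` is `r`-irreducible
over ℚ. -/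
theorem bertini_hilbert_hyperplane_sections (n : ℕ) (hn : 4 ≤ n) :
    ∃ c : ℕ, ∀ (r : ℕ), 1 ≤ r → ∀ (F : MvPolynomial (Fin n) ℤ) (d : ℕ), 1 ≤ d →
      MvPolynomial.IsHomogeneous F d →
      RIrreducible r (MvPolynomial.map (Int.castRingHom ℚ) F) →
      ∃ (G : MvPolynomial (Fin n) ℚ) (D : ℕ), G ≠ 0 ∧ MvPolynomial.IsHomogeneous G D ∧
        D ≤ c * d ^ 3 ∧
        ∀ a : Fin n → ℚ, a ≠ 0 → MvPolynomial.eval a G ≠ 0 →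
          ∀ φ : (Fin (n - 1) → ℚ) →ₗ[ℚ] (Fin n → ℚ), Function.Injective φ →
            (LinearMap.range φ : Set (Fin n → ℚ)) = {x : Fin n → ℚ | ∑ i, a i * x i = 0} →
            RIrreducible r (MvPolynomial.aeval
              (fun i : Fin n => ∑ j : Fin (n - 1),
                MvPolynomial.C (φ (Pi.single j 1) i) * MvPolynomial.X j)
              (MvPolynomial.map (Int.castRingHom ℚ) F)) := by
  obtain ⟨m, rfl⟩ : ∃ m, n = m + 1 + 3 := ⟨n - 4, by omega⟩
  refine ⟨12, fun r hr F d _ hF hirr => ?_⟩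
  obtain ⟨G, D, hG, hh, hD, H⟩ := exists_forall_irreducible_dvd_linSub
    (ne_zero_of_rIrreducible hirr hr)
  have hd := (hF.map (Int.castRingHom ℚ)).totalDegree_le
  refine ⟨G, D, hG, hh, hD.trans (Nat.mul_le_mul_left _ (Nat.pow_le_pow_left hd 3)),
    fun a _ ha φ hφ hrange g hg hgr => ?_⟩
  obtain ⟨hne, Hq⟩ := H a ha φ hφ hrange
  by_contra hu
  obtain ⟨q, hq, hqg⟩ := WfDvdMonoid.exists_irreducible_factor hu (ne_zero_of_dvd_ne_zero hne hg)
  obtain ⟨Q, hQ, hQF, hqQ⟩ := Hq q hq (hqg.trans hg)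
  refine hQ.not_isUnit (hirr Q hQF ?_)
  rw [← hqQ]
  exact (totalDegree_le_of_dvd hqg (ne_zero_of_dvd_ne_zero hne hg)).trans hgr
end

section
/- Let K be an algebraically closed field, let n ≥ 3, and let F ∈ K[x_0,…,x_n] be an irreducible homogeneous polynomial of degree d ≥ 2. Let u ∈ K^{n+1} be nonzero with F(u) = 0, and assume the hypersurface X = {F = 0} ⊂ ℙ^n is not a cone with cone point [u]; that is, assume there exist w ∈ K^{n+1} with F(w) = 0 and scalars s, t ∈ K with F(s·u + t·w) ≠ 0. Then the set of K-linear subspaces W ⊆ K^{n+1} of dimension n−1 (i.e., (n−2)-planes of ℙ^n) with u ∈ W and with F vanishing identically on W is finite of cardinality at most d². If moreover [u] is a smooth point of X, i.e., some partial derivative ∂F/∂x_i does not vanish at u, then this cardinality is at most d. -/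
open MvPolynomial

theorem two_mul_finrank_restrictTotalDegree_fin_two (A : Type*) [CommRing A] [Nontrivial A]
    (m : ℕ) :
    2 * Module.finrank A (restrictTotalDegree (Fin 2) A m) = (m + 1) * (m + 2) := by
  have hcard : Nat.card {s : Fin 2 →₀ ℕ | (s.sum fun _ e => e) ≤ m} =
      Nat.card (Σ i : Fin (m + 1), Fin (i + 1)) := by
    symm
    refine Nat.card_eq_of_bijective
      (fun x => ⟨Finsupp.equivFunOnFinite.symm ![(x.2 : ℕ), x.1 - x.2], ?_⟩) ⟨?_, ?_⟩
    · have h1 := x.1.2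
      have h2 := x.2.2
      simp only [Set.mem_ofPred_eq]
      rw [Finsupp.sum_fintype _ _ (by simp)]
      simp
      omega
    · rintro ⟨⟨i, hi⟩, ⟨j, hj⟩⟩ ⟨⟨i', hi'⟩, ⟨j', hj'⟩⟩ h
      have h0 := DFunLike.congr_fun (congrArg Subtype.val h) 0
      have h1 := DFunLike.congr_fun (congrArg Subtype.val h) 1
      simp at h0 h1
      simp at hj hj'
      obtain rfl : i = i' := by omega
      subst h0
      rfl
    · rintro ⟨s, hs⟩
      rw [Set.mem_ofPred_eq, Finsupp.sum_fintype _ _ (by simp)] at hs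
      simp at hs
      refine ⟨⟨⟨s 0 + s 1, by omega⟩, ⟨s 0, by simp⟩⟩, ?_⟩
      ext i
      fin_cases i <;> simp
  have h : Module.finrank A (restrictTotalDegree (Fin 2) A m) =
      ∑ i ∈ Finset.range (m + 1), (i + 1) := by
    rw [restrictTotalDegree, Module.finrank_eq_nat_card_basis
      (basisRestrictSupport A {s : Fin 2 →₀ ℕ | (s.sum fun _ e => e) ≤ m}), hcard, Nat.card_sigma]
    simp [Finset.sum_range]
  rw [h]
  clear h hcard
  induction m with
  | zero => simp
  | succ m ih => rw [Finset.sum_range_succ, mul_add, ih]; ring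

theorem finrank_range_add_finrank_ker_of_isDomain {A M N : Type*} [CommRing A] [IsDomain A]
    [AddCommGroup M] [Module A M] [Module.Finite A M] [AddCommGroup N] [Module A N]
    (f : M →ₗ[A] N) :
    Module.finrank A (LinearMap.range f) + Module.finrank A (LinearMap.ker f) =
      Module.finrank A M := by
  rw [← f.quotKerEquivRange.finrank_eq]
  exact Submodule.finrank_quotient_add_finrank _

/-- A polynomial of bounded degree separating one point of a finite set from the others. -/
theorem exists_totalDegree_le_eval_ne_zero {A σ : Type*} [CommRing A] [IsDomain A]
    (T : Finset (σ → A)) (p : σ → A) :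
    ∃ q : MvPolynomial σ A, q.totalDegree ≤ T.card ∧ eval p q ≠ 0 ∧
      ∀ p' ∈ T, p' ≠ p → eval p' q = 0 := by
  classical
  induction T using Finset.induction_on with
  | empty => exact ⟨1, by simp⟩
  | insert a T ha ih =>
    obtain ⟨q, hq, hqp, hqT⟩ := ih
    rw [Finset.card_insert_of_notMem ha]
    by_cases hap : a = p
    · subst hap
      refine ⟨q, by omega, hqp, fun p' hp' hne => hqT p' ?_ hne⟩
      simpa [hne] using hp'
    · obtain ⟨c, hc⟩ := Function.ne_iff.mp hap
      refine ⟨q * (X c - C (a c)), ?_, ?_, ?_⟩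
      · refine (totalDegree_mul _ _).trans (add_le_add hq ?_)
        refine (totalDegree_sub_C_le _ _).trans ?_
        simp
      · simpa using ⟨hqp, sub_ne_zero.mpr (Ne.symm hc)⟩
      · intro p' hp' hne
        rcases Finset.mem_insert.mp hp' with rfl | h
        · simp
        · simp [hqT p' h hne]

/-- Bézout's inequality for plane curves without common component. -/
theorem card_le_totalDegree_mul_totalDegree {A : Type*} [CommRing A] [IsDomain A]
    [IsNoetherianRing A] (P Q : MvPolynomial (Fin 2) A) (hP : P ≠ 0)
    (hPQ : ∀ h k, P * h = Q * k → P ∣ k) (T : Finset (Fin 2 → A))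
    (hTP : ∀ p ∈ T, eval p P = 0) (hTQ : ∀ p ∈ T, eval p Q = 0) :
    T.card ≤ P.totalDegree * Q.totalDegree := by
  classical
  set a := P.totalDegree with ha
  set b := Q.totalDegree with hb
  set N := T.card with hN
  let M := fun m => restrictTotalDegree (Fin 2) A m
  let r := fun m => Module.finrank A (M m)
  have hr : ∀ m, 2 * r m = (m + 1) * (m + 2) :=
    two_mul_finrank_restrictTotalDegree_fin_two A
  let ev : M (N + a + b) →ₗ[A] (T → A) :=
    (LinearMap.pi fun p : T => (aeval (R := A) (p : Fin 2 → A)).toLinearMap) ∘ₗ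
      (M (N + a + b)).subtype
  have hev : ∀ (x : M (N + a + b)) (p : T), ev x p = eval (p : Fin 2 → A) x.1 := by
    intro x p
    simp [ev, aeval_eq_eval]
  have h1 : N ≤ Module.finrank A (LinearMap.range ev) := by
    have hsep : ∀ p : T, ∃ x : M (N + a + b), ev x p ≠ 0 ∧ ∀ p' : T, p' ≠ p → ev x p' = 0 := by
      intro p
      obtain ⟨q, hq, hqp, hqT⟩ := exists_totalDegree_le_eval_ne_zero T (p : Fin 2 → A)
      refine ⟨⟨q, (mem_restrictTotalDegree _ _ _).mpr (by omega)⟩, ?_, ?_⟩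
      · rw [hev]; exact hqp
      · intro p' hp'
        rw [hev]
        exact hqT p' p'.2 (fun h => hp' (Subtype.ext h))
    choose x hx hx' using hsep
    have hli : LinearIndependent A (fun p : T => (⟨ev (x p), ⟨x p, rfl⟩⟩ : LinearMap.range ev)) := by
      rw [Fintype.linearIndependent_iff]
      intro g hg p
      have h := congrFun (congrArg Subtype.val hg) p
      simp only [Submodule.coe_sum, Submodule.coe_smul, Finset.sum_apply, Pi.smul_apply,
        smul_eq_mul, Submodule.coe_zero, Pi.zero_apply] at h
      rw [Finset.sum_eq_single p (fun p' _ hp' => by rw [hx' p' p hp'.symm, mul_zero])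
        (by simp)] at h
      exact (mul_eq_zero.mp h).resolve_right (hx p)
    simpa [hN] using hli.fintype_card_le_finrank
  let Φ : (M (N + b) × M (N + a)) →ₗ[A] MvPolynomial (Fin 2) A :=
    ((LinearMap.mulLeft A P) ∘ₗ (M (N + b)).subtype).coprod
      (-((LinearMap.mulLeft A Q) ∘ₗ (M (N + a)).subtype))
  have hΦ : ∀ x, Φ x = P * x.1.1 - Q * x.2.1 := by
    intro x
    simp [Φ, sub_eq_add_neg]
  have hdeg : ∀ x, Φ x ∈ M (N + a + b) := by
    intro x
    have hx1 := (mem_restrictTotalDegree _ _ _).mp x.1.2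
    have hx2 := (mem_restrictTotalDegree _ _ _).mp x.2.2
    rw [hΦ]
    refine (mem_restrictTotalDegree _ _ _).mpr ((totalDegree_sub _ _).trans (max_le ?_ ?_))
    · exact (totalDegree_mul _ _).trans (by omega)
    · exact (totalDegree_mul _ _).trans (by omega)
  let Φ' : (M (N + b) × M (N + a)) →ₗ[A] M (N + a + b) := Φ.codRestrict _ hdeg
  have h2 : Module.finrank A (LinearMap.range Φ') ≤ Module.finrank A (LinearMap.ker ev) := by
    refine Submodule.finrank_mono ?_
    rintro _ ⟨x, rfl⟩
    rw [LinearMap.mem_ker]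
    ext p
    rw [hev]
    simp [Φ', hΦ, hTP p p.2, hTQ p p.2]
  let Ψ : M N →ₗ[A] (M (N + b) × M (N + a)) :=
    (((LinearMap.mulLeft A Q) ∘ₗ (M N).subtype).codRestrict _ (fun x => by
      have hx1 := (mem_restrictTotalDegree _ _ _).mp x.2
      refine (mem_restrictTotalDegree _ _ _).mpr ((totalDegree_mul _ _).trans ?_)
      simp only [Submodule.subtype_apply]
      omega)).prod
    (((LinearMap.mulLeft A P) ∘ₗ (M N).subtype).codRestrict _ (fun x => by
      have hx1 := (mem_restrictTotalDegree _ _ _).mp x.2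
      refine (mem_restrictTotalDegree _ _ _).mpr ((totalDegree_mul _ _).trans ?_)
      simp only [Submodule.subtype_apply]
      omega))
  have h3 : Module.finrank A (LinearMap.ker Φ') ≤ r N := by
    refine le_trans (Submodule.finrank_mono (t := LinearMap.range Ψ) ?_)
      (LinearMap.finrank_range_le Ψ)
    rintro ⟨⟨h, hh⟩, ⟨k, hk⟩⟩ hx
    have hx0 : P * h = Q * k := by
      have := congrArg Subtype.val (LinearMap.mem_ker.mp hx)
      simpa [Φ', hΦ, sub_eq_zero] using this
    obtain ⟨l, rfl⟩ := hPQ h k hx0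
    have hl : h = Q * l := mul_left_cancel₀ hP (by rw [hx0]; ring)
    subst hl
    refine ⟨⟨l, (mem_restrictTotalDegree _ _ _).mpr ?_⟩, ?_⟩
    · by_cases hl0 : l = 0
      · simp [hl0]
      · have := (mem_restrictTotalDegree _ _ _).mp hk
        rw [totalDegree_mul_of_isDomain hP hl0] at this
        omega
    · rfl
  have h4 := finrank_range_add_finrank_ker_of_isDomain ev
  have h5 := finrank_range_add_finrank_ker_of_isDomain Φ'
  have hfree : ∀ m, Module.Free A (M m) := fun m => Module.Free.of_basis
    (basisRestrictSupport A {s : Fin 2 →₀ ℕ | (s.sum fun _ e => e) ≤ m})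
  rw [Module.finrank_prod] at h5
  change _ = r (N + b) + r (N + a) at h5
  change _ = r (N + a + b) at h4
  have e1 := hr (N + a + b)
  have e2 := hr (N + a)
  have e3 := hr (N + b)
  have e4 := hr N
  have : r N + r (N + a + b) = r (N + a) + r (N + b) + a * b := by nlinarith
  omega

/-- A polynomial and a family of polynomials without common prime factor have few common zeros. -/
theorem card_le_totalDegree_mul_of_forall_prime {A : Type*} [CommRing A] [IsDomain A]
    [UniqueFactorizationMonoid A] [IsNoetherianRing A] {ι : Type*}
    (G : ι → MvPolynomial (Fin 2) A) (d : ℕ) (hd : ∀ i, (G i).totalDegree ≤ d)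
    (hG : ∀ P, Prime P → ∃ i, ¬ P ∣ G i) (Q : MvPolynomial (Fin 2) A) (hQ : Q ≠ 0) :
    ∀ T : Finset (Fin 2 → A), (∀ p ∈ T, eval p Q = 0) → (∀ p ∈ T, ∀ i, eval p (G i) = 0) →
      T.card ≤ Q.totalDegree * d := by
  classical
  induction Q using UniqueFactorizationMonoid.induction_on_prime with
  | h₁ => exact absurd rfl hQ
  | h₂ Q hunit =>
    intro T hT _
    have : T = ∅ := Finset.eq_empty_of_forall_notMem fun p hp =>
      (hunit.map (eval p)).ne_zero (hT p hp)
    simp [this]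
  | h₃ Q P hQ0 hP ih =>
    intro T hT hTG
    rw [totalDegree_mul_of_isDomain hP.ne_zero hQ0, add_mul,
      ← Finset.card_filter_add_card_filter_not (s := T) (fun p => eval p P = 0)]
    refine add_le_add ?_ (ih hQ0 _ ?_ ?_)
    · obtain ⟨i, hi⟩ := hG P hP
      refine (card_le_totalDegree_mul_totalDegree P (G i) hP.ne_zero ?_ _ ?_ ?_).trans
        (Nat.mul_le_mul_left _ (hd i))
      · intro h k hhk
        exact (hP.dvd_or_dvd ⟨h, hhk.symm⟩).resolve_left hi
      · intro p hp
        exact (Finset.mem_filter.mp hp).2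
      · intro p hp
        exact hTG p (Finset.mem_filter.mp hp).1 i
    · intro p hp
      obtain ⟨hpT, hp⟩ := Finset.mem_filter.mp hp
      have := hT p hpT
      rw [map_mul] at this
      exact (mul_eq_zero.mp this).resolve_left hp
    · intro p hp
      exact hTG p (Finset.mem_filter.mp hp).1

theorem card_le_totalDegree_coeff_mul {A : Type*} [CommRing A] [IsDomain A]
    [UniqueFactorizationMonoid A] [IsNoetherianRing A]
    (H : Polynomial (MvPolynomial (Fin 2) A)) (hH : Irreducible H) (hH0 : H.natDegree ≠ 0)
    (d : ℕ) (hd : ∀ j, (H.coeff j).totalDegree ≤ d) (i : ℕ) (hi : H.coeff i ≠ 0)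
    (T : Finset (Fin 2 → A)) (hT : ∀ p ∈ T, ∀ j, eval p (H.coeff j) = 0) :
    T.card ≤ (H.coeff i).totalDegree * d := by
  refine card_le_totalDegree_mul_of_forall_prime H.coeff d hd ?_ _ hi T (fun p hp => hT p hp i) hT
  intro P hP
  by_contra! h
  exact hP.not_isUnit (hH.isPrimitive hH0 P ((Polynomial.C_dvd_iff_dvd_coeff _ _).mpr h))

theorem totalDegree_sumAlgEquiv_le {R S₁ S₂ : Type*} [CommRing R]
    (p : MvPolynomial (S₁ ⊕ S₂) R) : (sumAlgEquiv R S₁ S₂ p).totalDegree ≤ p.totalDegree := by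
  conv_lhs => rw [p.as_sum, map_sum]
  refine totalDegree_finsetSum_le fun s hs => ?_
  refine le_trans ?_ (le_totalDegree hs)
  rw [monomial_eq, map_mul, sumAlgEquiv_C_inl, Finsupp.prod, map_prod]
  refine (totalDegree_mul _ _).trans ?_
  rw [totalDegree_C, zero_add, Finsupp.sum]
  refine (totalDegree_finsetProd _ _).trans (Finset.sum_le_sum fun i _ => ?_)
  rw [map_pow]
  refine (totalDegree_pow _ _).trans ?_
  have : (sumAlgEquiv R S₁ S₂ (X i)).totalDegree ≤ 1 := by
    rcases i with i | i
    · rw [sumAlgEquiv_X_inl]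
      exact (isHomogeneous_X _ i).totalDegree_le
    · rw [sumAlgEquiv_X_inr, totalDegree_C]
      exact zero_le_one
  simpa using Nat.mul_le_mul_left (s i) this

/-- The linear change of variables expressing a polynomial in the coordinates with respect to a
basis of the coordinate space. -/
noncomputable def basisChange {K σ ι : Type*} [Field K] [Fintype σ] [DecidableEq σ] [Fintype ι]
    (b : Module.Basis ι K (σ → K)) : MvPolynomial σ K ≃ₐ[K] MvPolynomial ι K :=
  AlgEquiv.ofAlgHom
    (aeval fun i => ∑ k, C (b k i) * X k)
    (aeval fun k => ∑ i, C (b.repr (Pi.single i 1) k) * X i)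
    (by
      ext k : 1
      have h : ∀ l, ∑ i, b.repr (Pi.single i 1) k * b l i = b.repr (b l) k := by
        intro l
        conv_rhs => rw [pi_eq_sum_univ' (b l), map_sum, Finsupp.finsetSum_apply]
        simp [mul_comm]
      simp only [AlgHom.comp_apply, aeval_X, map_sum, map_mul, algHom_C, AlgHom.id_apply,
        Finset.mul_sum, algebraMap_eq]
      rw [Finset.sum_comm]
      simp_rw [← mul_assoc, ← map_mul, ← Finset.sum_mul, ← map_sum, h]
      classical
      simp [Finsupp.single_apply])
    (by
      ext i : 1
      have h : ∀ j, ∑ k, b k i * b.repr (Pi.single j 1) k = (Pi.single j 1 : σ → K) i := by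
        intro j
        conv_rhs => rw [← b.sum_repr (Pi.single j 1)]
        simp [mul_comm]
      simp only [AlgHom.comp_apply, aeval_X, map_sum, map_mul, algHom_C, AlgHom.id_apply,
        Finset.mul_sum, algebraMap_eq]
      rw [Finset.sum_comm]
      simp_rw [← mul_assoc, ← map_mul, ← Finset.sum_mul, ← map_sum, h]
      simp [Pi.single_apply])

theorem basisChange_apply {K σ ι : Type*} [Field K] [Fintype σ] [DecidableEq σ] [Fintype ι]
    (b : Module.Basis ι K (σ → K)) (F : MvPolynomial σ K) :
    basisChange b F = aeval (fun i => ∑ k, C (b k i) * X k) F :=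
  rfl

theorem eval_basisChange {K σ ι : Type*} [Field K] [Fintype σ] [DecidableEq σ] [Fintype ι]
    (b : Module.Basis ι K (σ → K)) (F : MvPolynomial σ K) (x : ι → K) :
    eval x (basisChange b F) = eval (∑ k, x k • b k) F := by
  have : (aeval x).comp (aeval fun i => ∑ k, C (b k i) * X k) =
      (aeval (∑ k, x k • b k) : MvPolynomial σ K →ₐ[K] K) := by
    ext i
    simp [mul_comm]
  simpa [aeval_eq_eval, basisChange_apply] using DFunLike.congr_fun this F

theorem isHomogeneous_basisChange {K σ ι : Type*} [Field K] [Fintype σ] [DecidableEq σ] [Fintype ι]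
    (b : Module.Basis ι K (σ → K)) {F : MvPolynomial σ K} {d : ℕ} (hF : F.IsHomogeneous d) :
    (basisChange b F).IsHomogeneous d := by
  have := hF.aeval (fun i => ∑ k, C (b k i) * X k) (n := 1)
    (fun i => IsHomogeneous.sum _ _ _ fun k _ => isHomogeneous_C_mul_X _ _)
  simpa [basisChange_apply] using this

theorem MvPolynomial.IsHomogeneous.eval_smul_eq {K σ : Type*} [CommRing K] {F : MvPolynomial σ K}
    {d : ℕ} (hF : F.IsHomogeneous d) (t : K) (x : σ → K) :
    eval (t • x) F = t ^ d * eval x F := by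
  rw [eval_eq, eval_eq, Finset.mul_sum]
  refine Finset.sum_congr rfl fun s hs => ?_
  have h : ∑ i ∈ s.support, s i = d := by
    simpa [Finsupp.weight_apply, Finsupp.sum] using hF (mem_support_iff.mp hs)
  simp only [Pi.smul_apply, smul_eq_mul, mul_pow, Finset.prod_mul_distrib]
  rw [Finset.prod_pow_eq_pow_sum, h]
  ring

/-- A polynomial in the coordinates with respect to a basis, as a univariate polynomial in the
distinguished coordinate. -/
noncomputable def toUnivariate {K σ τ : Type*} [Field K] [Fintype σ] [DecidableEq σ] [Fintype τ]
    (b : Module.Basis (Option τ) K (σ → K)) :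
    MvPolynomial σ K ≃ₐ[K] Polynomial (MvPolynomial τ K) :=
  (basisChange b).trans (optionEquivLeft K τ)

section toUnivariate

variable {K σ τ : Type*} [Field K] [Fintype σ] [DecidableEq σ] [Fintype τ]
  (b : Module.Basis (Option τ) K (σ → K))

theorem eval_map_toUnivariate (F : MvPolynomial σ K) (t : K) (s : τ → K) :
    ((toUnivariate b F).map (eval s)).eval t =
      eval (t • b none + ∑ k, s k • b (some k)) F := by
  rw [toUnivariate, AlgEquiv.trans_apply, ← optionEquivLeft_elim_eval, eval_basisChange,
    Fintype.sum_option]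
  rfl

variable {F : MvPolynomial σ K} {d : ℕ}

theorem natDegree_toUnivariate_le (hF : F.IsHomogeneous d) : (toUnivariate b F).natDegree ≤ d := by
  rw [toUnivariate, AlgEquiv.trans_apply, natDegree_optionEquivLeft]
  exact (degreeOf_le_totalDegree _ _).trans (isHomogeneous_basisChange b hF).totalDegree_le

theorem totalDegree_coeff_toUnivariate_le (hF : F.IsHomogeneous d) (j : ℕ) :
    ((toUnivariate b F).coeff j).totalDegree ≤ d - j := by
  have hle := (isHomogeneous_basisChange b hF).totalDegree_le
  by_cases hj : j ≤ (basisChange b F).totalDegree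
  · have := totalDegree_coeff_optionEquivLeft_add_le K τ (basisChange b F) j hj
    rw [toUnivariate, AlgEquiv.trans_apply]
    omega
  · have h0 : (toUnivariate b F).coeff j = 0 := by
      refine Polynomial.coeff_eq_zero_of_natDegree_lt ?_
      rw [toUnivariate, AlgEquiv.trans_apply, natDegree_optionEquivLeft]
      exact (degreeOf_le_totalDegree _ _).trans_lt (not_le.mp hj)
    simp [h0]

theorem natDegree_toUnivariate_ne_zero (hF : F.IsHomogeneous d)
    (h : ∃ (w : σ → K) (s t : K), eval w F = 0 ∧ eval (s • b none + t • w) F ≠ 0) :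
    (toUnivariate b F).natDegree ≠ 0 := by
  intro h0
  obtain ⟨w, s, t, hw, hst⟩ := h
  apply hst
  obtain ⟨G, hG⟩ := Polynomial.natDegree_eq_zero.mp h0
  have key : ∀ (c c' : K) (y : τ → K), eval (c • b none + ∑ k, y k • b (some k)) F =
      eval (c' • b none + ∑ k, y k • b (some k)) F := by
    intro c c' y
    rw [← eval_map_toUnivariate, ← eval_map_toUnivariate, ← hG]
    simp
  have hsum : t • w = (b.repr (t • w) none) • b none +
      ∑ k, b.repr (t • w) (some k) • b (some k) := by
    conv_lhs => rw [← b.sum_repr (t • w), Fintype.sum_option]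
  rw [hsum, ← add_assoc, ← add_smul, key _ (b.repr (t • w) none), ← hsum, hF.eval_smul_eq, hw,
    mul_zero]

theorem coeff_toUnivariate_sub_one_ne_zero [Infinite K] (hF : F.IsHomogeneous d) (hd : 2 ≤ d)
    (h0 : eval (b none) F = 0) (hs : ∃ i, eval (b none) (pderiv i F) ≠ 0) :
    (toUnivariate b F).coeff (d - 1) ≠ 0 := by
  intro hcoeff
  obtain ⟨i, hi⟩ := hs
  apply hi
  set u := b none with hu
  let v : σ → K := Pi.single i 1
  let c := b.repr v
  let g : Polynomial K := aeval (fun j => Polynomial.C (u j) + Polynomial.C (v j) * Polynomial.X) F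
  have hg : g.coeff 0 = eval u F ∧ g.coeff 1 = eval u (pderiv i F) := by
    clear hF h0 hi hcoeff
    induction F using MvPolynomial.induction_on with
    | C a => simp [g]
    | add p q hp hq => simpa [g] using ⟨by rw [hp.1, hq.1], by rw [hp.2, hq.2]⟩
    | mul_X p j hp =>
      simp only [g, map_mul, aeval_X, mul_add, Polynomial.coeff_add, Polynomial.coeff_mul_C,
        ← mul_assoc, Polynomial.coeff_mul_X, Polynomial.coeff_mul_X_zero, hp.1, hp.2, eval_X,
        pderiv_mul, pderiv_X, map_add, add_zero, true_and]
      by_cases hij : j = i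
      · subst hij
        simp [v]
      · simp [v, hij]
  let Hc := (toUnivariate b F).map (eval fun k => c (some k))
  let f := Hc.comp (Polynomial.X + Polynomial.C (c none))
  have hHc : Hc.natDegree ≤ d := Polynomial.natDegree_map_le.trans (natDegree_toUnivariate_le b hF)
  have hdeg : f.natDegree = Hc.natDegree := by
    rw [Polynomial.natDegree_comp, Polynomial.natDegree_X_add_C, mul_one]
  have hf : ∀ t, f.eval t = eval (t • u + v) F := by
    intro t
    simp only [f, Polynomial.eval_comp, Polynomial.eval_add, Polynomial.eval_X, Polynomial.eval_C]
    rw [eval_map_toUnivariate, add_smul, add_assoc, ← hu]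
    congr 3
    rw [hu, ← Fintype.sum_option (fun k => c k • b k), b.sum_repr]
  have hgt : ∀ t, g.eval t = eval (u + t • v) F := by
    intro t
    have : (Polynomial.aeval t).comp (aeval fun j => Polynomial.C (u j) +
        Polynomial.C (v j) * Polynomial.X) = (aeval (u + t • v) : MvPolynomial σ K →ₐ[K] K) := by
      ext j
      simp only [AlgHom.comp_apply, aeval_X, map_add, map_mul, Polynomial.aeval_C,
        Polynomial.aeval_X, Algebra.algebraMap_self, RingHom.id_apply, Pi.add_apply, Pi.smul_apply,
        smul_eq_mul]
      ring
    exact DFunLike.congr_fun this F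
  have hreflect : g = f.reflect d := by
    have : Polynomial.X * g = Polynomial.X * f.reflect d := by
      refine Polynomial.funext fun t => ?_
      rw [Polynomial.eval_mul, Polynomial.eval_mul, Polynomial.eval_X]
      rcases eq_or_ne t 0 with rfl | ht
      · simp
      · congr 1
        let _ := invertibleOfNonzero (inv_ne_zero ht)
        have h := Polynomial.eval₂_reflect_mul_pow (RingHom.id K) t⁻¹ d f (hdeg.trans_le hHc)
        rw [invOf_eq_inv, inv_inv, ← Polynomial.eval, ← Polynomial.eval, hf] at h
        rw [hgt, show u + t • v = t • (t⁻¹ • u + v) by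
          rw [smul_add, smul_smul, mul_inv_cancel₀ ht, one_smul], hF.eval_smul_eq, ← h, inv_pow]
        field_simp
    exact mul_left_cancel₀ Polynomial.X_ne_zero this
  have hcf : ∀ j, j ≤ d → g.coeff j = f.coeff (d - j) := by
    intro j hj
    rw [hreflect, Polynomial.coeff_reflect, Polynomial.revAt_le hj]
  have hfd : f.coeff d = 0 := by
    have := hcf 0 (Nat.zero_le d)
    rw [hg.1, h0] at this
    exact this.symm
  have h1 : Hc.natDegree ≤ d - 1 :=
    hdeg.symm.trans_le (Polynomial.natDegree_le_pred (hdeg.trans_le hHc) hfd)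
  have h2 : Hc.natDegree ≤ d - 1 - 1 :=
    Polynomial.natDegree_le_pred h1 (by simp [Hc, Polynomial.coeff_map, hcoeff])
  rw [← hg.2, hcf 1 (by omega)]
  exact Polynomial.coeff_eq_zero_of_natDegree_lt (by omega)

end toUnivariate

theorem eval_eval_sumAlgEquiv {K S₁ S₂ : Type*} [CommRing K] (G : MvPolynomial (S₁ ⊕ S₂) K)
    (l : S₁ → MvPolynomial S₂ K) (x : S₂ → K) :
    eval x (eval l (sumAlgEquiv K S₁ S₂ G)) = eval (Sum.elim (fun c => eval x (l c)) x) G := by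
  induction G using MvPolynomial.induction_on with
  | C a => simp [sumAlgEquiv_C_inl]
  | add p q hp hq => simp [hp, hq]
  | mul_X p i hp =>
    rw [map_mul, map_mul, map_mul, hp, map_mul, eval_X]
    rcases i with i | i
    · simp
    · simp

/-- Finitely many subspaces of codimension two have a common complement, spanned by two vectors. -/
theorem exists_common_complement_of_codim_two {K V : Type*} [Field K] [Infinite K]
    [AddCommGroup V] [Module K V] [FiniteDimensional K V] (S : Finset (Submodule K V))
    (hS : ∀ W ∈ S, Module.finrank K W + 2 = Module.finrank K V) :
    ∃ v : Fin 2 → V, ∀ W ∈ S, (∀ x, ∃ a : Fin 2 → K, x + ∑ c, a c • v c ∈ W) ∧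
      ∀ a : Fin 2 → K, ∑ c, a c • v c ∈ W → a = 0 := by
  classical
  have key : ∀ S : Finset (Submodule K V), (∀ W ∈ S, Module.finrank K W < Module.finrank K V) →
      ∃ v : V, ∀ W ∈ S, v ∉ W := by
    intro S hS
    have h := Subspace.biUnion_ne_univ_of_top_notMem (s := S) (k := K) (E := V)
      (fun h => (hS _ h).ne (finrank_top K V))
    obtain ⟨v, hv⟩ := (Set.ne_univ_iff_exists_notMem _).mp h
    exact ⟨v, fun W hW hvW => hv (Set.mem_biUnion hW hvW)⟩
  obtain ⟨v₁, h₁⟩ := key S (fun W hW => by have := hS W hW; omega)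
  obtain ⟨v₂, h₂⟩ := key (S.image fun W => W ⊔ Submodule.span K {v₁}) (by
    intro W' hW'
    obtain ⟨W, hW, rfl⟩ := Finset.mem_image.mp hW'
    rw [Submodule.finrank_sup_span_singleton (h₁ W hW)]
    have := hS W hW
    omega)
  refine ⟨![v₁, v₂], fun W hW => ⟨fun x => ?_, fun a ha => ?_⟩⟩
  · have h₂' := h₂ _ (Finset.mem_image_of_mem _ hW)
    have htop : W ⊔ Submodule.span K {v₁} ⊔ Submodule.span K {v₂} = ⊤ := by
      apply Submodule.eq_top_of_finrank_eq
      rw [Submodule.finrank_sup_span_singleton h₂',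
        Submodule.finrank_sup_span_singleton (h₁ W hW), ← hS W hW]
    have hx : x ∈ W ⊔ Submodule.span K {v₁} ⊔ Submodule.span K {v₂} := htop ▸ Submodule.mem_top
    obtain ⟨y, hy, z, hz, rfl⟩ := Submodule.mem_sup.mp hx
    obtain ⟨w, hw, z', hz', rfl⟩ := Submodule.mem_sup.mp hy
    obtain ⟨β, rfl⟩ := Submodule.mem_span_singleton.mp hz
    obtain ⟨α, rfl⟩ := Submodule.mem_span_singleton.mp hz'
    refine ⟨![-α, -β], ?_⟩
    convert hw using 1
    simp [Fin.sum_univ_two]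
    abel
  · have h₂' := h₂ _ (Finset.mem_image_of_mem _ hW)
    simp only [Fin.sum_univ_two, Matrix.cons_val_zero, Matrix.cons_val_one] at ha
    have h1 : a 1 = 0 := by
      by_contra hne
      apply h₂'
      rw [← Submodule.smul_mem_iff _ hne]
      have : a 1 • v₂ = (a 0 • v₁ + a 1 • v₂) + (-a 0) • v₁ := by
        rw [neg_smul]; abel
      rw [this]
      exact Submodule.add_mem_sup ha (Submodule.smul_mem _ _ (Submodule.mem_span_singleton_self v₁))
    have h0 : a 0 = 0 := by
      by_contra hne
      apply h₁ W hW
      rw [← Submodule.smul_mem_iff _ hne]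
      simpa [h1] using ha
    ext c
    fin_cases c
    · exact h0
    · exact h1

/-- A basis of the coordinate space adapted to a vector and finitely many subspaces of codimension
two containing it. -/
theorem exists_adapted_basis {K V : Type*} [Field K] [Infinite K]
    [AddCommGroup V] [Module K V] [FiniteDimensional K V] (S : Finset (Submodule K V))
    (hne : S.Nonempty) (hS : ∀ W ∈ S, Module.finrank K W + 2 = Module.finrank K V)
    (u : V) (hu : u ≠ 0) (huS : ∀ W ∈ S, u ∈ W) :
    ∃ (κ : Set V) (b : Module.Basis (Option (Fin 2 ⊕ κ)) K V), b none = u ∧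
      ∀ W ∈ S, (∀ x, ∃ a : Fin 2 → K, x + ∑ c, a c • b (some (Sum.inl c)) ∈ W) ∧
        ∀ a : Fin 2 → K, ∑ c, a c • b (some (Sum.inl c)) ∈ W → a = 0 := by
  obtain ⟨v, hv⟩ := exists_common_complement_of_codim_two S hS
  obtain ⟨W, hW⟩ := hne
  let w : Option (Fin 2) → V := fun o => o.elim u v
  have hli : LinearIndependent K w := by
    rw [Fintype.linearIndependent_iff]
    intro g hg
    rw [Fintype.sum_option] at hg
    have h0 : (fun c => g (some c)) = 0 := by
      refine (hv W hW).2 _ ?_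
      have : ∑ c, g (some c) • v c = -(g none • u) := by
        rw [eq_neg_iff_add_eq_zero, add_comm]
        exact hg
      rw [this]
      exact W.neg_mem (W.smul_mem _ (huS W hW))
    have h1 : ∀ c, g (some c) = 0 := fun c => congrFun h0 c
    rintro (_ | c)
    · simpa [h1, w, hu] using hg
    · exact h1 c
  let e : Option (Fin 2) ⊕ Module.Basis.sumExtendIndex hli ≃
      Option (Fin 2 ⊕ Module.Basis.sumExtendIndex hli) :=
    { toFun := Sum.elim (Option.map Sum.inl) (fun k => some (Sum.inr k))
      invFun := fun o => o.elim (Sum.inl none) (Sum.map some id)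
      left_inv := by rintro ((_ | c) | k) <;> rfl
      right_inv := by rintro (_ | (c | k)) <;> rfl }
  have hb : ∀ o, Module.Basis.sumExtend hli (Sum.inl o) = w o := by
    intro o
    simp only [Module.Basis.sumExtend, Module.Basis.reindex_apply, Module.Basis.extend_apply_self]
    rfl
  refine ⟨_, (Module.Basis.sumExtend hli).reindex e, ?_, ?_⟩
  · rw [Module.Basis.reindex_apply]
    exact hb none
  · have hbv : ∀ c, (Module.Basis.sumExtend hli).reindex e (some (Sum.inl c)) = v c := by
      intro c
      rw [Module.Basis.reindex_apply]
      exact hb (some c)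
    simpa only [hbv] using hv

theorem card_le_totalDegree_coeff_toUnivariate_mul {K σ κ : Type*} [Field K] [Infinite K]
    [Fintype σ] [DecidableEq σ] [Fintype κ] {F : MvPolynomial σ K} {d : ℕ}
    (hF : F.IsHomogeneous d) (hirr : Irreducible F)
    (b : Module.Basis (Option (Fin 2 ⊕ κ)) K (σ → K))
    (h0 : (toUnivariate b F).natDegree ≠ 0) (S : Finset (Submodule K (σ → K)))
    (hb : ∀ W ∈ S, (∀ x, ∃ a : Fin 2 → K, x + ∑ c, a c • b (some (Sum.inl c)) ∈ W) ∧
        ∀ a : Fin 2 → K, ∑ c, a c • b (some (Sum.inl c)) ∈ W → a = 0)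
    (hu : ∀ W ∈ S, b none ∈ W) (hFS : ∀ W ∈ S, ∀ x ∈ W, eval x F = 0)
    (i : ℕ) (hi : (toUnivariate b F).coeff i ≠ 0) :
    S.card ≤ ((toUnivariate b F).coeff i).totalDegree * d := by
  classical
  let E := sumAlgEquiv K (Fin 2) κ
  let H := (toUnivariate b F).map
    (E.toRingEquiv : MvPolynomial (Fin 2 ⊕ κ) K →+* MvPolynomial (Fin 2) (MvPolynomial κ K))
  have hcoeff : ∀ j, H.coeff j = E ((toUnivariate b F).coeff j) := fun j => by
    simp [H, Polynomial.coeff_map]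
  have hH : Irreducible H := by
    have h1 : Irreducible (toUnivariate b F) := (MulEquiv.irreducible_iff (toUnivariate b)).mpr hirr
    exact (MulEquiv.irreducible_iff (Polynomial.mapEquiv E.toRingEquiv)).mpr h1
  have hH0 : H.natDegree ≠ 0 := by
    rwa [Polynomial.natDegree_map_eq_of_injective E.injective]
  have hchoice : ∀ (W : S) (k : κ), ∃ a : Fin 2 → K,
      b (some (Sum.inr k)) + ∑ c, a c • b (some (Sum.inl c)) ∈ W.1 :=
    fun W k => (hb W.1 W.2).1 _
  choose α hα using hchoice
  let l : S → Fin 2 → MvPolynomial κ K := fun W c => ∑ k, C (α W k c) * X k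
  have hl : ∀ W c x, eval x (l W c) = ∑ k, α W k c * x k := by
    intro W c x
    simp [l]
  have hmem : ∀ (W : S) (x : κ → K),
      ∑ k, x k • b (some (Sum.inr k)) + ∑ c, (∑ k, α W k c * x k) • b (some (Sum.inl c)) ∈ W.1 := by
    intro W x
    have := W.1.sum_mem (t := Finset.univ) fun k _ => W.1.smul_mem (x k) (hα W k)
    convert this using 1
    simp_rw [smul_add, Finset.sum_add_distrib, Finset.smul_sum, Finset.sum_smul]
    rw [Finset.sum_comm]
    simp_rw [smul_smul, mul_comm]
  have hzero : ∀ (W : S) j, eval (l W) (H.coeff j) = 0 := by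
    intro W j
    refine MvPolynomial.funext fun x => ?_
    rw [hcoeff, eval_eval_sumAlgEquiv, map_zero]
    have : (toUnivariate b F).map (eval (Sum.elim (fun c => eval x (l W c)) x)) = 0 := by
      refine Polynomial.funext fun t => ?_
      rw [eval_map_toUnivariate, Polynomial.eval_zero]
      refine hFS W.1 W.2 _ (W.1.add_mem (W.1.smul_mem _ (hu W.1 W.2)) ?_)
      rw [Fintype.sum_sum_type]
      simpa [hl, add_comm] using hmem W x
    rw [← Polynomial.coeff_map, this, Polynomial.coeff_zero]
  have hle : ∀ W W' : S, l W = l W' → W.1 ≤ W'.1 := by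
    intro W W' h x hx
    have hsum : x = b.repr x none • b none +
        (∑ c, b.repr x (some (Sum.inl c)) • b (some (Sum.inl c)) +
        ∑ k, b.repr x (some (Sum.inr k)) • b (some (Sum.inr k))) := by
      conv_lhs => rw [← b.sum_repr x, Fintype.sum_option, Fintype.sum_sum_type]
    set y : κ → K := fun k => b.repr x (some (Sum.inr k)) with hy
    have hinl : ∑ c, b.repr x (some (Sum.inl c)) • b (some (Sum.inl c)) =
        x - b.repr x none • b none - ∑ k, y k • b (some (Sum.inr k)) := by
      rw [eq_sub_iff_add_eq, eq_sub_iff_add_eq]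
      conv_rhs => rw [hsum]
      abel
    have hlW : ∀ c, b.repr x (some (Sum.inl c)) = ∑ k, α W k c * y k := by
      have := (hb W.1 W.2).2 (fun c => b.repr x (some (Sum.inl c)) - ∑ k, α W k c * y k) (by
        have h2 := W.1.sub_mem (W.1.sub_mem hx (W.1.smul_mem (b.repr x none) (hu W.1 W.2)))
          (hmem W y)
        convert h2 using 1
        simp_rw [sub_smul, Finset.sum_sub_distrib, hinl]
        abel)
      intro c
      exact sub_eq_zero.mp (congrFun this c)
    have hlW' : ∀ c, b.repr x (some (Sum.inl c)) = ∑ k, α W' k c * y k := by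
      intro c
      rw [hlW, ← hl, ← hl, h]
    rw [hsum]
    refine W'.1.add_mem (W'.1.smul_mem _ (hu W'.1 W'.2)) ?_
    rw [add_comm]
    simp_rw [hlW']
    exact hmem W' y
  have hinj : Function.Injective l := fun W W' h =>
    Subtype.ext (le_antisymm (hle W W' h) (hle W' W h.symm))
  have hcard := card_le_totalDegree_coeff_mul H hH hH0 d
    (fun j => by
      rw [hcoeff]
      exact (totalDegree_sumAlgEquiv_le _).trans
        ((totalDegree_coeff_toUnivariate_le b hF j).trans (Nat.sub_le d j)))
    i (by rw [hcoeff]; simpa using hi) (Finset.univ.image l) (by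
      intro p hp j
      obtain ⟨W, _, rfl⟩ := Finset.mem_image.mp hp
      exact hzero W j)
  rw [Finset.card_image_of_injective _ hinj, Finset.card_univ, Fintype.card_coe] at hcard
  refine hcard.trans (Nat.mul_le_mul_right _ ?_)
  rw [hcoeff]
  exact totalDegree_sumAlgEquiv_le _

theorem Set.finite_and_ncard_le_of_forall_finset {α : Type*} {s : Set α} {N : ℕ}
    (h : ∀ S : Finset α, (S : Set α) ⊆ s → S.card ≤ N) : s.Finite ∧ s.ncard ≤ N := by
  have hfin : s.Finite := by
    by_contra hinf
    obtain ⟨S, hS, hcard⟩ := Set.Infinite.exists_subset_card_eq hinf (N + 1)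
    have := h S hS
    omega
  refine ⟨hfin, ?_⟩
  rw [Set.ncard_eq_toFinset_card s hfin]
  exact h _ (by simp)

/-- Bounding the number of `(n-2)`-planes of `ℙ^n` through a point of a hypersurface which is not
a cone with that point as cone point: at most `d²` such planes in general, and at most `d` through
a smooth point. Planes of projective dimension `n-2` correspond to linear subspaces of dimension
`n-1` of `K^{n+1}`. -/
theorem planes_through_point_of_hypersurface (K : Type*) [Field K] [IsAlgClosed K]
    (n : ℕ) (hn : 3 ≤ n) (F : MvPolynomial (Fin (n + 1)) K) (d : ℕ) (hd : 2 ≤ d)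
    (hhom : MvPolynomial.IsHomogeneous F d) (hirr : Irreducible F)
    (u : Fin (n + 1) → K) (hu : u ≠ 0) (huF : MvPolynomial.eval u F = 0)
    (hnotcone : ∃ (w : Fin (n + 1) → K) (s t : K), MvPolynomial.eval w F = 0 ∧
      MvPolynomial.eval (s • u + t • w) F ≠ 0) :
    {W : Submodule K (Fin (n + 1) → K) | Module.finrank K W = n - 1 ∧ u ∈ W ∧
        ∀ x ∈ W, MvPolynomial.eval x F = 0}.Finite ∧
    Set.ncard {W : Submodule K (Fin (n + 1) → K) | Module.finrank K W = n - 1 ∧ u ∈ W ∧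
        ∀ x ∈ W, MvPolynomial.eval x F = 0} ≤ d ^ 2 ∧
    ((∃ i, MvPolynomial.eval u (MvPolynomial.pderiv i F) ≠ 0) →
      Set.ncard {W : Submodule K (Fin (n + 1) → K) | Module.finrank K W = n - 1 ∧ u ∈ W ∧
        ∀ x ∈ W, MvPolynomial.eval x F = 0} ≤ d) := by
  have : Infinite K := IsAlgClosed.instInfinite
  set P := {W : Submodule K (Fin (n + 1) → K) | Module.finrank K W = n - 1 ∧ u ∈ W ∧
        ∀ x ∈ W, MvPolynomial.eval x F = 0} with hP
  have key : ∀ S : Finset (Submodule K (Fin (n + 1) → K)), (S : Set _) ⊆ P →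
      S.card ≤ d ^ 2 ∧ ((∃ i, eval u (pderiv i F) ≠ 0) → S.card ≤ d) := by
    intro S hS
    rcases S.eq_empty_or_nonempty with rfl | hne
    · simp
    obtain ⟨κ, b, rfl, hb⟩ := exists_adapted_basis S hne (fun W hW => by
      rw [(hS hW).1, Module.finrank_fin_fun]
      omega) u hu (fun W hW => (hS hW).2.1)
    have : Finite (Option (Fin 2 ⊕ κ)) := Module.Finite.finite_basis b
    have : Finite (Fin 2 ⊕ κ) := Finite.of_injective _ (Option.some_injective _)
    have : Finite κ := Finite.of_injective _ (Sum.inr_injective (α := Fin 2))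
    have := Fintype.ofFinite κ
    have h0 := natDegree_toUnivariate_ne_zero b hhom hnotcone
    have hbound := card_le_totalDegree_coeff_toUnivariate_mul hhom hirr b h0 S hb
      (fun W hW => (hS hW).2.1) (fun W hW => (hS hW).2.2)
    refine ⟨?_, fun hs => ?_⟩
    · rw [sq]
      refine (hbound (toUnivariate b F).natDegree ?_).trans (Nat.mul_le_mul_right _
        ((totalDegree_coeff_toUnivariate_le b hhom _).trans (Nat.sub_le _ _)))
      rw [Polynomial.coeff_natDegree, Polynomial.leadingCoeff_ne_zero]
      rintro h
      simp [h] at h0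
    · refine (hbound (d - 1) (coeff_toUnivariate_sub_one_ne_zero b hhom hd huF hs)).trans ?_
      have := totalDegree_coeff_toUnivariate_le b hhom (d - 1)
      calc _ ≤ 1 * d := Nat.mul_le_mul_right _ (by omega)
        _ = d := one_mul d
  obtain ⟨h1, h2⟩ := Set.finite_and_ncard_le_of_forall_finset fun S hS => (key S hS).1
  exact ⟨h1, h2, fun hs =>
    (Set.finite_and_ncard_le_of_forall_finset fun S hS => (key S hS).2 hs).2⟩
end

section
/- Let K be a field with algebraic closure K̄, let n ≥ 3, and let f ∈ K[x_1,…,x_n] be a non-constant polynomial with homogeneous decomposition f = Σ_i f_i, where f_i is the homogeneous part of degree i. Define W(f) = ⋃_{i : f_i ≠ 0} { x ∈ K̄^n : f_i(x) = 0 }. Then f is not NCC over K if and only if there exist linearly independent vectors c, c' ∈ K^n and a finite set S ⊆ K̄² ∖ {(0,0)} such that W(f) = ⋃_{(a,b) ∈ S} { x ∈ K̄^n : Σ_{j=1}^n (a·c_j + b·c'_j)·x_j = 0 }. -/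
open MvPolynomial

section CylinderLemmas

variable {K L : Type*} [Field K] [Field L]

theorem isHomogeneous_linForm {n : ℕ} (c : Fin n → K) : (linForm c).IsHomogeneous 1 :=
  IsHomogeneous.sum _ _ _ fun i _ => by
    simpa using (isHomogeneous_C (Fin n) (c i)).mul (isHomogeneous_X K i)

theorem map_linForm [Algebra K L] {n : ℕ} (c : Fin n → K) :
    map (algebraMap K L) (linForm c) = linForm fun j => algebraMap K L (c j) := by
  simp [linForm]

theorem eval_linForm {n : ℕ} (c x : Fin n → K) : eval x (linForm c) = ∑ j, c j * x j := by
  simp [linForm]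

theorem linForm_smul_add_smul {n : ℕ} (a b : K) (c d : Fin n → K) :
    linForm (a • c + b • d) = C a * linForm c + C b * linForm d := by
  simp [linForm, Finset.mul_sum, ← Finset.sum_add_distrib, add_mul, mul_assoc]

theorem map_aeval_linForm [Algebra K L] {n : ℕ} (c c' : Fin n → K) (p : MvPolynomial (Fin 2) K) :
    map (algebraMap K L) (aeval ![linForm c, linForm c'] p) =
      aeval (R := L) ![linForm fun j => algebraMap K L (c j), linForm fun j => algebraMap K L (c' j)]
        (map (algebraMap K L) p) := by
  induction p using MvPolynomial.induction_on with
  | C a => simp [algebraMap_eq]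
  | add p q hp hq => simp only [map_add, hp, hq]
  | mul_X p i hp =>
    simp only [map_mul, hp, map_X, aeval_X]
    fin_cases i <;> simp [map_linForm]

theorem eval_aeval_pair {σ : Type*} (l l' : MvPolynomial σ K) (x : σ → K)
    (p : MvPolynomial (Fin 2) K) :
    eval x (aeval ![l, l'] p) = eval ![eval x l, eval x l'] p := by
  induction p using MvPolynomial.induction_on with
  | C a => simp [algebraMap_eq]
  | add p q hp hq => simp only [map_add, hp, hq]
  | mul_X p i hp =>
    simp only [map_mul, hp, aeval_X, eval_X]
    fin_cases i <;> simp

theorem aeval_pair_aeval_linear {σ : Type*} (l l' : MvPolynomial σ K) (a b a' b' : K)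
    (g : MvPolynomial (Fin 2) K) :
    aeval ![l, l'] (aeval ![C a * X 0 + C b * X 1, C a' * X 0 + C b' * X 1] g) =
      aeval ![C a * l + C b * l', C a' * l + C b' * l'] g := by
  induction g using MvPolynomial.induction_on with
  | C a => simp [algebraMap_eq]
  | add p q hp hq => simp only [map_add, hp, hq]
  | mul_X p i hp =>
    simp only [map_mul, hp, aeval_X]
    fin_cases i <;> simp [algebraMap_eq]

theorem sum_combination_mul {ι : Type*} (s : Finset ι) (a b : K) (v w x : ι → K) :
    ∑ j ∈ s, (a * v j + b * w j) * x j = a * ∑ j ∈ s, v j * x j + b * ∑ j ∈ s, w j * x j := by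
  simp [add_mul, Finset.sum_add_distrib, Finset.mul_sum, mul_assoc]

/-- A pair of linearly independent vectors has a dual pair. -/
theorem exists_dual_pair {n : ℕ} {c c' : Fin n → K} (h : LinearIndependent K ![c, c']) :
    ∃ u u' : Fin n → K, ∑ j, c j * u j = 1 ∧ ∑ j, c' j * u j = 0 ∧
      ∑ j, c j * u' j = 0 ∧ ∑ j, c' j * u' j = 1 := by
  obtain ⟨g, hg⟩ := (Fintype.linearCombination K ![c, c']).exists_leftInverse_of_injective
    (LinearMap.ker_eq_bot.2 h.fintypeLinearCombination_injective)
  have key (i k : Fin 2) : ∑ j, (![c, c'] i) j * g (Pi.single j 1) k = if i = k then 1 else 0 := by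
    have h1 : g (![c, c'] i) = Pi.single i 1 := by
      simpa [Fintype.linearCombination_apply_single] using LinearMap.congr_fun hg (Pi.single i 1)
    conv_lhs at h1 => rw [pi_eq_sum_univ' (![c, c'] i)]
    have h2 := congr_fun h1 k
    simpa [Pi.single_apply, eq_comm] using h2
  exact ⟨fun j => g (Pi.single j 1) 0, fun j => g (Pi.single j 1) 1,
    by simpa using key 0 0, by simpa using key 1 0, by simpa using key 0 1, by simpa using key 1 1⟩

/-- Any two vectors in a space of dimension at least two are combinations of two linearly
independent vectors. -/
theorem exists_linearIndependent_pair_span {V : Type*} [AddCommGroup V] [Module K V]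
    (hV : 1 < Module.finrank K V) (c c' : V) :
    ∃ d d' : V, LinearIndependent K ![d, d'] ∧ (∃ a b : K, c = a • d + b • d') ∧
      ∃ a b : K, c' = a • d + b • d' := by
  have : Nontrivial V := Module.nontrivial_of_finrank_pos (R := K) (by omega)
  by_cases hc : c = 0
  · obtain ⟨v, hv⟩ := exists_ne (0 : V)
    by_cases hc' : c' = 0
    · obtain ⟨y, hy⟩ := exists_linearIndependent_pair_of_one_lt_finrank hV hv
      exact ⟨v, y, hy, ⟨0, 0, by simp [hc]⟩, ⟨0, 0, by simp [hc']⟩⟩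
    · obtain ⟨y, hy⟩ := exists_linearIndependent_pair_of_one_lt_finrank hV hc'
      exact ⟨c', y, hy, ⟨0, 0, by simp [hc]⟩, ⟨1, 0, by simp⟩⟩
  · by_cases hl : LinearIndependent K ![c, c']
    · exact ⟨c, c', hl, ⟨1, 0, by simp⟩, ⟨0, 1, by simp⟩⟩
    · obtain ⟨y, hy⟩ := exists_linearIndependent_pair_of_one_lt_finrank hV hc
      rw [LinearIndependent.pair_iff' hc] at hl
      push Not at hl
      obtain ⟨a, ha⟩ := hl
      exact ⟨c, y, hy, ⟨1, 0, by simp⟩, ⟨a, 0, by simp [ha]⟩⟩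

/-- Being a polynomial in two independent linear forms over `K` descends from extensions. -/
theorem mem_range_aeval_linForm_of_map [Algebra K L] {n : ℕ} {c c' : Fin n → K}
    (h : LinearIndependent K ![c, c']) {f : MvPolynomial (Fin n) K}
    (hf : map (algebraMap K L) f ∈ (aeval (R := L) ![linForm fun j => algebraMap K L (c j),
      linForm fun j => algebraMap K L (c' j)]).range) :
    f ∈ (aeval (R := K) ![linForm c, linForm c']).range := by
  obtain ⟨u, u', h1, h2, h3, h4⟩ := exists_dual_pair h
  obtain ⟨G, hG⟩ := hf
  let s : Fin n → MvPolynomial (Fin 2) K := fun j => C (u j) * X 0 + C (u' j) * X 1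
  have hs (d : Fin n → K) : aeval s (linForm d) =
      C (∑ j, d j * u j) * X 0 + C (∑ j, d j * u' j) * X 1 := by
    simp [linForm, s, algebraMap_eq, mul_add, Finset.sum_add_distrib, Finset.sum_mul, mul_assoc]
  let sL : Fin n → MvPolynomial (Fin 2) L := fun j => map (algebraMap K L) (s j)
  have hmap (p : MvPolynomial (Fin n) K) :
      aeval sL (map (algebraMap K L) p) = map (algebraMap K L) (aeval s p) := by
    induction p using MvPolynomial.induction_on with
    | C a => simp [algebraMap_eq]
    | add p q hp hq => simp only [map_add, hp, hq]
    | mul_X p i hp => simp only [map_mul, hp, map_X, aeval_X, sL]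
  have hsL (d : Fin n → K) : aeval sL (linForm fun j => algebraMap K L (d j)) =
      map (algebraMap K L) (aeval s (linForm d)) := by
    rw [← map_linForm, hmap]
  have hGs : G = map (algebraMap K L) (aeval s f) := by
    rw [← hmap, ← hG]
    change G = ((aeval sL).comp (aeval _)) G
    conv_lhs => rw [← AlgHom.id_apply (R := L) G]
    congr 1
    ext i : 1
    fin_cases i <;> simp [-aeval_eq_bind₁, hsL, hs, h1, h2, h3, h4]
  refine ⟨aeval s f, map_injective (algebraMap K L) (algebraMap K L).injective ?_⟩
  rw [← hG, hGs]
  exact map_aeval_linForm c c' _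

/-- A divisor of a product of linear forms lying in a subalgebra lies in it as well. -/
theorem mem_subalgebra_of_dvd_pow_prod {σ ι : Type*} (A : Subalgebra K (MvPolynomial σ K))
    (s : Finset ι) (l : ι → MvPolynomial σ K) (hl : ∀ i ∈ s, (l i).totalDegree = 1)
    (hA : ∀ i ∈ s, l i ∈ A) (N : ℕ) (F : MvPolynomial σ K) (hF : F ∣ (∏ i ∈ s, l i) ^ N) :
    F ∈ A := by
  have hunit (x : MvPolynomial σ K) (hx : IsUnit x) : x ∈ A := by
    rw [totalDegree_eq_zero_iff_eq_C.1 (isUnit_iff_totalDegree_of_isReduced.1 hx).2]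
    exact A.algebraMap_mem _
  have hne (i : ι) (hi : i ∈ s) : l i ≠ 0 := fun h => by simpa [h] using hl i hi
  revert hF
  refine UniqueFactorizationMonoid.induction_on_prime F (fun _ => A.zero_mem)
    (fun x hx _ => hunit x hx) fun a p _ hp ih hd => A.mul_mem ?_ (ih (dvd_of_mul_left_dvd hd))
  obtain ⟨i, hi, hpi⟩ := (hp.dvd_finsetProd_iff _).1
    (hp.dvd_of_dvd_pow (dvd_of_mul_right_dvd hd))
  obtain ⟨w, hw⟩ := (hp.irreducible.associated_of_dvd
    (irreducible_of_totalDegree_eq_one (hl i hi)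
      fun x hx => isUnit_iff_ne_zero.2 fun h0 => hne i hi (by ext m; simpa [h0] using hx m)) hpi).symm
  rw [← hw]
  exact A.mul_mem (hA i hi) (hunit _ w.isUnit)

/-- If the zero set of `F` lies in a finite union of zero sets of polynomials, then `F` divides
a power of their product. -/
theorem dvd_pow_prod_of_zeros_subset [IsAlgClosed K] {σ ι : Type*} [Finite σ] (s : Finset ι)
    (l : ι → MvPolynomial σ K) (F : MvPolynomial σ K)
    (hF : ∀ x, eval x F = 0 → ∃ i ∈ s, eval x (l i) = 0) :
    ∃ N : ℕ, F ∣ (∏ i ∈ s, l i) ^ N := by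
  have h : ∏ i ∈ s, l i ∈ vanishingIdeal K (zeroLocus K (Ideal.span {F})) := by
    intro x hx
    obtain ⟨i, hi, h0⟩ := hF x (by simpa using hx F (Ideal.mem_span_singleton_self F))
    rw [map_prod]
    exact Finset.prod_eq_zero hi (by simpa using h0)
  rw [vanishingIdeal_zeroLocus_eq_radical] at h
  obtain ⟨N, hN⟩ := h
  exact ⟨N, Ideal.mem_span_singleton.1 hN⟩

theorem MvPolynomial.IsHomogeneous.eval_smul_s16 {σ : Type*} {d : ℕ} {F : MvPolynomial σ K}
    (hF : F.IsHomogeneous d) (t : K) (x : σ → K) : eval (t • x) F = t ^ d * eval x F := by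
  rw [eval_eq, eval_eq, Finset.mul_sum]
  refine Finset.sum_congr rfl fun m hm => ?_
  have := hF (mem_support_iff.1 hm)
  rw [← this, Finsupp.weight_apply, Finsupp.sum, ← Finset.prod_pow_eq_pow_sum]
  simp [mul_pow, Finset.prod_mul_distrib]
  ring

/-- The zero set of a nonzero binary form over an algebraically closed field is a finite union
of lines. -/
theorem exists_finite_lines_of_isHomogeneous [IsAlgClosed K] {d : ℕ} {h : MvPolynomial (Fin 2) K}
    (hh : h.IsHomogeneous d) (h0 : h ≠ 0) :
    ∃ S : Set (K × K), S.Finite ∧ (∀ p ∈ S, p ≠ 0) ∧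
      ∀ x, eval x h = 0 ↔ ∃ p ∈ S, p.1 * x 0 + p.2 * x 1 = 0 := by
  have hinf : Infinite K := IsAlgClosed.instInfinite
  rcases Nat.eq_zero_or_pos d with rfl | hd
  · obtain ⟨a, rfl⟩ : ∃ a, h = C a := ⟨_, ((totalDegree_zero_iff_isHomogeneous _).2 hh |>
      totalDegree_eq_zero_iff_eq_C.1)⟩
    exact ⟨∅, Set.finite_empty, by simp, fun x => by simpa using h0⟩
  let P : Polynomial K := aeval ![Polynomial.X, 1] h
  have hP (r : K) : P.eval r = eval ![r, 1] h := by
    have : (Polynomial.aeval r).comp (aeval (R := K) ![Polynomial.X, 1]) = aeval ![r, 1] := by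
      ext i; fin_cases i <;> simp
    simpa [P, Polynomial.coe_aeval_eq_eval, coe_aeval_eq_eval] using DFunLike.congr_fun this h
  have hev (x : Fin 2 → K) (hx : x 1 ≠ 0) : eval x h = x 1 ^ d * P.eval (x 0 / x 1) := by
    rw [hP, ← hh.eval_smul_s16]
    congr 1
    congr 1
    ext i; fin_cases i <;> simp [mul_div_cancel₀, hx]
  have hev' (x : Fin 2 → K) (hx : x 1 = 0) : eval x h = x 0 ^ d * eval ![1, 0] h := by
    rw [← hh.eval_smul_s16]
    congr 1
    congr 1
    ext i; fin_cases i <;> simp [hx]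
  have hcancel (q : MvPolynomial (Fin 2) K) (hq : ∀ x : Fin 2 → K, x 1 ≠ 0 → eval x q = 0) :
      q = 0 := by
    have : X 1 * q = 0 := MvPolynomial.funext fun x => by
      by_cases hx : x 1 = 0 <;> simp [hx, hq]
    simpa using this
  have hP0 : P ≠ 0 := fun hP0 => h0 <| hcancel h fun x hx => by simp [hev x hx, hP0]
  refine ⟨(fun r => (1, -r)) '' {r | P.IsRoot r} ∪ {p | p = (0, 1) ∧ eval ![1, 0] h = 0},
    ((Polynomial.finite_setOfPred_isRoot hP0).image _).union
      ((Set.finite_singleton (0, 1)).subset fun p hp => hp.1), ?_, fun x => ?_⟩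
  · rintro p (⟨r, -, rfl⟩ | ⟨rfl, -⟩) <;> simp
  by_cases hx : x 1 = 0
  · rw [hev' x hx]
    simp only [mul_eq_zero, pow_eq_zero_iff hd.ne']
    constructor
    · rintro (hx0 | h1)
      · by_cases h1 : eval ![1, 0] h = 0
        · exact ⟨(0, 1), Or.inr ⟨rfl, h1⟩, by simp [hx]⟩
        · have hdeg : P.degree ≠ 0 := fun hdeg => by
            obtain ⟨a, ha⟩ : ∃ a, P = Polynomial.C a := ⟨_, Polynomial.eq_C_of_degree_eq_zero hdeg⟩
            have := hcancel (h - C a * X 1 ^ d) fun y hy => by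
              simp [hev y hy, ha, mul_comm]
            rw [sub_eq_zero] at this
            exact h1 (by simp [this, hd.ne'])
          obtain ⟨r, hr⟩ := IsAlgClosed.exists_root P hdeg
          exact ⟨_, Or.inl ⟨r, hr, rfl⟩, by simp [hx, hx0]⟩
      · exact ⟨(0, 1), Or.inr ⟨rfl, h1⟩, by simp [hx]⟩
    · rintro ⟨p, ⟨r, -, rfl⟩ | ⟨rfl, h1⟩, hp⟩
      · exact Or.inl (by simpa [hx] using hp)
      · exact Or.inr h1
  · rw [hev x hx]
    simp only [mul_eq_zero, pow_eq_zero_iff hd.ne', hx, false_or]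
    constructor
    · intro hr
      exact ⟨_, Or.inl ⟨_, hr, rfl⟩, by field_simp; simp⟩
    · rintro ⟨p, ⟨r, hr, rfl⟩ | ⟨rfl, h1⟩, hp⟩
      · have : x 0 / x 1 = r := by
          rw [div_eq_iff hx]
          linear_combination hp
        rw [this]
        exact hr
      · exact absurd (by simpa using hp) hx

/-- Substituting linear forms commutes with taking homogeneous components. -/
theorem homogeneousComponent_aeval_linear {σ τ : Type*} {l : σ → MvPolynomial τ K}
    (hl : ∀ i, (l i).IsHomogeneous 1) (g : MvPolynomial σ K) (i : ℕ) :
    homogeneousComponent i (aeval l g) = aeval l (homogeneousComponent i g) := by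
  have key (k : ℕ) : (aeval l (homogeneousComponent k g)).IsHomogeneous k := by
    simpa using (homogeneousComponent_isHomogeneous k g).aeval l hl
  conv_lhs => rw [← sum_homogeneousComponent g, map_sum, map_sum]
  rw [Finset.sum_congr rfl fun k _ => homogeneousComponent_of_mem (key k)]
  simp only [Finset.sum_ite_eq, Finset.mem_range]
  split_ifs with h
  · rfl
  · rw [homogeneousComponent_eq_zero _ _ (by omega), map_zero]

end CylinderLemmas

/-- Characterization of failure of NCC via `W(f)`: a non-constant `f ∈ K[x₁,…,xₙ]` (`n ≥ 3`) is
not NCC over `K` iff the union `W(f)` of the zero sets (in `K̄ⁿ`) of the nonzero homogeneous parts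
of `f` is the union of finitely many hyperplanes whose linear forms lie on a line of the dual
space defined over `K`, i.e. are `K̄`-combinations `a·c + b·c'` of two linearly independent
vectors `c, c' ∈ Kⁿ`. -/
theorem not_NCC_iff_W_union_of_hyperplanes (K : Type*) [Field K] (n : ℕ) (hn : 3 ≤ n)
    (f : MvPolynomial (Fin n) K) (hf : 0 < f.totalDegree) :
    ¬ IsNCC f ↔
      ∃ c c' : Fin n → K, LinearIndependent K ![c, c'] ∧
        ∃ S : Set (AlgebraicClosure K × AlgebraicClosure K), S.Finite ∧ (∀ p ∈ S, p ≠ 0) ∧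
          (⋃ i ∈ {i : ℕ | MvPolynomial.homogeneousComponent i f ≠ 0},
              {x : Fin n → AlgebraicClosure K |
                MvPolynomial.eval x (MvPolynomial.map (algebraMap K (AlgebraicClosure K))
                  (MvPolynomial.homogeneousComponent i f)) = 0})
            = ⋃ p ∈ S, {x : Fin n → AlgebraicClosure K |
                ∑ j, (p.1 * algebraMap K (AlgebraicClosure K) (c j)
                    + p.2 * algebraMap K (AlgebraicClosure K) (c' j)) * x j = 0} := by
  let A := AlgebraicClosure K
  let φ := algebraMap K A
  have hrow (c c' : Fin n → K) (p : A × A) (x : Fin n → A) :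
      ∑ j, (p.1 * φ (c j) + p.2 * φ (c' j)) * x j =
        p.1 * ∑ j, φ (c j) * x j + p.2 * ∑ j, φ (c' j) * x j :=
    sum_combination_mul _ _ _ _ _ _
  unfold IsNCC
  rw [not_not]
  constructor
  · rintro ⟨c₀, c₀', g₀, hg₀⟩
    obtain ⟨c, c', hli, ⟨a, b, hab⟩, ⟨a', b', hab'⟩⟩ := exists_linearIndependent_pair_span
      (K := K) (by simp; omega) c₀ c₀'
    obtain ⟨g, rfl⟩ : ∃ g, f = aeval ![linForm c, linForm c'] g := by
      refine ⟨aeval ![C a * X 0 + C b * X 1, C a' * X 0 + C b' * X 1] g₀, ?_⟩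
      rw [hg₀, aeval_pair_aeval_linear, hab, hab', linForm_smul_add_smul, linForm_smul_add_smul]
    have hhom (i : Fin 2) : (![linForm c, linForm c'] i).IsHomogeneous 1 := by
      fin_cases i <;> exact isHomogeneous_linForm _
    simp only [homogeneousComponent_aeval_linear hhom]
    have hev (p : MvPolynomial (Fin 2) K) (x : Fin n → A) :
        eval x (map φ (aeval ![linForm c, linForm c'] p)) =
          eval ![∑ j, φ (c j) * x j, ∑ j, φ (c' j) * x j] (map φ p) := by
      rw [map_aeval_linForm, eval_aeval_pair, eval_linForm, eval_linForm]
    have hS (i : ℕ) : ∃ S : Set (A × A), homogeneousComponent i g ≠ 0 →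
        S.Finite ∧ (∀ p ∈ S, p ≠ 0) ∧ ∀ x, eval x (map φ (homogeneousComponent i g)) = 0 ↔
          ∃ p ∈ S, p.1 * x 0 + p.2 * x 1 = 0 := by
      by_cases hi : homogeneousComponent i g = 0
      · exact ⟨∅, fun h => absurd hi h⟩
      · obtain ⟨S, h⟩ := exists_finite_lines_of_isHomogeneous
          ((homogeneousComponent_isHomogeneous i g).map φ)
          ((map_ne_zero_iff _ (map_injective φ φ.injective)).2 hi)
        exact ⟨S, fun _ => h⟩
    choose S hS using hS
    have hne {i : ℕ} (hi : aeval ![linForm c, linForm c'] (homogeneousComponent i g) ≠ 0) :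
        homogeneousComponent i g ≠ 0 := fun h => hi (by rw [h, map_zero])
    refine ⟨c, c', hli, ⋃ i ∈ {i | aeval ![linForm c, linForm c']
      (homogeneousComponent i g) ≠ 0}, S i, ?_, ?_, ?_⟩
    · refine Set.Finite.biUnion ((Set.finite_le_nat g.totalDegree).subset fun i hi => ?_)
        fun i hi => (hS i (hne hi)).1
      by_contra hlt
      exact hne hi (homogeneousComponent_eq_zero _ _ (not_le.1 hlt))
    · intro p hp
      simp only [Set.mem_iUnion] at hp
      obtain ⟨i, hi, hp⟩ := hp
      exact (hS i (hne hi)).2.1 p hp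
    · ext x
      simp only [Set.mem_iUnion, Set.mem_ofPred_eq, exists_prop]
      constructor
      · rintro ⟨i, hi, hx⟩
        obtain ⟨p, hp, h⟩ := ((hS i (hne hi)).2.2 _).1 ((hev _ x).symm.trans hx)
        exact ⟨p, ⟨i, hi, hp⟩, (hrow c c' p x).trans h⟩
      · rintro ⟨p, ⟨i, hi, hp⟩, h⟩
        exact ⟨i, hi, (hev _ x).trans
          (((hS i (hne hi)).2.2 _).2 ⟨p, hp, (hrow c c' p x).symm.trans h⟩)⟩
  · rintro ⟨c, c', hli, S, hfin, hS0, hW⟩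
    suffices h : f ∈ (aeval (R := K) ![linForm c, linForm c']).range by
      obtain ⟨g, hg⟩ := h
      exact ⟨c, c', g, hg.symm⟩
    obtain ⟨u, u', h1, h2, h3, h4⟩ := exists_dual_pair hli
    rw [← sum_homogeneousComponent f]
    refine Subalgebra.sum_mem _ fun i _ => ?_
    by_cases hi : homogeneousComponent i f = 0
    · rw [hi]
      exact Subalgebra.zero_mem _
    refine mem_range_aeval_linForm_of_map (L := A) hli ?_
    let l : A × A → MvPolynomial (Fin n) A := fun p =>
      linForm fun j => p.1 * φ (c j) + p.2 * φ (c' j)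
    have hl (p : A × A) : l p = C p.1 * linForm (fun j => φ (c j)) +
        C p.2 * linForm (fun j => φ (c' j)) := linForm_smul_add_smul _ _ _ _
    have hpush (v w : Fin n → K) : ∑ j, φ (v j) * φ (w j) = φ (∑ j, v j * w j) := by simp
    obtain ⟨N, hN⟩ := dvd_pow_prod_of_zeros_subset hfin.toFinset l
      (map φ (homogeneousComponent i f)) fun x hx => by
        have hx' := hW.subset (Set.mem_biUnion (show i ∈ {i | _} from hi) hx)
        simp only [Set.mem_iUnion, exists_prop] at hx'
        obtain ⟨p, hp, h⟩ := hx'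
        exact ⟨p, hfin.mem_toFinset.2 hp, (eval_linForm _ x).trans h⟩
    refine mem_subalgebra_of_dvd_pow_prod _ hfin.toFinset l (fun p hp => ?_) (fun p _ => ?_) N _ hN
    · refine (isHomogeneous_linForm _).totalDegree fun h0 => hS0 p (hfin.mem_toFinset.1 hp) ?_
      have e (w : Fin n → K) : p.1 * φ (∑ j, c j * w j) + p.2 * φ (∑ j, c' j * w j) = 0 := by
        have := congrArg (eval fun j => φ (w j)) h0
        rwa [eval_linForm, hrow, hpush, hpush, map_zero] at this
      ext
      · simpa [h1, h2] using e u
      · simpa [h3, h4] using e u'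
    · refine ⟨C p.1 * X 0 + C p.2 * X 1, ?_⟩
      rw [hl]
      simp [algebraMap_eq, φ]
end

section
/- Let K be a number field with algebraic closure K̄ (so that K̄ is also a separable closure of K, since char K = 0), let n ≥ 3, and let f ∈ K[x_1,…,x_n] be a non-constant polynomial. Then f is NCC over K if and only if f, viewed as a polynomial in K̄[x_1,…,x_n] via the inclusion K ⊆ K̄, is NCC over K̄. -/
open MvPolynomial

/-- The chain rule for a derivation evaluated on a polynomial expression. -/
theorem derivation_aeval_eq_sum {R A σ : Type*} [Fintype σ] [CommRing R] [CommRing A] [Algebra R A]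
    (D : Derivation R A A) (x : σ → A) (p : MvPolynomial σ R) :
    D (aeval x p) = ∑ i, aeval x (pderiv i p) * D (x i) := by
  classical
  induction p using MvPolynomial.induction_on with
  | C a => simp
  | add p q hp hq => simp [hp, hq, add_mul, Finset.sum_add_distrib]
  | mul_X p j hp =>
    simp only [map_mul, aeval_X, Derivation.leibniz, smul_eq_mul, hp, pderiv_X, map_add, add_mul,
      Finset.sum_add_distrib, Finset.mul_sum]
    congr 1
    · rw [Finset.sum_eq_single j]
      · simp
      · intro i _ hij
        simp [hij.symm]
      · simp
    · exact Finset.sum_congr rfl fun i _ => by ring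

/-- A polynomial with vanishing directional derivative along `v` is invariant under translation
by `v`, in characteristic zero. -/
theorem eval_add_eq_of_sum_pderiv_eq_zero {K : Type*} [Field K] [CharZero K] {n : ℕ}
    (f : MvPolynomial (Fin n) K) (v : Fin n → K) (hv : ∑ i, v i • pderiv i f = 0)
    (x : Fin n → K) : eval (x + v) f = eval x f := by
  let y : Fin n → Polynomial K := fun i => Polynomial.C (x i) + Polynomial.C (v i) * Polynomial.X
  have hd : Polynomial.derivative (aeval y f) = 0 := by
    have h := derivation_aeval_eq_sum (Polynomial.derivative' (R := K)) y f
    have h' := congrArg (aeval y) hv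
    simp only [map_sum, map_smul, map_zero] at h'
    change Polynomial.derivative (aeval y f) = _ at h
    rw [h, ← h']
    refine Finset.sum_congr rfl fun i _ => ?_
    change _ * Polynomial.derivative (y i) = _
    rw [Polynomial.smul_eq_C_mul, mul_comm]
    simp [y]
  have hc := Polynomial.eq_C_of_derivative_eq_zero hd
  have key (t : K) : (aeval y f).eval t = eval (fun i => x i + v i * t) f := by
    rw [← Polynomial.coe_aeval_eq_eval, ← MvPolynomial.coe_aeval_eq_eval, RingHom.coe_coe,
      ← AlgHom.comp_apply, MvPolynomial.comp_aeval]
    simp [y]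
  have h1 := key 1
  have h0 := key 0
  rw [hc, Polynomial.eval_C] at h0 h1
  simp only [mul_one, mul_zero, add_zero] at h0 h1
  exact h1.symm.trans h0

/-- Linear independence of polynomials is preserved by extension of scalars. -/
theorem linearIndependent_map_algebraMap {K L ι σ : Type*} [Field K] [Field L] [Algebra K L]
    [Fintype ι] {p : ι → MvPolynomial σ K} (hp : LinearIndependent K p) :
    LinearIndependent L fun i => map (algebraMap K L) (p i) := by
  rw [Fintype.linearIndependent_iff] at hp ⊢
  intro t ht i
  rw [← Module.forall_dual_apply_eq_zero_iff K]
  intro φ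
  refine hp (fun j => φ (t j)) ?_ i
  ext m
  have h := congrArg (fun q => φ (coeff m q)) ht
  simp only [coeff_sum, coeff_smul, coeff_map, smul_eq_mul, map_sum, coeff_zero, map_zero] at h ⊢
  rw [← h]
  refine Finset.sum_congr rfl fun j _ => ?_
  rw [mul_comm (t j), ← Algebra.smul_def, map_smul, smul_eq_mul, mul_comm]

/-- The linear map sending a direction to the corresponding directional derivative of `f`. -/
noncomputable def directionalDeriv {K : Type*} [Field K] {n : ℕ} (f : MvPolynomial (Fin n) K) :
    (Fin n → K) →ₗ[K] MvPolynomial (Fin n) K :=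
  Fintype.linearCombination K fun i => pderiv i f

theorem directionalDeriv_apply {K : Type*} [Field K] {n : ℕ} (f : MvPolynomial (Fin n) K)
    (v : Fin n → K) : directionalDeriv f v = ∑ i, v i • pderiv i f := rfl

/-- In characteristic zero, `f` is a polynomial in two linear forms as soon as its partial
derivatives span a space of dimension at most two. -/
theorem not_isNCC_of_finrank_range_le {K : Type*} [Field K] [CharZero K] {n : ℕ}
    (f : MvPolynomial (Fin n) K)
    (h : Module.finrank K (LinearMap.range (directionalDeriv f)) ≤ 2) : ¬ IsNCC f := by
  obtain ⟨ι, hι⟩ := (finrank_le_iff_exists_linearMap (R := K)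
    (M := LinearMap.range (directionalDeriv f)) (M' := Fin 2 → K)).1 (by simpa using h)
  obtain ⟨ρ, hρ⟩ := ι.exists_leftInverse_of_injective (LinearMap.ker_eq_bot.2 hι)
  obtain ⟨s, hs⟩ := (directionalDeriv f).rangeRestrict.exists_rightInverse_of_surjective
    (LinearMap.range_rangeRestrict _)
  let α := ι ∘ₗ (directionalDeriv f).rangeRestrict
  let β := s ∘ₗ ρ
  have hαβ (x) : directionalDeriv f (β (α x)) = directionalDeriv f x := by
    have h1 := LinearMap.congr_fun hρ ((directionalDeriv f).rangeRestrict x)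
    have h2 := LinearMap.congr_fun hs ((directionalDeriv f).rangeRestrict x)
    simp only [LinearMap.comp_apply, LinearMap.id_apply] at h1 h2
    simp only [α, β, LinearMap.comp_apply, h1]
    exact congrArg Subtype.val h2
  have hf (x) : eval (β (α x)) f = eval x f := by
    have := eval_add_eq_of_sum_pderiv_eq_zero f (β (α x) - x)
      (by rw [← directionalDeriv_apply, map_sub, hαβ, sub_self]) x
    rwa [add_sub_cancel] at this
  have lin (m k : ℕ) (γ : (Fin m → K) →ₗ[K] (Fin k → K)) (x : Fin m → K) (j : Fin k) :
      eval x (linForm fun i => γ (Pi.single i 1) j) = γ x j := by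
    have hsingle (i : Fin m) : (Pi.single i 1 : Fin m → K) = fun j => if i = j then 1 else 0 := by
      ext j
      simp [Pi.single_apply, eq_comm]
    rw [LinearMap.pi_apply_eq_sum_univ γ x]
    simp [linForm, hsingle, mul_comm]
  intro hN
  refine hN ⟨fun i => α (Pi.single i 1) 0, fun i => α (Pi.single i 1) 1,
    aeval (fun j => linForm fun i => β (Pi.single i 1) j) f, MvPolynomial.funext fun x => ?_⟩
  have hev (m k : ℕ) (y : Fin k → MvPolynomial (Fin m) K) (p : MvPolynomial (Fin k) K)
      (x : Fin m → K) : eval x (aeval y p) = eval (fun i => eval x (y i)) p := by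
    simp only [← MvPolynomial.coe_aeval_eq_eval, RingHom.coe_coe, ← AlgHom.comp_apply,
      MvPolynomial.comp_aeval]
  have hα : (fun i => eval x ((![linForm fun i => α (Pi.single i 1) 0,
      linForm fun i => α (Pi.single i 1) 1] : Fin 2 → MvPolynomial (Fin n) K) i)) = α x := by
    ext j
    fin_cases j
    · exact lin _ _ α x 0
    · exact lin _ _ α x 1
  rw [hev, hα, hev]
  simp only [lin]
  exact (hf x).symm

/-- If `f` is a polynomial in two linear forms over an extension field, then its partial
derivatives span a space of dimension at most two. -/
theorem finrank_range_directionalDeriv_le {K L : Type*} [Field K] [Field L] [Algebra K L] {n : ℕ}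
    (f : MvPolynomial (Fin n) K) (h : ¬ IsNCC (map (algebraMap K L) f)) :
    Module.finrank K (LinearMap.range (directionalDeriv f)) ≤ 2 := by
  classical
  obtain ⟨c, c', g, hg⟩ := not_not.1 h
  let P : Fin 2 → MvPolynomial (Fin n) L := fun k => aeval ![linForm c, linForm c'] (pderiv k g)
  have hlin (i : Fin n) (c : Fin n → L) : pderiv i (linForm c) = C (c i) := by
    simp [linForm, pderiv_X, Pi.single_apply]
  have hmem (q : LinearMap.range (directionalDeriv f)) :
      map (algebraMap K L) (q : MvPolynomial (Fin n) K) ∈ Submodule.span L (Set.range P) := by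
    obtain ⟨-, v, rfl⟩ := q
    simp only [directionalDeriv_apply, map_sum, smul_eq_C_mul, map_mul, map_C]
    refine Submodule.sum_mem _ fun i _ => ?_
    rw [← smul_eq_C_mul, ← pderiv_map, hg, derivation_aeval_eq_sum]
    refine Submodule.smul_mem _ _ (Submodule.sum_mem _ fun k _ => ?_)
    obtain ⟨a, ha⟩ : ∃ a : L, pderiv i ((![linForm c, linForm c'] :
        Fin 2 → MvPolynomial (Fin n) L) k) = C a := by
      fin_cases k
      · exact ⟨_, hlin i c⟩
      · exact ⟨_, hlin i c'⟩
    rw [ha, mul_comm, ← smul_eq_C_mul]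
    exact Submodule.smul_mem _ _ (Submodule.subset_span ⟨k, rfl⟩)
  let b := Module.finBasis K (LinearMap.range (directionalDeriv f))
  have hb := linearIndependent_map_algebraMap (L := L)
    (b.linearIndependent.map' (Submodule.subtype _) (Submodule.ker_subtype _))
  have hb' : LinearIndependent L fun i =>
      (⟨map (algebraMap K L) (b i : MvPolynomial (Fin n) K), hmem (b i)⟩ :
        Submodule.span L (Set.range P)) :=
    LinearIndependent.of_comp (Submodule.subtype _) hb
  have := FiniteDimensional.span_of_finite L (Set.finite_range P)
  have h1 := hb'.fintype_card_le_finrank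
  have h2 := finrank_range_le_card (R := L) P
  rw [Fintype.card_fin] at h1 h2
  exact h1.trans h2

/-- Being a polynomial in two linear forms is preserved by extension of scalars. -/
theorem IsNCC.of_map {K L : Type*} [CommSemiring K] [CommSemiring L] (φ : K →+* L) {n : ℕ}
    {f : MvPolynomial (Fin n) K} (h : IsNCC (map φ f)) : IsNCC f := by
  rintro ⟨c, c', g, rfl⟩
  refine h ⟨φ ∘ c, φ ∘ c', map φ g, ?_⟩
  have hlin (c : Fin n → K) : map φ (linForm c) = linForm (φ ∘ c) := by simp [linForm]
  clear h
  induction g using MvPolynomial.induction_on with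
  | C a => simp [algebraMap_eq]
  | add p q hp hq => simp only [map_add, hp, hq]
  | mul_X p j hp =>
    simp only [map_mul, hp, aeval_X, map_X]
    congr 1
    fin_cases j
    · exact hlin c
    · exact hlin c'

/-- For a number field `K` (so that the algebraic closure is also a separable closure), a
non-constant polynomial `f ∈ K[x₁,…,xₙ]` with `n ≥ 3` is NCC over `K` iff it is NCC over the
algebraic closure of `K`. -/
theorem isNCC_iff_isNCC_algebraicClosure (K : Type*) [Field K] [NumberField K] (n : ℕ)
    (hn : 3 ≤ n) (f : MvPolynomial (Fin n) K) (hf : 0 < f.totalDegree) :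
    IsNCC f ↔ IsNCC (MvPolynomial.map (algebraMap K (AlgebraicClosure K)) f) := by
  exact ⟨fun h => by_contra fun h' => not_isNCC_of_finrank_range_le f
      (finrank_range_directionalDeriv_le f h') h, IsNCC.of_map _⟩
end
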